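/- arXiv:math/9808118 — 2 statements merged into one kernel-verified Lean document; each statement's English description precedes it below -/
import Mathlib

section
/- Let c and d each be a nonnegative integer or half-integer and let n > p ≥ 0 be integers, with d ≥ 1 if p ≥ 1 (so that (d^{n−p},(d−1)^p) is a partition or half-partition). Then, as an identity of rational functions (in y_1,…,y_n with x_j = y_j^2 when half-integer exponents occur), so_{2n+1}((c^n); x^{±1}) · so_{2n+1}((d^{n−p},(d−1)^p); x^{±1}) = Σ_ν c_{n,p}(ν) · so_{2n+1}(ν; x^{±1}), where ν ranges over all partitions if c+d is an integer, resp. all half-partitions if c+d is a half-integer, with exactly n parts (zero parts allowed in the partition case) satisfying ν_i ≥ |c−d| for 1 ≤ i ≤ n−p, ν_i ≥ max{c−d, d−c−1} for n−p < i ≤ n, ν_i ≤ c+d and c+d−ν_i ∈ ℤ for all i; here c_{n,p}(ν) is the number of partitions (resp. half-partitions) μ of the same kind, with exactly n parts, such that ν ⊆ μ, μ/ν is a vertical strip with exactly p − m_{d−c−1}(ν) cells (i.e. 0 ≤ μ_i − ν_i ≤ 1 for all i, with exactly p − m_{d−c−1}(ν) indices i with μ_i = ν_i + 1), and for every index i with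 μ_i = ν_i + 1 the added cell's column index ν_i + 1 is different from d−c, from c−d+1, and from c+d+1; m_l(ν) denotes the multiplicity of l among the parts of ν. -/
open scoped Classical
open Finset

noncomputable section

/-- The field of rational functions in `n` variables over `ℚ`. -/
abbrev FF (n : ℕ) : Type := FractionRing (MvPolynomial (Fin n) ℚ)

/-- The variables, as elements of the rational function field. -/
def Xv (n : ℕ) : Fin n → FF n := fun i =>
  algebraMap (MvPolynomial (Fin n) ℚ) (FF n) (MvPolynomial.X i)

/-- Irreducible odd orthogonal character `so_{2n+1}(λ; x^{±1})`, written in the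
variables `y` where `x_j = y_j²`; here `L` is the doubled index, `L = 2λ`. -/
def soOdd {F : Type} [Field F] (n : ℕ) (L : Fin n → ℤ) (y : Fin n → F) : F :=
  Matrix.det (Matrix.of fun i j : Fin n =>
    y j ^ (L i + 2 * (n : ℤ) - 2 * ((i : ℕ) : ℤ) - 1) -
      y j ^ (-(L i + 2 * (n : ℤ) - 2 * ((i : ℕ) : ℤ) - 1))) /
  Matrix.det (Matrix.of fun i j : Fin n =>
    y j ^ (2 * (n : ℤ) - 2 * ((i : ℕ) : ℤ) - 1) -
      y j ^ (-(2 * (n : ℤ) - 2 * ((i : ℕ) : ℤ) - 1)))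


/-- `c_{n,p}(ν)` in doubled coordinates (`V = 2ν`, `C = 2c`, `D = 2d`): the number
of (half-)partitions `μ` (`W = 2μ`) obtained from `ν` by adding a vertical strip
of length `p - m_{d-c-1}(ν)` avoiding the columns `d-c`, `c-d+1` and `c+d+1`. -/
def cCoeff (n C D p : ℕ) (V : Fin n → ℤ) : ℕ :=
  ((Fintype.piFinset fun i : Fin n => Finset.Icc (V i) (V i + 2)).filter
    (fun W => (∀ i, W i = V i ∨ W i = V i + 2) ∧
      (∀ i j : Fin n, i ≤ j → W j ≤ W i) ∧
      (((Finset.univ.filter (fun i : Fin n => W i = V i + 2)).card : ℤ)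
        = (p : ℤ) - ((Finset.univ.filter
            (fun i : Fin n => V i = (D : ℤ) - (C : ℤ) - 2)).card : ℤ)) ∧
      (∀ i, W i = V i + 2 →
        W i ≠ (D : ℤ) - (C : ℤ) ∧ W i ≠ (C : ℤ) - (D : ℤ) + 2 ∧
          W i ≠ (C : ℤ) + (D : ℤ) + 2))).card


section Ext

variable {K : Type} [Field K] {n : ℕ}

/-- Top degree functional on the exterior algebra of `K^n`. -/
def topL (K : Type) [Field K] (n : ℕ) : ExteriorAlgebra K (Fin n → K) →ₗ[K] K :=
  ExteriorAlgebra.liftAlternating (fun i =>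
    if h : i = n then
      (Matrix.detRowAlternating (n := Fin n) (R := K)).domDomCongr (finCongr h.symm)
    else 0)

lemma topL_iMulti (v : Fin n → (Fin n → K)) :
    topL K n (ExteriorAlgebra.ιMulti K n v) = Matrix.det (Matrix.of v) := by
  unfold topL
  rw [ExteriorAlgebra.liftAlternating_apply_ιMulti]
  simp only [dif_pos]
  rfl

lemma topL_iMulti_ne {m : ℕ} (h : m ≠ n) (v : Fin m → (Fin n → K)) :
    topL K n (ExteriorAlgebra.ιMulti K m v) = 0 := by
  unfold topL
  rw [ExteriorAlgebra.liftAlternating_apply_ιMulti]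
  simp [h]

/-- diagonal map -/
def dg (d : Fin n → K) : (Fin n → K) →ₗ[K] (Fin n → K) where
  toFun v := fun j => d j * v j
  map_add' := by intro a b; funext j; simp [mul_add]
  map_smul' := by intro a b; funext j; simp; ring

lemma topL_map (d : Fin n → K) (x : ExteriorAlgebra K (Fin n → K)) :
    topL K n (ExteriorAlgebra.map (dg d) x) = (∏ j, d j) * topL K n x := by
  have : (topL K n) ∘ₗ (ExteriorAlgebra.map (dg d)).toLinearMap = (∏ j, d j) • topL K n := by
    apply ExteriorAlgebra.lhom_ext
    intro i
    ext v
    simp only [LinearMap.compAlternatingMap_apply, LinearMap.comp_apply, AlgHom.toLinearMap_apply,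
      ExteriorAlgebra.map_apply_ιMulti, LinearMap.smul_apply, smul_eq_mul]
    by_cases h : i = n
    · subst h
      rw [topL_iMulti, topL_iMulti, ← Matrix.det_mul_row]
      rfl
    · rw [topL_iMulti_ne h, topL_iMulti_ne h, mul_zero]
  exact congrArg (fun f => f x) this

/-- Descending ordered product `(1+f (N-1)) ⋯ (1+f 0)`. -/
def descP (f : ℕ → (Fin n → K)) : ℕ → ExteriorAlgebra K (Fin n → K)
  | 0 => 1
  | N + 1 => (1 + ExteriorAlgebra.ι K (f N)) * descP f N

lemma map_descP (d : Fin n → K) (f : ℕ → (Fin n → K)) (N : ℕ) :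
    ExteriorAlgebra.map (dg d) (descP f N) = descP (fun k => dg d (f k)) N := by
  induction N with
  | zero => simp [descP]
  | succ N ih => simp [descP, ih]

/-- The `e_j`-component of the ordered product. -/
def kE (ζ : ℕ → K) (w : ℕ → (Fin n → K)) : ℕ → ExteriorAlgebra K (Fin n → K)
  | 0 => 0
  | N + 1 => (1 - ExteriorAlgebra.ι K (w N)) * kE ζ w N + ζ N • descP w N

/-- The three-term recursion, invariant under inversion of the removed variable. -/
def qE (t : K) (w : ℕ → (Fin n → K)) : ℕ → ExteriorAlgebra K (Fin n → K)
  | 0 => 0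
  | 1 => 1
  | N + 2 => t • qE t w (N + 1) + ExteriorAlgebra.ι K (w N) * qE t w (N + 1) - qE t w N

lemma descP_split (e : Fin n → K) (ζ : ℕ → K) (w : ℕ → (Fin n → K)) (N : ℕ) :
    descP (fun k => ζ k • e + w k) N = descP w N + ExteriorAlgebra.ι K e * kE ζ w N := by
  induction N with
  | zero => simp [descP, kE]
  | succ N ih =>
    have h1 := ExteriorAlgebra.ι_sq_zero (R := K) e
    have h2 : ExteriorAlgebra.ι K (w N) * ExteriorAlgebra.ι K e =
        - (ExteriorAlgebra.ι K e * ExteriorAlgebra.ι K (w N)) :=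
      eq_neg_of_add_eq_zero_left (ExteriorAlgebra.ι_add_mul_swap _ _)
    simp only [descP, kE, ih, map_add, map_smul]
    generalize ExteriorAlgebra.ι K (w N) = a at *
    generalize ExteriorAlgebra.ι K e = b at *
    have h3 : ∀ x, a * (b * x) = - (b * (a * x)) := by
      intro x; rw [← mul_assoc, h2, neg_mul, mul_assoc]
    have h4 : ∀ x, b * (b * x) = 0 := by
      intro x; rw [← mul_assoc, h1, zero_mul]
    simp only [add_mul, mul_add, one_mul, sub_mul, mul_sub, h3, smul_mul_assoc, mul_smul_comm, h4,
      smul_zero]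
    abel

lemma kE_three (ζ : ℕ → K) (z : K) (hz : ∀ k, ζ (k + 1) = z * ζ k) (w : ℕ → (Fin n → K)) (N : ℕ) :
    kE ζ w (N + 2) = (1 + z) • kE ζ w (N + 1)
      - ExteriorAlgebra.ι K (w (N + 1)) * kE ζ w (N + 1)
      + z • (ExteriorAlgebra.ι K (w N) * kE ζ w (N + 1)) - z • kE ζ w N := by
  have h1 := ExteriorAlgebra.ι_sq_zero (R := K) (w N)
  have key : (1 + ExteriorAlgebra.ι K (w N)) * kE ζ w (N + 1) =
      kE ζ w N + ζ N • descP w (N + 1) := by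
    simp only [kE, descP]
    generalize ExteriorAlgebra.ι K (w N) = a at *
    have h4 : ∀ x, a * (a * x) = 0 := by
      intro x; rw [← mul_assoc, h1, zero_mul]
    simp only [add_mul, mul_add, one_mul, sub_mul, mul_sub, mul_smul_comm, h4,
      smul_add]
    abel
  have h5 : ExteriorAlgebra.ι K (w N) * kE ζ w (N + 1) =
      kE ζ w N + ζ N • descP w (N + 1) - kE ζ w (N + 1) := by
    rw [← key]; noncomm_ring
  rw [h5]
  rw [show kE ζ w (N + 2) = (1 - ExteriorAlgebra.ι K (w (N+1))) * kE ζ w (N+1)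
    + ζ (N+1) • descP w (N+1) from rfl, hz]
  simp only [sub_mul, one_mul, smul_sub, smul_add, add_smul, one_smul, smul_smul]
  abel

/-- doubled power vectors -/
def pw (N : ℕ) (y : Fin n → K) (k : ℕ) : Fin n → K :=
  fun j => y j ^ (2 * (k : ℤ) - ((N : ℤ) - 1))

/-- Sum of all maximal minors of the power matrix with exponents symmetric about `0`. -/
def GN (N : ℕ) (y : Fin n → K) : K := topL K n (descP (pw N y) N)

lemma kE_eq (N : ℕ) (y : Fin n → K) (hy : ∀ j, y j ≠ 0) (j : Fin n) (k : ℕ) :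
    kE (fun k => y j ^ (2 * (k : ℤ) - ((N : ℤ) - 1))) (fun k => Function.update (pw N y k) j 0) k
    = (y j ^ ((k : ℤ) - N)) • ExteriorAlgebra.map
      (dg (Function.update (fun i => y j - y i ^ 2 / y j) j 1))
      (qE (y j + (y j)⁻¹) (fun k => Function.update (pw N y k) j 0) k) := by
  have hD : ∀ k, dg (Function.update (fun i => y j - y i ^ 2 / y j) j 1)
      (Function.update (pw N y k) j 0) =
      y j • (Function.update (pw N y k) j 0) - (y j)⁻¹ • (Function.update (pw N y (k+1)) j 0) := by
    intro k
    funext i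
    by_cases h : i = j
    · subst h; simp [dg]
    · simp only [dg, LinearMap.coe_mk, AddHom.coe_mk, Function.update_of_ne h, Pi.sub_apply,
        Pi.smul_apply, smul_eq_mul, pw]
      have : (2 * ((k + 1 : ℕ) : ℤ) - ((N : ℤ) - 1)) = (2 * (k : ℤ) - ((N : ℤ) - 1)) + 2 := by
        push_cast; ring
      rw [this, zpow_add₀ (hy i)]
      have := hy j
      field_simp
  induction k using Nat.twoStepInduction with
  | zero => simp [kE, qE]
  | one =>
    simp only [kE, qE, descP, map_one, mul_zero, zero_add]
    congr 2
    push_cast; ring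
  | more k ih1 ih2 =>
    rw [kE_three _ (y j ^ 2), ih1, ih2]
    · simp only [qE, map_sub, map_add, map_mul, map_smul, ExteriorAlgebra.map_apply_ι, hD]
      have e1 : ((k + 2 : ℕ) : ℤ) - N = ((k : ℤ) - N) + 2 := by push_cast; ring
      have e2 : ((k + 1 : ℕ) : ℤ) - N = ((k : ℤ) - N) + 1 := by push_cast; ring
      rw [e1, e2, zpow_add₀ (hy j), zpow_add₀ (hy j)]
      generalize y j ^ ((k : ℤ) - N) = c
      simp only [sub_mul, add_mul, smul_sub, smul_add, smul_mul_assoc, mul_smul_comm, smul_smul,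
        mul_add]
      have hj := hy j
      have f1 : c * y j ^ (2:ℤ) * (y j)⁻¹ = c * y j := by
        norm_cast; field_simp
      have f2 : c * y j ^ (2:ℤ) * y j = y j ^ 2 * (c * y j ^ (1:ℤ)) := by
        norm_cast; ring
      rw [f1, f2]
      simp only [zpow_one, one_mul, add_smul]
      rw [show c * y j ^ (2:ℤ) = y j ^ 2 * c by norm_cast; ring]
      abel
    · intro k
      have : (2 * ((k + 1 : ℕ) : ℤ) - ((N : ℤ) - 1)) = (2 * (k : ℤ) - ((N : ℤ) - 1)) + 2 := by
        push_cast; ring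
      rw [this, zpow_add₀ (hy j)]
      norm_cast
      ring

lemma GN_formula (N : ℕ) (y : Fin n → K) (hy : ∀ j, y j ≠ 0) (j : Fin n) :
    GN N y = (∏ i, (Function.update (fun i => y j - y i ^ 2 / y j) j 1 : Fin n → K) i) *
      topL K n (ExteriorAlgebra.ι K (Pi.single j 1) *
        qE (y j + (y j)⁻¹) (fun k => Function.update (pw N y k) j 0) N) := by
  have h0 : pw N y = fun k : ℕ => (y j ^ (2 * (k : ℤ) - ((N : ℤ) - 1))) • (Pi.single j 1 : Fin n → K)
      + Function.update (pw N y k) j 0 := by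
    funext k i
    by_cases h : i = j
    · subst h; simp [pw]
    · simp [h]
  unfold GN
  refine (congrArg (fun f => topL K n (descP f N)) h0).trans ?_
  rw [descP_split (Pi.single j 1) (fun k => y j ^ (2 * (k : ℤ) - ((N : ℤ) - 1)))
    (fun k => Function.update (pw N y k) j 0), map_add]
  have h1 : descP (fun k => Function.update (pw N y k) j 0) N = ExteriorAlgebra.map
      (dg (Function.update 1 j 0)) (descP (fun k => Function.update (pw N y k) j 0) N) := by
    rw [map_descP]
    congr 1
    funext k i
    by_cases h : i = j
    · subst h; simp [dg]
    · simp [dg, h]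
  rw [h1, topL_map, Finset.prod_eq_zero (Finset.mem_univ j) (by simp), zero_mul, zero_add,
    kE_eq N y hy j N]
  rw [sub_self, zpow_zero, one_smul, ← topL_map, map_mul (ExteriorAlgebra.map _), ExteriorAlgebra.map_apply_ι]
  congr 3
  funext i
  by_cases h : i = j
  · subst h; simp [dg]
  · simp [dg, h]

lemma GN_flip (N M : ℕ) (y : Fin n → K) (hy : ∀ j, y j ≠ 0) (j : Fin n) :
    GN N (Function.update y j (y j)⁻¹) * GN M y = GN N y * GN M (Function.update y j (y j)⁻¹) := by
  have hy' : ∀ i, Function.update y j (y j)⁻¹ i ≠ 0 := by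
    intro i
    by_cases h : i = j
    · subst h; simpa using hy i
    · simpa [h] using hy i
  have hp : ∀ N, (fun k => Function.update (pw N (Function.update y j (y j)⁻¹) k) j 0) =
      fun k => Function.update (pw N y k) j 0 := by
    intro N
    funext k i
    by_cases h : i = j
    · subst h; simp
    · simp [h, pw]
  rw [GN_formula N _ hy' j, GN_formula M _ hy' j, GN_formula N _ hy j, GN_formula M _ hy j, hp, hp]
  simp only [Function.update_self, inv_inv]
  rw [add_comm (y j)⁻¹]
  ring

end Ext

section Sums

variable {K : Type} [Field K] {n : ℕ}

lemma descP_eq_sum (f : ℕ → (Fin n → K)) (N : ℕ) :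
    descP f N = ∑ A ∈ (range N).powerset,
      ((A.sort (· ≥ ·)).map (fun a => ExteriorAlgebra.ι K (f a))).prod := by
  induction N with
  | zero => simp [descP]
  | succ N ih =>
    rw [Finset.range_add_one, Finset.sum_powerset_insert (by simp)]
    rw [descP, add_mul, one_mul, ih, Finset.mul_sum]
    congr 1
    apply Finset.sum_congr rfl
    intro A hA
    rw [Finset.mem_powerset] at hA
    have hlt : ∀ b ∈ A, b < N := fun b hb => Finset.mem_range.1 (hA hb)
    rw [Finset.sort_insert (· ≥ ·) (fun b hb => (hlt b hb).le) (fun h => lt_irrefl _ (hlt N h))]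
    simp

/-- Partitions with `n` parts, all at most `M`. -/
def boxF (n M : ℕ) : Finset (Fin n → ℕ) :=
  (Fintype.piFinset fun _ : Fin n => range (M + 1)).filter (fun w => ∀ i j : Fin n, i ≤ j → w j ≤ w i)

lemma mem_boxF {M : ℕ} {w : Fin n → ℕ} :
    w ∈ boxF n M ↔ (∀ i, w i ≤ M) ∧ ∀ i j : Fin n, i ≤ j → w j ≤ w i := by
  simp [boxF]

lemma sort_image (J : Fin n → ℕ) (hJ : StrictAnti J) :
    (Finset.univ.image J).sort (· ≥ ·) = List.ofFn J := by
  apply List.Perm.eq_of_pairwise (le := (· ≥ ·))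
  · intro a b _ _ h1 h2; exact le_antisymm h2 h1
  · exact Finset.pairwise_sort _ _
  · rw [List.pairwise_ofFn]
    intro i j hij
    exact (hJ hij).le
  · apply (List.perm_ext_iff_of_nodup (Finset.sort_nodup _ _) (List.nodup_ofFn.2 hJ.injective)).2
    intro a
    simp [List.mem_ofFn]

lemma topL_descP (f : ℕ → (Fin n → K)) (M : ℕ) :
    topL K n (descP f (M + n)) =
      ∑ w ∈ boxF n M, Matrix.det (Matrix.of fun i : Fin n => f (w i + (n - 1 - i))) := by
  rw [descP_eq_sum, map_sum]
  have hsub : Finset.powersetCard n (range (M + n)) ⊆ (range (M + n)).powerset := by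
    intro A hA
    exact Finset.mem_powerset.2 (Finset.mem_powersetCard.1 hA).1
  rw [← Finset.sum_subset hsub]
  · symm
    have hanti : ∀ w ∈ boxF n M, StrictAnti (fun i : Fin n => w i + (n - 1 - i)) := by
      intro w hw i j hij
      have := (mem_boxF.1 hw).2 i j hij.le
      have h2 : (i : ℕ) < j := hij
      have := j.2
      show w j + (n - 1 - j) < w i + (n - 1 - i)
      omega
    refine Finset.sum_bij (fun w _ => Finset.univ.image (fun i : Fin n => w i + (n - 1 - i)))
      ?_ ?_ ?_ ?_
    · intro w hw
      rw [Finset.mem_powersetCard]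
      constructor
      · intro a ha
        simp only [Finset.mem_image, Finset.mem_univ, true_and] at ha
        obtain ⟨i, rfl⟩ := ha
        have := (mem_boxF.1 hw).1 i
        have := i.2
        rw [Finset.mem_range]; omega
      · rw [Finset.card_image_of_injective _ (hanti w hw).injective]; simp
    · intro w hw w' hw' h
      have h3 := congrArg (fun A => A.sort (· ≥ ·)) h
      simp only [sort_image _ (hanti w hw), sort_image _ (hanti w' hw')] at h3
      have h4 := List.ofFn_injective h3
      funext i
      have := congrFun h4 i
      omega
    · intro A hA
      rw [Finset.mem_powersetCard] at hA
      let J : Fin n → ℕ := fun i => A.orderEmbOfFin hA.2 (Fin.rev i)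
      have hJ : StrictAnti J := by
        intro i j hij
        exact (A.orderEmbOfFin hA.2).strictMono (Fin.rev_lt_rev.2 hij)
      have hJN : ∀ i, J i < M + n := fun i =>
        Finset.mem_range.1 (hA.1 (Finset.orderEmbOfFin_mem A hA.2 _))
      have hgap : ∀ k : ℕ, ∀ i j : Fin n, (j : ℕ) = i + k → J j + k ≤ J i := by
        intro k
        induction k with
        | zero => intro i j h; have : i = j := Fin.ext (by omega); subst this; simp
        | succ k ih =>
          intro i j h
          have hj := j.2
          have h1 := ih i ⟨i + k, by omega⟩ rfl
          have h2 : J j < J ⟨i + k, by omega⟩ := hJ (by rw [Fin.lt_def]; simp; omega)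
          omega
      have hlow : ∀ i : Fin n, n - 1 - i ≤ J i := by
        intro i
        have := i.2
        have := hgap (n - 1 - i) i ⟨n - 1, by omega⟩ (by simp; omega)
        omega
      refine ⟨fun i => J i - (n - 1 - i), ?_, ?_⟩
      · rw [mem_boxF]
        constructor
        · intro i
          have hi := i.2
          have h1 := hgap i ⟨0, by omega⟩ i (by simp)
          have := hJN ⟨0, by omega⟩
          omega
        · intro i j hij
          have hij' : (i : ℕ) ≤ j := hij
          have := j.2
          have h1 := hgap (j - i) i j (by omega)
          show J j - (n - 1 - j) ≤ J i - (n - 1 - i)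
          omega
      · have : (fun i : Fin n => J i - (n - 1 - i) + (n - 1 - i)) = J := by
          funext i
          have := hlow i
          omega
        rw [this]
        ext a
        simp only [Finset.mem_image, Finset.mem_univ, true_and]
        constructor
        · rintro ⟨i, rfl⟩; exact Finset.orderEmbOfFin_mem A hA.2 _
        · intro ha
          have : a ∈ Set.range (A.orderEmbOfFin hA.2) := by
            rw [Finset.range_orderEmbOfFin]; exact ha
          obtain ⟨i, hi⟩ := this
          exact ⟨Fin.rev i, by simp [J, hi]⟩
    · intro w hw
      rw [sort_image _ (hanti w hw), List.map_ofFn, ← topL_iMulti, ExteriorAlgebra.ιMulti_apply]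
      rfl
  · intro A hA hA'
    have hc : (A.sort (· ≥ ·)).length ≠ n := by
      rw [Finset.length_sort]
      intro h
      exact hA' (Finset.mem_powersetCard.2 ⟨Finset.mem_powerset.1 hA, h⟩)
    generalize A.sort (· ≥ ·) = l at hc
    rw [← topL_iMulti_ne hc (fun i => f (l.get i)), ExteriorAlgebra.ιMulti_apply]
    congr 2
    conv_lhs => rw [← List.ofFn_get l, List.map_ofFn]
    rfl

lemma topL_descP_self (f : ℕ → (Fin n → K)) :
    topL K n (descP f n) = Matrix.det (Matrix.of fun i : Fin n => f (n - 1 - i)) := by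
  have h := topL_descP f 0
  rw [zero_add] at h
  rw [h]
  have : boxF n 0 = {fun _ => 0} := by
    ext w
    rw [mem_boxF, Finset.mem_singleton]
    constructor
    · rintro ⟨h, -⟩; funext i; have := h i; omega
    · rintro rfl; simp
  rw [this, Finset.sum_singleton]
  simp

/-- two sided sequences -/
def om (a b : Fin n → K) (N : ℕ) (y : Fin n → K) (k : ℕ) : Fin n → K := fun j =>
  a j * y j ^ (2 * (k : ℤ) - ((N : ℤ) - 1)) + b j * (y j)⁻¹ ^ (2 * (k : ℤ) - ((N : ℤ) - 1))

/-- Flip the variables outside `s`. -/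
def flp (s : Finset (Fin n)) (y : Fin n → K) : Fin n → K := s.piecewise y (fun j => (y j)⁻¹)

lemma topL_om (a b y : Fin n → K) (M : ℕ) :
    topL K n (descP (om a b (M + n) y) (M + n)) =
      ∑ s : Finset (Fin n), (∏ j, s.piecewise a b j) * GN (M + n) (flp s y) := by
  unfold GN
  simp only [topL_descP, Finset.mul_sum]
  rw [Finset.sum_comm]
  apply Finset.sum_congr rfl
  intro w _
  rw [← Matrix.det_transpose]
  have h := (Matrix.detRowAlternating (n := Fin n) (R := K)).toMultilinearMap.map_add_univ
    (fun j i => a j * y j ^ (2 * ((w i + (n - 1 - i) : ℕ) : ℤ) - (((M + n : ℕ) : ℤ) - 1)))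
    (fun j i => b j * (y j)⁻¹ ^ (2 * ((w i + (n - 1 - i) : ℕ) : ℤ) - (((M + n : ℕ) : ℤ) - 1)))
  refine Eq.trans ?_ (h.trans ?_)
  · rfl
  · apply Finset.sum_congr rfl
    intro s _
    rw [← Matrix.det_transpose, ← Matrix.det_mul_column]
    change Matrix.det _ = _
    congr 1
    ext j i
    by_cases hj : j ∈ s
    · simp [hj, flp, pw]
    · simp [hj, flp, pw]

lemma flp_all (N M : ℕ) (y : Fin n → K) (hy : ∀ j, y j ≠ 0) (hV : ∀ s, GN M (flp s y) ≠ 0)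
    (t : Finset (Fin n)) :
    GN N (flp tᶜ y) * GN M y = GN N y * GN M (flp tᶜ y) := by
  induction t using Finset.induction_on with
  | empty =>
    have : flp ∅ᶜ y = y := by funext i; simp [flp]
    rw [this]
  | insert j t hj ih =>
    have h1 : flp (insert j t)ᶜ y = Function.update (flp tᶜ y) j (flp tᶜ y j)⁻¹ := by
      funext i
      by_cases h : i = j
      · subst h; simp [flp, hj]
      · simp [flp, h, Finset.piecewise]
    have hy' : ∀ i, flp tᶜ y i ≠ 0 := by
      intro i
      by_cases h : i ∈ t
      · simpa [flp, h] using hy i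
      · simpa [flp, h] using hy i
    have h2 := GN_flip N M (flp tᶜ y) hy' j
    rw [← h1] at h2
    have h3 := hV tᶜ
    apply mul_right_cancel₀ h3
    calc GN N (flp (insert j t)ᶜ y) * GN M y * GN M (flp tᶜ y)
        = (GN N (flp (insert j t)ᶜ y) * GN M (flp tᶜ y)) * GN M y := by ring
      _ = (GN N (flp tᶜ y) * GN M y) * GN M (flp (insert j t)ᶜ y) := by rw [h2]; ring
      _ = _ := by rw [ih]; ring

lemma topL_om_mul (a b y : Fin n → K) (hy : ∀ j, y j ≠ 0) (hV : ∀ s, GN n (flp s y) ≠ 0) (M : ℕ) :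
    topL K n (descP (om a b (M + n) y) (M + n)) * GN n y =
      GN (M + n) y * topL K n (descP (om a b n y) n) := by
  have h0 := topL_om a b y 0
  simp only [zero_add] at h0
  rw [h0, topL_om, Finset.sum_mul, Finset.mul_sum]
  apply Finset.sum_congr rfl
  intro s _
  have := flp_all (M + n) n y hy hV sᶜ
  rw [compl_compl] at this
  rw [mul_assoc, this]
  ring

end Sums

section Collapse

variable {K : Type} [Field K] {n : ℕ}

/-- `y^m - y^{-m}` -/
def Uv (y : Fin n → K) (m : ℤ) : Fin n → K := fun j => y j ^ m - y j ^ (-m)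

lemma Uv_neg (y : Fin n → K) (m : ℤ) : Uv y (-m) = - Uv y m := by
  funext j; simp [Uv]

lemma Uv_zero (y : Fin n → K) : Uv y 0 = 0 := by
  funext j; simp [Uv]

/-- `U_m + s U_{m+2}` -/
def vv (s : K) (y : Fin n → K) (m : ℤ) : Fin n → K := Uv y m + s • Uv y (m + 2)

/-- Weyl numerator. -/
def Nn (y : Fin n → K) (V : Fin n → ℤ) : K :=
  Matrix.det (Matrix.of fun i : Fin n => Uv y (V i + 2 * (n : ℤ) - 2 * ((i : ℕ) : ℤ) - 1))

lemma descP_add (f : ℕ → (Fin n → K)) (A B : ℕ) :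
    descP f (B + A) = descP (fun k => f (k + A)) B * descP f A := by
  induction B with
  | zero => simp [descP]
  | succ B ih => rw [Nat.add_right_comm, descP, ih, descP, mul_assoc]

lemma descP_bot (f : ℕ → (Fin n → K)) (N : ℕ) :
    descP f (N + 1) = descP (fun k => f (k + 1)) N * (1 + ExteriorAlgebra.ι K (f 0)) := by
  rw [descP_add]; simp [descP]

lemma collapse_U (y : Fin n → K) (C : ℕ) :
    descP (fun k => Uv y (1 - C + 2 * k)) C = 1 := by
  induction C using Nat.twoStepInduction with
  | zero => rfl
  | one => simp [descP, Uv_zero]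
  | more C ih _ =>
    rw [descP_bot, descP]
    have h1 : (fun k : ℕ => Uv y (1 - ((C + 2 : ℕ) : ℤ) + 2 * ((k + 1 : ℕ) : ℤ))) =
        fun k : ℕ => Uv y (1 - (C : ℤ) + 2 * k) := by
      funext k; congr 1; push_cast; ring
    rw [h1, ih]
    have h2 : (1 - ((C + 2 : ℕ) : ℤ) + 2 * ((C + 1 : ℕ) : ℤ)) = (C : ℤ) + 1 := by push_cast; ring
    have h3 : (1 - ((C + 2 : ℕ) : ℤ) + 2 * ((0 : ℕ) : ℤ)) = -((C : ℤ) + 1) := by push_cast; ring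
    rw [h2, h3, Uv_neg, map_neg]
    have := ExteriorAlgebra.ι_sq_zero (R := K) (Uv y ((C : ℤ) + 1))
    simp only [mul_one, add_mul, mul_add, one_mul, mul_neg, this]
    abel

lemma collapse_v (s : K) (y : Fin n → K) (k0 : ℕ) :
    descP (fun k => vv s y (-(k0 : ℤ) + 2 * k)) k0 = 1 + (s - 1) • ExteriorAlgebra.ι K (Uv y k0) := by
  induction k0 using Nat.twoStepInduction with
  | zero => simp [descP, Uv_zero]
  | one =>
    have h : Uv y (-1 + 2) = Uv y 1 := by norm_num
    simp [descP, vv, h, Uv_neg, sub_smul]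
    abel
  | more C ih _ =>
    rw [descP_bot, descP]
    have h1 : (fun k : ℕ => vv s y (-((C + 2 : ℕ) : ℤ) + 2 * ((k + 1 : ℕ) : ℤ))) =
        fun k : ℕ => vv s y (-(C : ℤ) + 2 * k) := by
      funext k; congr 1; push_cast; ring
    rw [h1, ih]
    have h2 : (-((C + 2 : ℕ) : ℤ) + 2 * ((C + 1 : ℕ) : ℤ)) = (C : ℤ) := by push_cast; ring
    have h3 : (-((C + 2 : ℕ) : ℤ) + 2 * ((0 : ℕ) : ℤ)) = -((C : ℤ) + 2) := by push_cast; ring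
    have h4 : -((C : ℤ) + 2) + 2 = -(C : ℤ) := by ring
    have h5 : ((C + 2 : ℕ) : ℤ) = (C : ℤ) + 2 := by push_cast; ring
    rw [h2, h3, vv, vv, h4, Uv_neg, Uv_neg, h5]
    have s1 := ExteriorAlgebra.ι_sq_zero (R := K) (Uv y (C : ℤ))
    have s2 := ExteriorAlgebra.ι_sq_zero (R := K) (Uv y ((C : ℤ) + 2))
    have s3 : ExteriorAlgebra.ι K (Uv y ((C : ℤ) + 2)) * ExteriorAlgebra.ι K (Uv y (C : ℤ)) =
        - (ExteriorAlgebra.ι K (Uv y (C : ℤ)) * ExteriorAlgebra.ι K (Uv y ((C : ℤ) + 2))) :=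
      eq_neg_of_add_eq_zero_left (ExteriorAlgebra.ι_add_mul_swap _ _)
    simp only [map_add, map_neg, map_smul]
    generalize ExteriorAlgebra.ι K (Uv y (C : ℤ)) = a at *
    generalize ExteriorAlgebra.ι K (Uv y ((C : ℤ) + 2)) = b at *
    have t1 : ∀ x, a * (a * x) = 0 := by
      intro x; rw [← mul_assoc, s1, zero_mul]
    have t2 : ∀ x, b * (b * x) = 0 := by
      intro x; rw [← mul_assoc, s2, zero_mul]
    have t3 : ∀ x, b * (a * x) = -(a * (b * x)) := by
      intro x; rw [← mul_assoc, s3, neg_mul, mul_assoc]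
    clear ih
    have q1 : (1 + (a + s • b)) * (1 + (s - 1) • a) = 1 + s • a + s • b - (s * (s - 1)) • (a * b) := by
      simp only [mul_add, add_mul, mul_one, one_mul, smul_mul_assoc, mul_smul_comm, s1, s3, smul_zero,
        smul_neg]
      module
    have q2 : (1 + s • a + s • b - (s * (s - 1)) • (a * b)) * (1 + (-b + s • -a)) = 1 + (s - 1) • b := by
      simp only [mul_add, add_mul, sub_mul, mul_one, one_mul, smul_mul_assoc, mul_smul_comm, smul_neg, mul_neg,
        mul_assoc, s1, s2, s3, t1, smul_zero, mul_zero, neg_zero]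
      module
    rw [q1, q2]

lemma om_eq (s : K) (y : Fin n → K) (hy : ∀ j, y j ≠ 0) (e : ℤ) (N k : ℕ) :
    om (fun j => (1 + s * y j ^ 2) * y j ^ e) (fun j => -((1 + s * (y j)⁻¹ ^ 2) * (y j)⁻¹ ^ e)) N y k
      = vv s y (e + (2 * k - (N - 1))) := by
  funext j
  have h := hy j
  have h' := inv_ne_zero h
  simp only [om, vv, Uv, Pi.add_apply, Pi.smul_apply, smul_eq_mul]
  rw [← inv_zpow', ← inv_zpow', zpow_add₀ h, zpow_add₀ h', zpow_add₀ h _ 2, zpow_add₀ h' _ 2,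
    zpow_add₀ h, zpow_add₀ h' e]
  norm_cast
  ring

lemma vv_main (s : K) (y : Fin n → K) (hy : ∀ j, y j ≠ 0) (hV : ∀ s, GN n (flp s y) ≠ 0)
    (d : ℤ) (C : ℕ) :
    topL K n (descP (fun k => vv s y (d - 1 - C + 2 * k)) (C + n)) * GN n y =
      GN (C + n) y * topL K n (descP (fun k => vv s y (d - 1 + 2 * k)) n) := by
  have h := topL_om_mul (fun j => (1 + s * y j ^ 2) * y j ^ (d - 2 + n))
    (fun j => -((1 + s * (y j)⁻¹ ^ 2) * (y j)⁻¹ ^ (d - 2 + n))) y hy hV C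
  have e1 : ∀ N : ℕ, om (fun j => (1 + s * y j ^ 2) * y j ^ (d - 2 + n))
    (fun j => -((1 + s * (y j)⁻¹ ^ 2) * (y j)⁻¹ ^ (d - 2 + n))) N y =
      fun k : ℕ => vv s y (d - 2 + n + (2 * k - (N - 1))) := by
    intro N; funext k; exact om_eq s y hy _ N k
  rw [e1, e1] at h
  convert h using 5
  · push_cast; ring
  · push_cast; ring

lemma Nn_const (y : Fin n → K) (c : ℤ) :
    topL K n (descP (fun k => Uv y (c + 1 + 2 * k)) n) = Nn y (fun _ => c) := by
  rw [topL_descP_self, Nn]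
  congr 2
  funext i
  have := i.2
  congr 1
  rw [Nat.cast_sub (by omega), Nat.cast_sub (by omega)]
  push_cast; ring

lemma main_id (s : K) (y : Fin n → K) (hy : ∀ j, y j ≠ 0) (hV : ∀ s, GN n (flp s y) ≠ 0)
    (C D : ℕ) :
    Nn y (fun _ => (C : ℤ)) * topL K n (descP (fun k => vv s y ((D : ℤ) - 1 + 2 * k)) n) =
      Nn y (fun _ => 0) * topL K n (descP (fun k => vv s y ((D : ℤ) - 1 - C + 2 * k)) (C + n)) := by
  have h1 := vv_main 0 y hy hV 2 C
  have h2 := vv_main s y hy hV D C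
  have hv : ∀ m, vv 0 y m = Uv y m := by intro m; simp [vv]
  simp only [hv] at h1
  have h3 : topL K n (descP (fun k : ℕ => Uv y (2 - 1 - (C : ℤ) + 2 * k)) (C + n)) =
      Nn y (fun _ => (C : ℤ)) := by
    rw [add_comm C n, descP_add]
    have e1 : (fun k : ℕ => Uv y (2 - 1 - (C : ℤ) + 2 * k)) = fun k : ℕ => Uv y (1 - C + 2 * k) := by
      funext k; congr 1
    rw [e1, collapse_U, mul_one, ← Nn_const]
    congr 3
    funext k; congr 1; push_cast; ring
  have h4 : topL K n (descP (fun k : ℕ => Uv y (2 - 1 + 2 * (k : ℤ))) n) = Nn y (fun _ => 0) := by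
    rw [← Nn_const]; congr 1
  rw [h3, h4] at h1
  have hV' : GN n y ≠ 0 := by
    have := hV univ
    rwa [show flp univ y = y by funext i; simp [flp]] at this
  apply mul_right_cancel₀ hV'
  calc _ = (Nn y (fun _ => (C : ℤ)) * GN n y) *
        topL K n (descP (fun k => vv s y ((D : ℤ) - 1 + 2 * k)) n) := by ring
    _ = Nn y (fun _ => 0) * (GN (C + n) y *
        topL K n (descP (fun k => vv s y ((D : ℤ) - 1 + 2 * k)) n)) := by rw [h1]; ring
    _ = _ := by rw [← h2]; ring

lemma GN_ne_zero (y : Fin n → K) (hy : ∀ j, y j ≠ 0) (hinj : ∀ i j, i ≠ j → y i ^ 2 ≠ y j ^ 2) :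
    GN n y ≠ 0 := by
  rw [GN, topL_descP_self]
  have : (Matrix.of fun i : Fin n => pw n y (n - 1 - i)) =
      Matrix.of fun i j => (y j ^ (-((n : ℤ) - 1))) *
        ((Matrix.vandermonde (fun j => y j ^ 2)).transpose.submatrix Fin.revPerm id) i j := by
    ext i j
    have hi := i.2
    simp only [Matrix.of_apply, pw, Matrix.submatrix_apply, Matrix.transpose_apply, id,
      Matrix.vandermonde_apply, Fin.revPerm_apply, Fin.val_rev]
    rw [← pow_mul, ← zpow_natCast, ← zpow_add₀ (hy j)]
    congr 1
    rw [Nat.cast_sub (by omega), Nat.cast_sub (by omega), Nat.cast_mul, Nat.cast_sub (by omega)]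
    push_cast; ring
  rw [this, Matrix.det_mul_row, Matrix.det_permute]
  apply mul_ne_zero
  · exact Finset.prod_ne_zero_iff.2 (fun j _ => zpow_ne_zero _ (hy j))
  · apply mul_ne_zero
    · skip
      rcases Int.units_eq_one_or (Equiv.Perm.sign (Fin.revPerm (n := n))) with h | h <;> simp [h]
    · rw [Matrix.det_transpose, Matrix.det_vandermonde_ne_zero_iff]
      intro i j h
      by_contra hne
      exact hinj i j hne h

lemma GN_flp_ne_zero (y : Fin n → K) (hy : ∀ j, y j ≠ 0) (hinj : ∀ i j, i ≠ j → y i ^ 2 ≠ y j ^ 2)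
    (hinv : ∀ i j, i ≠ j → y i ^ 2 * y j ^ 2 ≠ 1) (s : Finset (Fin n)) : GN n (flp s y) ≠ 0 := by
  apply GN_ne_zero
  · intro j
    by_cases h : j ∈ s <;> simpa [flp, h] using hy j
  · intro i j hij
    have hi := pow_ne_zero 2 (hy i)
    have hj := pow_ne_zero 2 (hy j)
    by_cases h1 : i ∈ s <;> by_cases h2 : j ∈ s <;> simp only [flp, Finset.piecewise, h1, h2, if_true, if_false, inv_pow]
    · exact hinj i j hij
    · intro h
      apply hinv i j hij
      rw [h, inv_mul_cancel₀ hj]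
    · intro h
      apply hinv i j hij
      rw [← h, mul_inv_cancel₀ hi]
    · intro h
      exact hinj i j hij (inv_injective h)

lemma Xv_facts (n : ℕ) : (∀ j, Xv n j ≠ 0) ∧ (∀ i j, i ≠ j → Xv n i ^ 2 ≠ Xv n j ^ 2) ∧
    (∀ i j, i ≠ j → Xv n i ^ 2 * Xv n j ^ 2 ≠ 1) := by
  have hinj := IsFractionRing.injective (MvPolynomial (Fin n) ℚ) (FF n)
  refine ⟨?_, ?_, ?_⟩
  · intro j h
    have h0 : (MvPolynomial.X j : MvPolynomial (Fin n) ℚ) = 0 := by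
      apply hinj; rw [map_zero]; exact h
    exact MvPolynomial.X_ne_zero j h0
  · intro i j hij h
    have h0 : (MvPolynomial.X i : MvPolynomial (Fin n) ℚ) ^ 2 = MvPolynomial.X j ^ 2 := by
      apply hinj; rw [map_pow, map_pow]; exact h
    have := congrArg (MvPolynomial.eval (fun k => if k = i then (1 : ℚ) else 0)) h0
    simp [hij.symm] at this
  · intro i j hij h
    have h0 : (MvPolynomial.X i : MvPolynomial (Fin n) ℚ) ^ 2 * MvPolynomial.X j ^ 2 = 1 := by
      apply hinj; rw [map_mul, map_pow, map_pow, map_one]; exact h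
    have := congrArg (MvPolynomial.eval (fun _ => (0 : ℚ))) h0
    simp at this

end Collapse

section Coef

variable {K : Type} [Field K] {n : ℕ}

lemma det_expand (s : K) (g h : Fin n → (Fin n → K)) :
    Matrix.det (Matrix.of fun i => g i + s • h i) =
      ∑ T : Finset (Fin n), s ^ T.card * Matrix.det (Matrix.of fun i => if i ∈ T then h i else g i) := by
  have h1 := (Matrix.detRowAlternating (R := K) (n := Fin n)).toMultilinearMap.map_add_univ
    (fun i => s • h i) g
  have e1 : Matrix.det (Matrix.of fun i => g i + s • h i) =
      (Matrix.detRowAlternating (R := K) (n := Fin n)).toMultilinearMap ((fun i => s • h i) + g) := by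
    show Matrix.det _ = Matrix.det _
    congr 1
    ext i j
    simp [add_comm]
  rw [e1, h1]
  refine Finset.sum_congr rfl fun T _ => ?_
  have h2 := (Matrix.detRowAlternating (R := K) (n := Fin n)).toMultilinearMap.map_piecewise_smul
    (fun _ => s) (fun i => if i ∈ T then h i else g i) T
  have e2 : T.piecewise (fun i => s • h i) g =
      T.piecewise (fun i => s • (if i ∈ T then h i else g i)) (fun i => if i ∈ T then h i else g i) := by
    funext i
    by_cases hi : i ∈ T <;> simp [Finset.piecewise, hi]
  rw [e2, h2, Finset.prod_const, smul_eq_mul]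
  rfl

/-- configurations -/
def cfg (n M q : ℕ) : Finset ((Fin n → ℕ) × Finset (Fin n)) :=
  (boxF n M ×ˢ (univ : Finset (Finset (Fin n)))).filter (fun x => x.2.card = q)

lemma mem_cfg {M q : ℕ} {x : (Fin n → ℕ) × Finset (Fin n)} : x ∈ cfg n M q ↔
    ((∀ i, x.1 i ≤ M) ∧ ∀ i j, i ≤ j → x.1 j ≤ x.1 i) ∧ x.2.card = q := by
  rw [cfg, Finset.mem_filter, Finset.mem_product, mem_boxF]; simp

/-- the determinant attached to a configuration -/
def trm (g h : ℕ → (Fin n → K)) (x : (Fin n → ℕ) × Finset (Fin n)) : K :=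
  Matrix.det (Matrix.of fun i : Fin n => if i ∈ x.2 then h (x.1 i + (n - 1 - i)) else g (x.1 i + (n - 1 - i)))

lemma topL_expand (s : K) (g h : ℕ → (Fin n → K)) (M : ℕ) :
    topL K n (descP (fun k => g k + s • h k) (M + n)) =
      ∑ x ∈ boxF n M ×ˢ (univ : Finset (Finset (Fin n))), s ^ x.2.card * trm g h x := by
  rw [topL_descP, Finset.sum_product]
  refine Finset.sum_congr rfl fun w _ => ?_
  rw [det_expand]
  rfl

lemma coef_eq [Infinite K] {ι κ : Type} (A : Finset ι) (B : Finset κ) (ea : ι → ℕ) (eb : κ → ℕ)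
    (a : ι → K) (b : κ → K) (c c' : K)
    (h : ∀ s : K, c * ∑ i ∈ A, s ^ ea i * a i = c' * ∑ j ∈ B, s ^ eb j * b j) (q : ℕ) :
    c * ∑ i ∈ A with ea i = q, a i = c' * ∑ j ∈ B with eb j = q, b j := by
  have hp : (Polynomial.C c * ∑ i ∈ A, Polynomial.monomial (ea i) (a i) : Polynomial K) =
      Polynomial.C c' * ∑ i ∈ B, Polynomial.monomial (eb i) (b i) := by
    apply Polynomial.funext
    intro s
    have := h s
    simp only [Polynomial.eval_mul, Polynomial.eval_C, Polynomial.eval_finsetSum, Polynomial.eval_monomial]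
    simpa only [mul_comm (s ^ _)] using this
  have := congrArg (fun P => Polynomial.coeff P q) hp
  simpa [Polynomial.finsetSum_coeff, Polynomial.coeff_monomial, Finset.sum_filter] using this

lemma cfg_eq [Infinite K] (g h g' h' : ℕ → (Fin n → K)) (M M' : ℕ) (c c' : K)
    (H : ∀ s : K, c * topL K n (descP (fun k => g k + s • h k) (M + n)) =
      c' * topL K n (descP (fun k => g' k + s • h' k) (M' + n))) (q : ℕ) :
    c * ∑ x ∈ cfg n M q, trm g h x = c' * ∑ x ∈ cfg n M' q, trm g' h' x := by
  refine coef_eq (boxF n M ×ˢ (univ : Finset (Finset (Fin n))))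
    (boxF n M' ×ˢ (univ : Finset (Finset (Fin n)))) (fun x => x.2.card) (fun x => x.2.card)
    (trm g h) (trm g' h') c c' ?_ q
  intro s
  rw [← topL_expand, ← topL_expand, H]

/-- value sequence -/
def Vc (lo : ℤ) (x : (Fin n → ℕ) × Finset (Fin n)) : Fin n → ℤ :=
  fun i => lo + 2 * (x.1 i : ℤ) - (if i ∈ x.2 then 0 else 2)

/-- antitone sequences -/
def Anti (V : Fin n → ℤ) : Prop := ∀ i j, i ≤ j → V j ≤ V i

lemma Nn_zero_of_eq (y : Fin n → K) (V : Fin n → ℤ) (i j : Fin n) (hij : i ≠ j)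
    (h : V i - 2 * (i : ℕ) = V j - 2 * (j : ℕ)) : Nn y V = 0 := by
  apply Matrix.det_zero_of_row_eq hij
  show Uv y _ = Uv y _
  congr 1
  linarith

lemma Nn_zero_of_not_anti (y : Fin n → K) (x : (Fin n → ℕ) × Finset (Fin n)) (lo : ℤ)
    (hw : ∀ i j, i ≤ j → x.1 j ≤ x.1 i) (h : ¬ Anti (Vc lo x)) : Nn y (Vc lo x) = 0 := by
  by_contra hne
  apply h
  have step : ∀ i : ℕ, ∀ (hi : i + 1 < n), Vc lo x ⟨i + 1, hi⟩ ≤ Vc lo x ⟨i, by omega⟩ := by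
    intro i hi
    by_contra hlt
    apply hne
    apply Nn_zero_of_eq y _ ⟨i, by omega⟩ ⟨i + 1, hi⟩ (by simp)
    have := hw ⟨i, by omega⟩ ⟨i + 1, hi⟩ (by simp)
    simp only [Vc] at hlt ⊢
    split_ifs at hlt ⊢ <;> push_cast <;> omega
  intro i j hij
  obtain ⟨i, hi⟩ := i
  obtain ⟨j, hj⟩ := j
  simp only [Fin.mk_le_mk] at hij
  induction j, hij using Nat.le_induction with
  | base => exact le_refl _
  | succ k hk ih => exact (step k hj).trans (ih (by omega))

lemma Nn_zero_of_neg_one (y : Fin n → K) (V : Fin n → ℤ) (i : Fin n) (hi : (i : ℕ) + 1 = n)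
    (h : V i = -1) : Nn y V = 0 := by
  apply Matrix.det_eq_zero_of_row_eq_zero i
  intro j
  show Uv y _ j = 0
  have : V i + 2 * (n : ℤ) - 2 * ((i : ℕ) : ℤ) - 1 = 0 := by omega
  rw [this, Uv_zero]; rfl

lemma trm_std (y : Fin n → K) (lo : ℤ) (x : (Fin n → ℕ) × Finset (Fin n)) :
    trm (fun k => Uv y (lo - 1 + 2 * k)) (fun k => Uv y (lo - 1 + 2 * k + 2)) x = Nn y (Vc lo x) := by
  unfold trm Nn
  congr 2
  funext i
  have := i.2
  simp only [Vc]
  split_ifs <;> congr 1 <;> push_cast <;>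
    rw [Nat.cast_sub (by omega), Nat.cast_sub (by omega)] <;> push_cast <;> ring

lemma sum_std (y : Fin n → K) (lo : ℤ) (M q : ℕ) :
    ∑ x ∈ cfg n M q, trm (fun k => Uv y (lo - 1 + 2 * k)) (fun k => Uv y (lo - 1 + 2 * k + 2)) x =
      ∑ x ∈ cfg n M q with Anti (Vc lo x), Nn y (Vc lo x) := by
  simp only [trm_std]
  rw [Finset.sum_filter_of_ne]
  intro x hx hne
  by_contra h
  exact hne (Nn_zero_of_not_anti y x lo (mem_cfg.1 hx).1.2 h)

lemma lower_card (S : Finset (Fin n)) (h : ∀ i j, i ≤ j → j ∈ S → i ∈ S) (j : Fin n) :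
    j ∈ S ↔ (j : ℕ) < S.card := by
  constructor
  · intro hj
    have : Finset.Iic j ⊆ S := fun i hi => h i j (Finset.mem_Iic.1 hi) hj
    have := Finset.card_le_card this
    rw [Fin.card_Iic] at this
    omega
  · intro hj
    by_contra hn
    have : S ⊆ Finset.Iio j := by
      intro i hi
      rw [Finset.mem_Iio]
      by_contra hc
      exact hn (h j i (not_lt.1 hc) hi)
    have := Finset.card_le_card this
    rw [Fin.card_Iio] at this
    omega

lemma lhs_sum (y : Fin n → K) (D : ℤ) (p : ℕ) (hp : p ≤ n) :
    ∑ x ∈ cfg n 0 (n - p) with Anti (Vc D x), Nn y (Vc D x) =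
      Nn y (fun i => if (i : ℕ) < n - p then D else D - 2) := by
  have hcard : (univ.filter (fun i : Fin n => (i : ℕ) < n - p)).card = n - p := by
    rw [Fin.card_filter_val_lt]; omega
  have : (cfg n 0 (n - p)).filter (fun x => Anti (Vc D x)) =
      {((fun _ => 0), univ.filter (fun i : Fin n => (i : ℕ) < n - p))} := by
    ext ⟨w, T⟩
    simp only [Finset.mem_filter, mem_cfg, Finset.mem_singleton, Prod.mk.injEq]
    constructor
    · rintro ⟨⟨⟨h1, _⟩, h2⟩, h3⟩
      have hw : w = fun _ => 0 := by funext i; simpa using h1 i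
      refine ⟨hw, ?_⟩
      have hl := lower_card T (by
        intro i j hij hj
        have := h3 i j hij
        by_contra hi
        simp [Vc, hw, hi, hj] at this)
      ext i
      rw [hl, h2]; simp
    · rintro ⟨rfl, rfl⟩
      refine ⟨⟨⟨by simp, by simp⟩, hcard⟩, ?_⟩
      intro i j hij
      have : (i : ℕ) ≤ j := hij
      simp only [Vc, Finset.mem_filter, Finset.mem_univ, true_and]
      split_ifs <;> omega
  rw [this, Finset.sum_singleton]
  congr 1
  funext i
  simp only [Vc, Finset.mem_filter, Finset.mem_univ, true_and]
  split_ifs <;> simp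

end Coef
section Cases

variable {K : Type} [Field K] {n : ℕ}

/-- configurations surviving all cancellations -/
def goodCfg (n : ℕ) (lo : ℤ) (M q : ℕ) (e : ℤ) : Finset ((Fin n → ℕ) × Finset (Fin n)) :=
  (cfg n M q).filter (fun x => Anti (Vc lo x) ∧ (∀ i, e ≤ Vc lo x i ∧ 0 ≤ Vc lo x i) ∧
    ∀ i, i ∉ x.2 → Vc lo x i ≠ e)

lemma case_two (y : Fin n → K) (lo : ℤ) (hlo : 1 ≤ lo) (M q : ℕ) :
    ∑ x ∈ cfg n M q with Anti (Vc lo x), Nn y (Vc lo x) = ∑ x ∈ goodCfg n lo M q (-lo), Nn y (Vc lo x) := by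
  symm
  apply Finset.sum_subset
  · intro x hx
    simp only [goodCfg, Finset.mem_filter] at hx ⊢
    exact ⟨hx.1, hx.2.1⟩
  · intro x hx hnx
    simp only [goodCfg, Finset.mem_filter] at hx hnx
    have hge : ∀ i, lo - 2 ≤ Vc lo x i := by
      intro i; simp only [Vc]; split_ifs <;> omega
    have : ∃ i, Vc lo x i < 0 := by
      by_contra hc
      push Not at hc
      exact hnx ⟨hx.1, hx.2, fun i => ⟨by linarith [hc i], hc i⟩, fun i _ => by linarith [hc i]⟩
    obtain ⟨i, hi⟩ := this
    have hn : 0 < n := by have := i.2; omega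
    have h2 := hx.2 i ⟨n - 1, by omega⟩ (by rw [Fin.le_def]; simp; omega)
    have h3 := hge ⟨n - 1, by omega⟩
    apply Nn_zero_of_neg_one y _ ⟨n - 1, by omega⟩ (by simp; omega)
    omega

/-- number of nonzero entries -/
def cz (w : Fin n → ℕ) : ℕ := (univ.filter (fun j => w j ≠ 0)).card

lemma cz_iff (w : Fin n → ℕ) (hw : ∀ i j, i ≤ j → w j ≤ w i) (j : Fin n) : w j ≠ 0 ↔ (j : ℕ) < cz w := by
  have := lower_card (univ.filter (fun j => w j ≠ 0)) (by
    intro i j hij hj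
    simp only [Finset.mem_filter, Finset.mem_univ, true_and] at hj ⊢
    have := hw i j hij
    omega) j
  simp only [Finset.mem_filter, Finset.mem_univ, true_and] at this
  exact this

lemma cz_le (w : Fin n → ℕ) : cz w ≤ n := by
  have := Finset.card_le_univ (univ.filter (fun j => w j ≠ 0))
  simpa [cz] using this

lemma cz_eq (w : Fin n → ℕ) (c : ℕ) (hc : c ≤ n) (h : ∀ j, w j ≠ 0 ↔ (j : ℕ) < c) : cz w = c := by
  simp only [cz, h]
  rw [Fin.card_filter_val_lt]; omega

/-- the first row vector family in the case `D ≤ C` -/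
def gz (y : Fin n → K) (lo : ℤ) (k : ℕ) : Fin n → K :=
  if k = 0 then - Uv y (lo + 1) else Uv y (lo - 1 + 2 * k)

/-- bad configurations -/
def Bad (x : (Fin n → ℕ) × Finset (Fin n)) : Prop := ∃ l : Fin n, (l : ℕ) + 1 = n ∧ x.1 l = 0 ∧ l ∉ x.2

lemma trm_good (y : Fin n → K) (lo : ℤ) (x : (Fin n → ℕ) × Finset (Fin n)) (hx : ¬ Bad x) :
    trm (gz y lo) (fun k => Uv y (lo - 1 + 2 * k + 2)) x = Nn y (Vc lo x) := by
  rw [← trm_std]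
  unfold trm
  congr 2
  funext i
  split_ifs with h
  · rfl
  · rw [gz, if_neg]
    intro h0
    have := i.2
    exact hx ⟨i, by omega, by omega, h⟩

lemma trm_bad (y : Fin n → K) (lo : ℤ) (w : Fin n → ℕ) (T : Finset (Fin n)) (l : Fin n) (hl : (l : ℕ) + 1 = n)
    (h0 : w l = 0) (hT : l ∉ T) :
    trm (gz y lo) (fun k => Uv y (lo - 1 + 2 * k + 2)) (w, T) = - Nn y (Vc lo (w, insert l T)) := by
  rw [← trm_std]
  unfold trm
  have e : (Matrix.of fun i : Fin n => if i ∈ T then Uv y (lo - 1 + 2 * ((w i + (n - 1 - i) : ℕ) : ℤ) + 2)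
      else gz y lo (w i + (n - 1 - i))) =
      Matrix.updateRow (Matrix.of fun i : Fin n => if i ∈ insert l T then
        Uv y (lo - 1 + 2 * ((w i + (n - 1 - i) : ℕ) : ℤ) + 2) else
          Uv y (lo - 1 + 2 * ((w i + (n - 1 - i) : ℕ) : ℤ))) l
        ((-1 : K) • (Uv y (lo - 1 + 2 * ((w l + (n - 1 - l) : ℕ) : ℤ) + 2))) := by
    ext i j
    by_cases hi : i = l
    · subst hi
      have : w i + (n - 1 - i) = 0 := by omega
      simp only [Matrix.of_apply, hT, if_false, this, gz, if_true, Matrix.updateRow_self]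
      have e2 : lo - 1 + 2 * ((0 : ℕ) : ℤ) + 2 = lo + 1 := by push_cast; ring
      rw [e2]; simp
    · rw [Matrix.updateRow_ne hi]
      simp only [Matrix.of_apply, Finset.mem_insert, hi, false_or, gz]
      have : w i + (n - 1 - i) ≠ 0 := by
        intro h
        apply hi
        have := i.2
        apply Fin.ext
        omega
      rw [if_neg this]
  show Matrix.det (Matrix.of fun i : Fin n => if i ∈ T then Uv y (lo - 1 + 2 * ((w i + (n - 1 - i) : ℕ) : ℤ) + 2)
      else gz y lo (w i + (n - 1 - i))) = _
  rw [e, Matrix.det_updateRow_smul, neg_one_mul]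
  congr 2
  convert Matrix.updateRow_eq_self _ l using 2
  show _ = if l ∈ insert l T then _ else _
  rw [if_pos (Finset.mem_insert_self l T)]

lemma bad_sum (y : Fin n → K) (hn : 1 ≤ n) (lo : ℤ) (M q : ℕ) :
    ∑ x ∈ cfg n M q with Bad x, trm (gz y lo) (fun k => Uv y (lo - 1 + 2 * k + 2)) x =
      - ∑ x ∈ cfg n M (q + 1) with (x.1 ⟨n - 1, by omega⟩ = 0 ∧ (⟨n - 1, by omega⟩ : Fin n) ∈ x.2),
        Nn y (Vc lo x) := by
  set l : Fin n := ⟨n - 1, by omega⟩ with hl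
  have hl1 : (l : ℕ) + 1 = n := by simp [hl]; omega
  have hb : ∀ x : (Fin n → ℕ) × Finset (Fin n), Bad x ↔ x.1 l = 0 ∧ l ∉ x.2 := by
    intro x
    constructor
    · rintro ⟨l', h1, h2⟩
      have : l' = l := Fin.ext (by omega)
      rwa [this] at h2
    · intro h; exact ⟨l, hl1, h⟩
  rw [← Finset.sum_neg_distrib]
  refine Finset.sum_nbij' (fun x => (x.1, insert l x.2)) (fun x => (x.1, x.2.erase l)) ?_ ?_ ?_ ?_ ?_
  · intro x hx
    simp only [Finset.mem_filter, mem_cfg, hb] at hx ⊢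
    refine ⟨⟨hx.1.1, ?_⟩, hx.2.1, by simp⟩
    rw [Finset.card_insert_of_notMem hx.2.2, hx.1.2]
  · intro x hx
    simp only [Finset.mem_filter, mem_cfg, hb] at hx ⊢
    refine ⟨⟨hx.1.1, ?_⟩, hx.2.1, by simp⟩
    rw [Finset.card_erase_of_mem hx.2.2, hx.1.2]; rfl
  · intro x hx
    simp only [Finset.mem_filter, mem_cfg, hb] at hx
    ext1
    · rfl
    · exact Finset.erase_insert hx.2.2
  · intro x hx
    simp only [Finset.mem_filter, mem_cfg] at hx
    ext1
    · rfl
    · exact Finset.insert_erase hx.2.2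
  · intro x hx
    simp only [Finset.mem_filter, mem_cfg, hb] at hx
    exact trm_bad y lo x.1 x.2 l hl1 hx.2.1 hx.2.2

/-- forward move -/
def fwd (x : (Fin n → ℕ) × Finset (Fin n)) : (Fin n → ℕ) × Finset (Fin n) :=
  (fun j => if (j : ℕ) + 1 = cz x.1 then 0 else x.1 j,
    univ.filter (fun j => (j : ℕ) + 1 = cz x.1 ∨ j ∈ x.2))

/-- backward move -/
def bwd (x : (Fin n → ℕ) × Finset (Fin n)) : (Fin n → ℕ) × Finset (Fin n) :=
  (fun j => if (j : ℕ) = cz x.1 then 1 else x.1 j,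
    univ.filter (fun j => (j : ℕ) ≠ cz x.1 ∧ j ∈ x.2))

lemma cancel_sum (y : Fin n → K) (hn : 1 ≤ n) (lo : ℤ) (M q : ℕ) (hM : q < n → 1 ≤ M) :
    ∑ x ∈ cfg n M q with (Anti (Vc lo x) ∧ (∀ i, lo ≤ Vc lo x i) ∧ ∃ i, i ∉ x.2 ∧ Vc lo x i = lo),
      Nn y (Vc lo x) =
    ∑ x ∈ cfg n M (q + 1) with
      (Anti (Vc lo x) ∧ x.1 ⟨n - 1, by omega⟩ = 0 ∧ (⟨n - 1, by omega⟩ : Fin n) ∈ x.2),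
        Nn y (Vc lo x) := by
  set l : Fin n := ⟨n - 1, by omega⟩ with hl
  have hl1 : (l : ℕ) + 1 = n := by simp [hl]; omega
  have lel : ∀ i : Fin n, i ≤ l := fun i => by rw [Fin.le_def]; have := i.2; omega
  -- facts about the left side
  have F1 : ∀ x : (Fin n → ℕ) × Finset (Fin n), x ∈ (cfg n M q).filter
      (fun x => Anti (Vc lo x) ∧ (∀ i, lo ≤ Vc lo x i) ∧ ∃ i, i ∉ x.2 ∧ Vc lo x i = lo) →
      ∃ j : Fin n, (j : ℕ) + 1 = cz x.1 ∧ x.1 j = 1 ∧ j ∉ x.2 := by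
    intro x hx
    simp only [Finset.mem_filter, mem_cfg] at hx
    obtain ⟨⟨⟨h1, h2⟩, h3⟩, h4, h5, i, hi, hi'⟩ := hx
    have hc := cz_iff x.1 h2
    have hcn := cz_le x.1
    have hwi : x.1 i ≠ 0 := by
      intro h; simp only [Vc, hi, h, if_false] at hi'; omega
    have hic := (hc i).1 hwi
    refine ⟨⟨cz x.1 - 1, by omega⟩, by simp; omega, ?_⟩
    generalize hj : (⟨cz x.1 - 1, by omega⟩ : Fin n) = j
    have hjv : (j : ℕ) = cz x.1 - 1 := by rw [← hj]
    have h6 := h4 i j (by rw [Fin.le_def]; omega)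
    have h7 := h5 j
    have h8 := (hc j).2 (by omega)
    rw [hi'] at h6
    have h9 : Vc lo x j = lo := le_antisymm h6 h7
    simp only [Vc] at h9
    split_ifs at h9 with h
    · omega
    · exact ⟨by omega, h⟩
  have F1c : ∀ x : (Fin n → ℕ) × Finset (Fin n), x ∈ (cfg n M q).filter
      (fun x => Anti (Vc lo x) ∧ (∀ i, lo ≤ Vc lo x i) ∧ ∃ i, i ∉ x.2 ∧ Vc lo x i = lo) →
      cz (fwd x).1 = cz x.1 - 1 := by
    intro x hx
    obtain ⟨j, hj, hj1, hjT⟩ := F1 x hx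
    simp only [Finset.mem_filter, mem_cfg] at hx
    have hc := cz_iff x.1 hx.1.1.2
    apply cz_eq _ _ (by have := cz_le x.1; omega)
    intro a
    simp only [fwd]
    have := hc a
    split_ifs <;> omega
  have F2 : ∀ x : (Fin n → ℕ) × Finset (Fin n), x ∈ (cfg n M (q + 1)).filter
      (fun x => Anti (Vc lo x) ∧ x.1 l = 0 ∧ l ∈ x.2) →
      ∃ j : Fin n, (j : ℕ) = cz x.1 ∧ x.1 j = 0 ∧ j ∈ x.2 := by
    intro x hx
    simp only [Finset.mem_filter, mem_cfg] at hx
    obtain ⟨⟨⟨h1, h2⟩, h3⟩, h4, h5, h6⟩ := hx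
    have hc := cz_iff x.1 h2
    have hlc := hc l
    refine ⟨⟨cz x.1, by omega⟩, rfl, ?_⟩
    generalize hj : (⟨cz x.1, by omega⟩ : Fin n) = j
    have hjv : (j : ℕ) = cz x.1 := by rw [← hj]
    have h7 := hc j
    have h8 := h4 j l (lel j)
    refine ⟨by omega, ?_⟩
    by_contra hjT
    simp only [Vc, h6, hjT, if_true, if_false] at h8
    omega
  have F2c : ∀ x : (Fin n → ℕ) × Finset (Fin n), x ∈ (cfg n M (q + 1)).filter
      (fun x => Anti (Vc lo x) ∧ x.1 l = 0 ∧ l ∈ x.2) →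
      cz (bwd x).1 = cz x.1 + 1 := by
    intro x hx
    obtain ⟨j, hj, hj1, hjT⟩ := F2 x hx
    simp only [Finset.mem_filter, mem_cfg] at hx
    have hc := cz_iff x.1 hx.1.1.2
    apply cz_eq _ _ (by have := j.2; omega)
    intro a
    simp only [bwd]
    have := hc a
    split_ifs <;> omega
  have V1 : ∀ x : (Fin n → ℕ) × Finset (Fin n), x ∈ (cfg n M q).filter
      (fun x => Anti (Vc lo x) ∧ (∀ i, lo ≤ Vc lo x i) ∧ ∃ i, i ∉ x.2 ∧ Vc lo x i = lo) →
      Vc lo (fwd x) = Vc lo x := by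
    intro x hx
    obtain ⟨j, hj, hj1, hjT⟩ := F1 x hx
    funext a
    by_cases ha : a = j
    · subst ha; simp [Vc, fwd, hj, hj1, hjT]
    · have : ¬ (a : ℕ) + 1 = cz x.1 := fun h => ha (Fin.ext (by omega))
      simp [Vc, fwd, this]
  have V2 : ∀ x : (Fin n → ℕ) × Finset (Fin n), x ∈ (cfg n M (q + 1)).filter
      (fun x => Anti (Vc lo x) ∧ x.1 l = 0 ∧ l ∈ x.2) →
      Vc lo (bwd x) = Vc lo x := by
    intro x hx
    obtain ⟨j, hj, hj1, hjT⟩ := F2 x hx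
    funext a
    by_cases ha : a = j
    · subst ha; simp [Vc, bwd, hj, hj1, hjT]
    · have : ¬ (a : ℕ) = cz x.1 := fun h => ha (Fin.ext (by omega))
      simp [Vc, bwd, this]
  refine Finset.sum_nbij' fwd bwd ?_ ?_ ?_ ?_ ?_
  · intro x hx
    have hV := V1 x hx
    obtain ⟨j, hj, hj1, hjT⟩ := F1 x hx
    simp only [Finset.mem_filter, mem_cfg] at hx ⊢
    obtain ⟨⟨⟨h1, h2⟩, h3⟩, h4, h5, i, hi, hi'⟩ := hx
    have hc := cz_iff x.1 h2
    rw [hV]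
    refine ⟨⟨⟨?_, ?_⟩, ?_⟩, h4, ?_, ?_⟩
    · intro a
      have := h1 a
      simp only [fwd]; split_ifs <;> omega
    · intro a b hab
      have h6 := h2 a b hab
      have h7 := hc a
      have h8 := hc b
      have : (a : ℕ) ≤ b := hab
      simp only [fwd]; split_ifs <;> omega
    · have : (fwd x).2 = insert j x.2 := by
        ext a
        simp only [fwd, Finset.mem_filter, Finset.mem_univ, true_and, Finset.mem_insert, Fin.ext_iff]
        rw [← hj]; simp
      rw [this, Finset.card_insert_of_notMem hjT, h3]
    · have := hc l
      simp only [fwd]; split_ifs <;> [rfl; skip]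
      have := cz_le x.1
      omega
    · simp only [fwd, Finset.mem_filter, Finset.mem_univ, true_and]
      by_cases hlc : (l : ℕ) + 1 = cz x.1
      · exact Or.inl hlc
      · right
        have := cz_le x.1
        have := hc l
        have h9 := h5 l
        by_contra hlT
        simp only [Vc, hlT, if_false] at h9
        omega
  · intro x hx
    have hV := V2 x hx
    obtain ⟨j, hj, hj1, hjT⟩ := F2 x hx
    simp only [Finset.mem_filter, mem_cfg] at hx ⊢
    obtain ⟨⟨⟨h1, h2⟩, h3⟩, h4, h5, h6⟩ := hx
    have hc := cz_iff x.1 h2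
    rw [hV]
    have hqn : q < n := by
      have := Finset.card_le_univ x.2
      simp at this
      omega
    have hM' := hM hqn
    have hVl : Vc lo x l = lo := by simp [Vc, h5, h6]
    refine ⟨⟨⟨?_, ?_⟩, ?_⟩, h4, ?_, ⟨j, ?_, ?_⟩⟩
    · intro a
      have := h1 a
      simp only [bwd]; split_ifs <;> omega
    · intro a b hab
      have h6 := h2 a b hab
      have h7 := hc a
      have h8 := hc b
      have : (a : ℕ) ≤ b := hab
      simp only [bwd]; split_ifs <;> omega
    · have : (bwd x).2 = x.2.erase j := by
        ext a
        simp only [bwd, Finset.mem_filter, Finset.mem_univ, true_and, Finset.mem_erase, ne_eq, Fin.ext_iff]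
        rw [← hj]
      rw [this, Finset.card_erase_of_mem hjT, h3]; rfl
    · intro i
      have := h4 i l (lel i)
      rwa [hVl] at this
    · simp [bwd, hj]
    · simp [Vc, hj1, hjT]
  · intro x hx
    obtain ⟨j, hj, hj1, hjT⟩ := F1 x hx
    have hcz := F1c x hx
    ext a
    · simp only [bwd, hcz]
      by_cases ha : (a : ℕ) + 1 = cz x.1
      · have : a = j := Fin.ext (by omega)
        rw [if_pos (by omega), this, hj1]
      · rw [if_neg (by omega)]; simp [fwd, ha]
    · simp only [bwd, hcz, Finset.mem_filter, Finset.mem_univ, true_and]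
      by_cases ha : (a : ℕ) + 1 = cz x.1
      · have : a = j := Fin.ext (by omega)
        subst this
        constructor
        · intro h; omega
        · intro h; exact absurd h hjT
      · simp only [fwd, Finset.mem_filter, Finset.mem_univ, true_and, ha, false_or, and_iff_right_iff_imp]
        intro _; omega
  · intro x hx
    obtain ⟨j, hj, hj1, hjT⟩ := F2 x hx
    have hcz := F2c x hx
    ext a
    · simp only [fwd, hcz]
      by_cases ha : (a : ℕ) = cz x.1
      · have : a = j := Fin.ext (by omega)
        rw [if_pos (by omega), this, hj1]
      · rw [if_neg (by omega)]; simp [bwd, ha]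
    · simp only [fwd, hcz, Finset.mem_filter, Finset.mem_univ, true_and]
      by_cases ha : (a : ℕ) = cz x.1
      · have : a = j := Fin.ext (by omega)
        subst this
        constructor
        · intro _; exact hjT
        · intro _; left; omega
      · simp only [bwd, Finset.mem_filter, Finset.mem_univ, true_and]
        constructor
        · rintro (h | h)
          · omega
          · exact h.2
        · intro h; right; exact ⟨ha, h⟩
  · intro x hx
    rw [V1 x hx]

lemma case_one (y : Fin n → K) (hn : 1 ≤ n) (lo : ℤ) (hlo : 0 ≤ lo) (M q : ℕ) (hM : q < n → 1 ≤ M) :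
    ∑ x ∈ cfg n M q, trm (gz y lo) (fun k => Uv y (lo - 1 + 2 * k + 2)) x =
      ∑ x ∈ goodCfg n lo M q lo, Nn y (Vc lo x) := by
  have hvan : ∀ q', ∀ P : ((Fin n → ℕ) × Finset (Fin n)) → Prop, ∀ [DecidablePred P],
      ∑ x ∈ cfg n M q' with P x, Nn y (Vc lo x) = ∑ x ∈ cfg n M q' with (Anti (Vc lo x) ∧ P x), Nn y (Vc lo x) := by
    intro q' P _
    symm
    apply Finset.sum_subset
    · intro x hx
      simp only [Finset.mem_filter] at hx ⊢
      exact ⟨hx.1, hx.2.2⟩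
    · intro x hx hnx
      simp only [Finset.mem_filter, mem_cfg] at hx hnx
      exact Nn_zero_of_not_anti y x lo hx.1.1.2 (fun h => hnx ⟨hx.1, h, hx.2⟩)
  rw [← Finset.sum_filter_add_sum_filter_not (cfg n M q) Bad, bad_sum y hn, hvan, ← cancel_sum y hn lo M q hM]
  rw [Finset.sum_congr rfl (g := fun x => Nn y (Vc lo x)) (s₁ := (cfg n M q).filter (fun x => ¬ Bad x))
    (fun x hx => trm_good y lo x (Finset.mem_filter.1 hx).2), hvan q (fun x => ¬ Bad x)]
  have key : ∀ x ∈ cfg n M q, (Anti (Vc lo x) ∧ ¬ Bad x) ↔ (Anti (Vc lo x) ∧ ∀ i, lo ≤ Vc lo x i) := by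
    intro x hx
    have hw := (mem_cfg.1 hx).1.2
    constructor
    · rintro ⟨h1, h2⟩
      refine ⟨h1, fun i => ?_⟩
      have h3 := h1 i ⟨n - 1, by omega⟩ (by rw [Fin.le_def]; simp; omega)
      refine le_trans ?_ h3
      by_contra hc
      apply h2
      refine ⟨⟨n - 1, by omega⟩, by simp; omega, ?_⟩
      simp only [Vc] at hc
      split_ifs at hc with h
      · omega
      · exact ⟨by omega, h⟩
    · rintro ⟨h1, h2⟩
      refine ⟨h1, ?_⟩
      rintro ⟨l, h3, h4, h5⟩
      have := h2 l
      simp [Vc, h4, h5] at this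
  rw [Finset.filter_congr key, ← Finset.sum_filter_add_sum_filter_not
    ((cfg n M q).filter (fun x => (Anti (Vc lo x) ∧ ∀ i, lo ≤ Vc lo x i)))
    (fun x => ∃ i, i ∉ x.2 ∧ Vc lo x i = lo), Finset.filter_filter, Finset.filter_filter]
  have e1 : (cfg n M q).filter (fun x => (Anti (Vc lo x) ∧ ∀ i, lo ≤ Vc lo x i) ∧ ¬ ∃ i, i ∉ x.2 ∧ Vc lo x i = lo)
      = goodCfg n lo M q lo := by
    apply Finset.filter_congr
    intro x _
    constructor
    · rintro ⟨⟨h1, h2⟩, h3⟩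
      exact ⟨h1, fun i => ⟨h2 i, hlo.trans (h2 i)⟩, fun i hi h => h3 ⟨i, hi, h⟩⟩
    · rintro ⟨h1, h2, h3⟩
      exact ⟨⟨h1, fun i => (h2 i).1⟩, fun ⟨i, hi, h⟩ => h3 i hi h⟩
  rw [e1]
  simp only [and_assoc]
  abel

end Cases
section Final

/-- index set of the right-hand side -/
def Sset (n C D p : ℕ) : Finset (Fin n → ℤ) :=
  ((Fintype.piFinset fun _ : Fin n =>
            Finset.Icc (0 : ℤ) ((C : ℤ) + D)).filter
            (fun V => (∀ i j : Fin n, i ≤ j → V j ≤ V i) ∧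
              (∀ i, ((C : ℤ) + D - V i) % 2 = 0) ∧
              (∀ i : Fin n, (i : ℕ) < n - p → |(C : ℤ) - D| ≤ V i) ∧
              (∀ i : Fin n, n - p ≤ (i : ℕ) →
                max ((C : ℤ) - D) ((D : ℤ) - C - 2) ≤ V i)))

/-- vertical strips -/
def Fset (n C D p : ℕ) (V : Fin n → ℤ) : Finset (Fin n → ℤ) :=
  ((Fintype.piFinset fun i : Fin n => Finset.Icc (V i) (V i + 2)).filter
    (fun W => (∀ i, W i = V i ∨ W i = V i + 2) ∧
      (∀ i j : Fin n, i ≤ j → W j ≤ W i) ∧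
      (((Finset.univ.filter (fun i : Fin n => W i = V i + 2)).card : ℤ)
        = (p : ℤ) - ((Finset.univ.filter
            (fun i : Fin n => V i = (D : ℤ) - (C : ℤ) - 2)).card : ℤ)) ∧
      (∀ i, W i = V i + 2 →
        W i ≠ (D : ℤ) - (C : ℤ) ∧ W i ≠ (C : ℤ) - (D : ℤ) + 2 ∧
          W i ≠ (C : ℤ) + (D : ℤ) + 2)))

lemma mem_Sset {n C D p : ℕ} {V : Fin n → ℤ} : V ∈ Sset n C D p ↔
    (∀ i, 0 ≤ V i ∧ V i ≤ (C : ℤ) + D) ∧ Anti V ∧ (∀ i, ((C : ℤ) + D - V i) % 2 = 0) ∧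
      (∀ i : Fin n, (i : ℕ) < n - p → (C : ℤ) - D ≤ V i ∧ (D : ℤ) - C ≤ V i) ∧
      (∀ i : Fin n, n - p ≤ (i : ℕ) → (C : ℤ) - D ≤ V i ∧ (D : ℤ) - C - 2 ≤ V i) := by
  unfold Sset Anti
  rw [Finset.mem_filter, Fintype.mem_piFinset]
  simp only [Finset.mem_Icc, max_le_iff, abs_le']
  have : ∀ i, -((C : ℤ) - D) ≤ V i ↔ (D : ℤ) - C ≤ V i := by intro i; rw [neg_sub]
  simp only [this]

lemma mem_Fset {n C D p : ℕ} {V W : Fin n → ℤ} : W ∈ Fset n C D p V ↔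
    (∀ i, W i = V i ∨ W i = V i + 2) ∧ Anti W ∧
      ((Finset.univ.filter (fun i : Fin n => W i = V i + 2)).card +
        (Finset.univ.filter (fun i : Fin n => V i = (D : ℤ) - (C : ℤ) - 2)).card = p) ∧
      (∀ i, W i = V i + 2 →
        W i ≠ (D : ℤ) - (C : ℤ) ∧ W i ≠ (C : ℤ) - (D : ℤ) + 2 ∧
          W i ≠ (C : ℤ) + (D : ℤ) + 2) := by
  unfold Fset Anti
  rw [Finset.mem_filter, Fintype.mem_piFinset]
  simp only [Finset.mem_Icc]
  constructor
  · rintro ⟨_, h1, h2, h3, h4⟩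
    exact ⟨h1, h2, by omega, h4⟩
  · rintro ⟨h1, h2, h3, h4⟩
    exact ⟨fun i => by rcases h1 i with h | h <;> omega, h1, h2, by omega, h4⟩

lemma card_aux {n : ℕ} (T A B : Finset (Fin n)) (h : ∀ i, i ∉ T ↔ i ∈ A ∨ i ∈ B)
    (hd : ∀ i, i ∈ A → i ∉ B) : T.card + (A.card + B.card) = n := by
  have h1 : Tᶜ = A ∪ B := by ext i; simp [h]
  have h2 : Disjoint A B := Finset.disjoint_left.2 (fun i => hd i)
  rw [← Finset.card_union_of_disjoint h2, ← h1, Finset.card_add_card_compl, Fintype.card_fin]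

lemma rhs_sum {K : Type} [Field K] {n C D p : ℕ} (hpn : p < n) (lo : ℤ) (M : ℕ)
    (hlo : (D ≤ C ∧ lo = (C : ℤ) - D ∧ M = D) ∨ (C < D ∧ lo = (D : ℤ) - C ∧ M = C))
    (X : (Fin n → ℤ) → K) :
    ∑ x ∈ goodCfg n lo M (n - p) ((C : ℤ) - D), X (Vc lo x) =
      ∑ V ∈ Sset n C D p, (cCoeff n C D p V : K) * X V := by
  have e1 : ∀ V, (cCoeff n C D p V : K) * X V = ∑ W ∈ Fset n C D p V, X V := by
    intro V
    rw [Finset.sum_const, nsmul_eq_mul]; rfl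
  simp only [e1]
  rw [Finset.sum_sigma']
  -- pointwise facts
  have P : ∀ (x : (Fin n → ℕ) × Finset (Fin n)) (i : Fin n),
      (i ∈ x.2 ∧ Vc lo x i = lo + 2 * x.1 i) ∨ (i ∉ x.2 ∧ Vc lo x i = lo + 2 * x.1 i - 2) := by
    intro x i
    by_cases h : i ∈ x.2 <;> simp [Vc, h]
  have G : ∀ x, x ∈ goodCfg n lo M (n - p) ((C : ℤ) - D) ↔ ((∀ i, x.1 i ≤ M) ∧ ∀ i j, i ≤ j → x.1 j ≤ x.1 i) ∧
      x.2.card = n - p ∧ Anti (Vc lo x) ∧ (∀ i, (C : ℤ) - D ≤ Vc lo x i ∧ 0 ≤ Vc lo x i) ∧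
        ∀ i, i ∉ x.2 → Vc lo x i ≠ (C : ℤ) - D := by
    intro x
    simp only [goodCfg, Finset.mem_filter, mem_cfg, and_assoc]
  -- facts about the right side
  have R : ∀ z : (Σ _ : Fin n → ℤ, Fin n → ℤ), z ∈ (Sset n C D p).sigma (fun V => Fset n C D p V) →
      ∀ i, ∃ k : ℕ, ((z.1 i = (D : ℤ) - C - 2 ∧ k = 0 ∧ z.1 i = lo - 2 ∧ z.2 i = z.1 i ∧ C < D ∧ D ≠ C + 1) ∨
        (z.1 i ≠ (D : ℤ) - C - 2 ∧ z.2 i = lo + 2 * k ∧ k ≤ M)) ∧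
        (if z.1 i = (D : ℤ) - C - 2 then 0 else ((z.2 i - lo) / 2).toNat) = k := by
    intro z hz i
    rw [Finset.mem_sigma, mem_Sset, mem_Fset] at hz
    obtain ⟨⟨h1, h2, h3, h4, h5⟩, h6, h7, h8, h9⟩ := hz
    refine ⟨_, ?_, rfl⟩
    have g1 := h1 i
    have g3 := h3 i
    have g4 := h4 i
    have g5 := h5 i
    have g6 := h6 i
    have g9 := h9 i
    have g10 : (C : ℤ) - D ≤ z.1 i ∧ (D : ℤ) - C - 2 ≤ z.1 i := by
      rcases lt_or_ge (i : ℕ) (n - p) with h | h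
      · have := g4 h; omega
      · exact g5 h
    clear g4 g5
    split_ifs with h
    · left; omega
    · right; omega
  refine Finset.sum_nbij'
    (fun x => (⟨Vc lo x, fun i => if Vc lo x i = (D : ℤ) - C - 2 then Vc lo x i else lo + 2 * x.1 i⟩ :
      Σ _ : Fin n → ℤ, Fin n → ℤ))
    (fun z => (fun i => if z.1 i = (D : ℤ) - C - 2 then 0 else ((z.2 i - lo) / 2).toNat,
      univ.filter (fun i => z.2 i = z.1 i ∧ z.1 i ≠ (D : ℤ) - C - 2))) ?_ ?_ ?_ ?_ ?_
  · intro x hx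
    rw [G] at hx
    obtain ⟨⟨h1, h2⟩, h3, h4, h5, h6⟩ := hx
    have Px := P x
    rw [Finset.mem_sigma, mem_Sset, mem_Fset]
    dsimp only
    generalize hV : Vc lo x = V at *
    refine ⟨⟨?_, h4, ?_, ?_, ?_⟩, ?_, ?_, ?_, ?_⟩
    · intro i
      have := h1 i; have := h5 i; have := Px i
      omega
    · intro i
      have := Px i; omega
    · intro i hi
      refine ⟨(h5 i).1, ?_⟩
      by_contra hc
      have hsub : x.2 ⊆ Finset.Iio i := by
        intro j hj
        rw [Finset.mem_Iio]
        by_contra hji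
        have a1 := h4 i j (not_lt.1 hji)
        have a2 := Px j
        have a3 := h5 j
        rcases a2 with ⟨_, a2⟩ | ⟨a2, _⟩
        · omega
        · exact a2 hj
      have := Finset.card_le_card hsub
      rw [Fin.card_Iio, h3] at this
      omega
    · intro i _
      refine ⟨(h5 i).1, ?_⟩
      have := h5 i; have := Px i
      omega
    · intro i
      have := Px i
      split_ifs <;> omega
    · intro a b hab
      have b1 := h4 a b hab
      have b2 := h2 a b hab
      have b3 := Px a
      have b4 := Px b
      have b5 := h5 b
      dsimp only
      split_ifs <;> omega
    · have := card_aux x.2 (Finset.univ.filter (fun i : Fin n =>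
        (if V i = (D : ℤ) - C - 2 then V i else lo + 2 * x.1 i) = V i + 2))
        (Finset.univ.filter (fun i : Fin n => V i = (D : ℤ) - (C : ℤ) - 2)) (by
          intro i
          simp only [Finset.mem_filter, Finset.mem_univ, true_and]
          have b1 := Px i
          have b2 := h5 i
          rcases b1 with ⟨b1, b3⟩ | ⟨b1, b3⟩
          · simp only [b1, not_true_eq_false, false_iff]
            split_ifs <;> omega
          · simp only [b1, not_false_eq_true, true_iff]
            split_ifs <;> omega) (by
          intro i
          simp only [Finset.mem_filter, Finset.mem_univ, true_and]
          intro h h'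
          rw [if_pos h'] at h
          omega)
      omega
    · intro i
      have b1 := Px i
      have b2 := h6 i
      have b3 := h1 i
      have b5 := h5 i
      split_ifs with h
      · omega
      · intro h'
        rcases b1 with ⟨b1, b4⟩ | ⟨b1, b4⟩
        · omega
        · have := b2 b1
          omega
  · intro z hz
    have Rz := R z hz
    rw [Finset.mem_sigma, mem_Sset, mem_Fset] at hz
    obtain ⟨⟨h1, h2, h3, h4, h5⟩, h6, h7, h8, h9⟩ := hz
    choose k hk hk' using Rz
    simp only [hk']
    have hV : Vc lo (k, univ.filter (fun i => z.2 i = z.1 i ∧ z.1 i ≠ (D : ℤ) - C - 2)) = z.1 := by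
      funext i
      simp only [Vc, Finset.mem_filter, Finset.mem_univ, true_and]
      have := hk i
      have := h6 i
      split_ifs <;> omega
    rw [G, hV]
    refine ⟨⟨?_, ?_⟩, ?_, h2, ?_, ?_⟩
    · intro i
      have := hk i
      dsimp only
      omega
    · intro a b hab
      have := hk a
      have := hk b
      have := h7 a b hab
      have := h2 a b hab
      dsimp only
      omega
    · have := card_aux (univ.filter (fun i => z.2 i = z.1 i ∧ z.1 i ≠ (D : ℤ) - C - 2))
        (Finset.univ.filter (fun i : Fin n => z.2 i = z.1 i + 2))
        (Finset.univ.filter (fun i : Fin n => z.1 i = (D : ℤ) - (C : ℤ) - 2)) (by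
          intro i
          simp only [Finset.mem_filter, Finset.mem_univ, true_and]
          have := h6 i
          omega) (by
          intro i
          simp only [Finset.mem_filter, Finset.mem_univ, true_and]
          have := h9 i
          omega)
      dsimp only
      omega
    · intro i
      refine ⟨?_, (h1 i).1⟩
      rcases lt_or_ge (i : ℕ) (n - p) with h | h
      · exact (h4 i h).1
      · exact (h5 i h).1
    · intro i
      simp only [Finset.mem_filter, Finset.mem_univ, true_and]
      have := h6 i
      have := h9 i
      have := hk i
      have := h1 i
      omega
  · intro x hx
    rw [G] at hx
    obtain ⟨⟨h1, h2⟩, h3, h4, h5, h6⟩ := hx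
    have Px := P x
    dsimp only
    generalize hV : Vc lo x = V at *
    ext i
    · have := Px i
      have := h5 i
      dsimp only
      split_ifs <;> omega
    · simp only [Finset.mem_filter, Finset.mem_univ, true_and]
      have b2 := h5 i
      rcases Px i with ⟨b1, b3⟩ | ⟨b1, b3⟩
      · simp only [b1, iff_true]
        split_ifs <;> omega
      · simp only [b1, iff_false]
        split_ifs <;> omega
  · intro z hz
    have Rz := R z hz
    rw [Finset.mem_sigma, mem_Sset, mem_Fset] at hz
    obtain ⟨⟨h1, h2, h3, h4, h5⟩, h6, h7, h8, h9⟩ := hz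
    choose k hk hk' using Rz
    simp only [hk']
    have hV : Vc lo (k, univ.filter (fun i => z.2 i = z.1 i ∧ z.1 i ≠ (D : ℤ) - C - 2)) = z.1 := by
      funext i
      simp only [Vc, Finset.mem_filter, Finset.mem_univ, true_and]
      have := hk i
      have := h6 i
      split_ifs <;> omega
    rw [hV]
    obtain ⟨V, W⟩ := z
    simp only [Sigma.mk.injEq, heq_eq_eq, true_and]
    funext i
    have := hk i
    dsimp only at this ⊢
    split_ifs <;> omega
  · intro x hx
    rfl

lemma soOdd_eq {K : Type} [Field K] (n : ℕ) (L : Fin n → ℤ) (y : Fin n → K) :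
    soOdd n L y = Nn y L / Nn y (fun _ => 0) := by
  unfold soOdd Nn
  simp only [zero_add]
  rfl

lemma main_coef {K : Type} [Field K] [Infinite K] {n : ℕ} (y : Fin n → K) (hy : ∀ j, y j ≠ 0)
    (hV : ∀ s, GN n (flp s y) ≠ 0) (C D p : ℕ) (hpn : p < n) (hd : 1 ≤ p → 2 ≤ D) :
    Nn y (fun _ => (C : ℤ)) * Nn y (fun i => if (i : ℕ) < n - p then (D : ℤ) else (D : ℤ) - 2) =
      Nn y (fun _ => 0) * ∑ V ∈ Sset n C D p, (cCoeff n C D p V : K) * Nn y V := by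
  rcases lt_or_ge C D with hCD | hCD
  · have h := cfg_eq (fun k => Uv y ((D : ℤ) - 1 + 2 * k)) (fun k => Uv y ((D : ℤ) - 1 + 2 * k + 2))
      (fun k => Uv y ((D : ℤ) - C - 1 + 2 * k)) (fun k => Uv y ((D : ℤ) - C - 1 + 2 * k + 2)) 0 C
      (Nn y (fun _ => (C : ℤ))) (Nn y (fun _ => 0)) (by
        intro s
        have := main_id s y hy hV C D
        rw [zero_add]
        rw [show (D : ℤ) - C - 1 = D - 1 - C by ring]
        exact this) (n - p)
    rw [sum_std, sum_std, lhs_sum y D p hpn.le, case_two y _ (by omega)] at h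
    rw [h, ← rhs_sum hpn ((D : ℤ) - C) C (Or.inr ⟨hCD, rfl, rfl⟩) (Nn y)]
    rw [neg_sub]
  · have h := cfg_eq (fun k => Uv y ((D : ℤ) - 1 + 2 * k)) (fun k => Uv y ((D : ℤ) - 1 + 2 * k + 2))
      (gz y ((C : ℤ) - D)) (fun k => Uv y ((C : ℤ) - D - 1 + 2 * k + 2)) 0 D
      (Nn y (fun _ => (C : ℤ))) (Nn y (fun _ => 0)) (by
        intro s
        have h0 := main_id s y hy hV C D
        rw [zero_add]
        refine h0.trans ?_
        congr 2
        obtain ⟨m, rfl⟩ : ∃ m, n = m + 1 := ⟨n - 1, by omega⟩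
        have e1 : C + (m + 1) = (D + m) + (C - D + 1) := by omega
        have hk0 : ((C - D + 1 : ℕ) : ℤ) = (C : ℤ) - D + 1 := by omega
        rw [e1, descP_add, ← add_assoc D m 1]
        have e2 : (fun k : ℕ => vv s y ((D : ℤ) - 1 - C + 2 * k)) =
            fun k : ℕ => vv s y (-((C - D + 1 : ℕ) : ℤ) + 2 * k) := by
          funext k; congr 1; rw [hk0]; ring
        rw [e2, collapse_v, descP_bot]
        congr 1
        · congr 1
          funext k
          simp only [vv, gz, Nat.add_eq_zero_iff, one_ne_zero, and_false, if_false]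
          congr 2
          · rw [Nat.cast_add, hk0]; push_cast; ring
          · congr 1
            rw [Nat.cast_add, hk0]; push_cast; ring
        · simp only [gz, if_true]
          have e3 : (C : ℤ) - D - 1 + 2 * ((0 : ℕ) : ℤ) + 2 = (C : ℤ) - D + 1 := by push_cast; ring
          rw [e3, hk0, map_add, map_neg, map_smul, sub_smul, one_smul]
          abel) (n - p)
    rw [sum_std, lhs_sum y D p hpn.le, case_one y (by omega) _ (by omega) D (n - p) (by
      intro h
      have := hd (by omega)
      omega)] at h
    rw [h, ← rhs_sum hpn ((C : ℤ) - D) D (Or.inl ⟨hCD, rfl, rfl⟩) (Nn y)]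

end Final

/-- `so_{2n+1}((c^n)) · so_{2n+1}((d^{n-p},(d-1)^p))
= ∑_ν c_{n,p}(ν) so_{2n+1}(ν)`.  Stated in doubled coordinates: `C = 2c`,
`D = 2d`, `V = 2ν`, variables `y` with `x_j = y_j²`. -/
theorem soOddRect_mul_soOdd_nearly_rectangular_rows
    (n C D p : ℕ) (hpn : p < n) (hd : 1 ≤ p → 2 ≤ D) :
    soOdd n (fun _ : Fin n => (C : ℤ)) (Xv n) *
        soOdd n (fun i : Fin n =>
          if (i : ℕ) < n - p then (D : ℤ) else (D : ℤ) - 2) (Xv n)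
      = ∑ V ∈ ((Fintype.piFinset fun _ : Fin n =>
            Finset.Icc (0 : ℤ) ((C : ℤ) + D)).filter
            (fun V => (∀ i j : Fin n, i ≤ j → V j ≤ V i) ∧
              (∀ i, ((C : ℤ) + D - V i) % 2 = 0) ∧
              (∀ i : Fin n, (i : ℕ) < n - p → |(C : ℤ) - D| ≤ V i) ∧
              (∀ i : Fin n, n - p ≤ (i : ℕ) →
                max ((C : ℤ) - D) ((D : ℤ) - C - 2) ≤ V i))),
          (cCoeff n C D p V : FF n) * soOdd n V (Xv n) := by
  obtain ⟨hy, hinj, hinv⟩ := Xv_facts n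
  have : Infinite (FF n) := Infinite.of_injective (algebraMap ℚ (FF n)) (algebraMap ℚ (FF n)).injective
  have h := main_coef (Xv n) hy (fun s => GN_flp_ne_zero (Xv n) hy hinj hinv s) C D p hpn hd
  show _ = ∑ V ∈ Sset n C D p, (cCoeff n C D p V : FF n) * soOdd n V (Xv n)
  simp only [soOdd_eq]
  by_cases h0 : Nn (Xv n) (fun _ => 0) = 0
  · simp [h0]
  · rw [div_mul_div_comm, h, mul_div_mul_left _ _ h0, Finset.sum_div]
    exact Finset.sum_congr rfl fun V _ => (mul_div_assoc _ _ _)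

end
end

section
/- Let c be a nonnegative integer and λ a partition with at most n parts. Then, as an identity of rational functions in x_1,…,x_n, sp_{2n}((c^n); x^{±1}) · sp_{2n}(λ; x^{±1}) = Σ_{ν} sp_{2n}(ν; x^{±1}) · Σ_{μ} LRbar^{ν+(c^n)}_{λ,μ}(c), where the outer sum ranges over all partitions ν with at most n parts satisfying ν_i ≤ λ_i + c for all i (λ padded with zeros to length n and λ+(c^n) = (λ_1+c,…,λ_n+c)), and the inner sum ranges over all partitions μ ⊆ ((2c)^n) all of whose parts are even. -/
open scoped Classical
open Finset

noncomputable section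

/-- Irreducible symplectic character `sp_{2n}(λ; x^{±1})` via the Weyl character formula. -/
def spWeyl {F : Type} [Field F] (n : ℕ) (lam : Fin n → ℤ) (x : Fin n → F) : F :=
  Matrix.det (Matrix.of fun i j : Fin n =>
    x j ^ (lam i + (n : ℤ) - ((i : ℕ) : ℤ)) - x j ^ (-(lam i + (n : ℤ) - ((i : ℕ) : ℤ)))) /
  Matrix.det (Matrix.of fun i j : Fin n =>
    x j ^ ((n : ℤ) - ((i : ℕ) : ℤ)) - x j ^ (-((n : ℤ) - ((i : ℕ) : ℤ))))

/-- The cells of the skew shape `A/Λ` in doubled coordinates: in row `i` the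
(doubled) column indices run through `Λ i < J ≤ A i` with `J ≡ A i (mod 2)`. -/
def cellsOf (n : ℕ) (Λ A : Fin n → ℤ) : Finset (Fin n × ℤ) :=
  Finset.univ.biUnion (fun i : Fin n =>
    ((Finset.Ioc (Λ i) (A i)).filter (fun J => (A i - J) % 2 = 0)).image (fun J => (i, J)))

/-- `F` is a Littlewood–Richardson filling of the skew shape `A/Λ` (in doubled
coordinates) with content `μ`: entries lie in `{1, …, n}` (and are `0` off the
shape), rows weakly increase, columns strictly increase, entry `e+1` occurs `μ e`
times, and the lattice condition holds for the right-to-left row reading word. -/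
def IsLRFilling (n : ℕ) (Λ A : Fin n → ℤ) (μ : Fin n → ℕ) (F : Fin n → ℤ → ℕ) : Prop :=
  (∀ i, Λ i ≤ A i ∧ (A i - Λ i) % 2 = 0) ∧
  (∀ i J, (i, J) ∉ cellsOf n Λ A → F i J = 0) ∧
  (∀ i J, (i, J) ∈ cellsOf n Λ A → 1 ≤ F i J ∧ F i J ≤ n) ∧
  (∀ i J, (i, J) ∈ cellsOf n Λ A → (i, J + 2) ∈ cellsOf n Λ A → F i J ≤ F i (J + 2)) ∧
  (∀ i i' : Fin n, ∀ J : ℤ, i < i' → (i, J) ∈ cellsOf n Λ A → (i', J) ∈ cellsOf n Λ A →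
      F i J < F i' J) ∧
  (∀ e : Fin n,
    ((cellsOf n Λ A).filter (fun c => F c.1 c.2 = (e : ℕ) + 1)).card = μ e) ∧
  (∀ i : Fin n, ∀ J : ℤ, ∀ e : ℕ,
    ((cellsOf n Λ A).filter
        (fun c => (c.1 < i ∨ (c.1 = i ∧ J ≤ c.2)) ∧ F c.1 c.2 = e + 2)).card ≤
    ((cellsOf n Λ A).filter
        (fun c => (c.1 < i ∨ (c.1 = i ∧ J ≤ c.2)) ∧ F c.1 c.2 = e + 1)).card)

/-- Condition (∗): an entry `e` in the last row in (doubled) column `J = 2j` has at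
least `2c - 2j + 1 = C2 - J + 1` further entries `e` strictly to its right. -/
def StarCond (n : ℕ) (Λ A : Fin n → ℤ) (C2 : ℤ) (F : Fin n → ℤ → ℕ) : Prop :=
  ∀ i : Fin n, (i : ℕ) + 1 = n → ∀ J : ℤ, (i, J) ∈ cellsOf n Λ A →
    C2 - J + 1 ≤
      (((cellsOf n Λ A).filter (fun c => F c.1 c.2 = F i J ∧ J < c.2)).card : ℤ)

/-- The modified Littlewood–Richardson coefficient
`LRbar^{A/2}_{Λ/2, μ}(C2/2)` (doubled coordinates). -/
def LRbar (n : ℕ) (Λ A : Fin n → ℤ) (μ : Fin n → ℕ) (C2 : ℤ) : ℕ :=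
  Nat.card {F : Fin n → ℤ → ℕ // IsLRFilling n Λ A μ F ∧ StarCond n Λ A C2 F}



namespace SpProof

/-- An abstract invariance principle for transfer-matrix sums. -/
theorem abstract_inv {P A : Type*} [Fintype P] [CommRing A]
    (h2 : ∀ a b : A, a + a = b + b → a = b)
    (σ : A →+* A) (rel : ℕ → P → P → Prop) (w : ℕ → P → A) (G : ℕ → P → A)
    (G0 : ∀ S, G 0 S = 1)
    (Gs : ∀ m S, G (m + 1) S = ∑ C, if rel m S C then w m C * G m C else 0)
    (τ : P → P) (ττ : ∀ p, τ (τ p) = p) (N : P → Prop)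
    (hw : ∀ m C, w m (τ C) = σ (w m C))
    (ha : ∀ m S C, N S → rel m S C → rel m S (τ C))
    (hc : ∀ m S C, N S → rel m S C →
      (N C ∧ τ C = C) ∨ (N C ∧ ¬ N (τ C)) ∨ (¬ N C ∧ N (τ C)))
    (hb : ∀ m S C, N S → ¬ N (τ S) → rel m (τ S) C → rel m S C)
    (hb' : ∀ m S C, N S → ¬ N (τ S) → rel m S C → ¬ rel m (τ S) C →
      N C ∧ σ (w (m + 1) (τ S) * w m C) = w (m + 1) (τ S) * w m C) :
    ∀ m S, N S → σ (G m S) = G m S := by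
  intro m
  induction m using Nat.strong_induction_on with
  | _ m ih =>
  intro S hS
  cases m with
  | zero => rw [G0, map_one]
  | succ m =>
  have hσw : ∀ m C, σ (w m (τ C)) = w m C := by
    intro m C
    rw [← hw, ττ]
  -- pairs of a low and a high step
  have E : ∀ L, N L → ¬ N (τ L) →
      σ (w m L * G m L + w m (τ L) * G m (τ L)) = w m L * G m L + w m (τ L) * G m (τ L) := by
    intro L hL hH
    have hdiff : σ (w m (τ L) * (G m L - G m (τ L))) = w m (τ L) * (G m L - G m (τ L)) := by
      cases m with
      | zero => simp [G0]
      | succ k =>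
        rw [Gs, Gs, ← Finset.sum_sub_distrib, Finset.mul_sum, map_sum]
        refine Finset.sum_congr rfl fun C _ => ?_
        by_cases h1 : rel k L C
        · by_cases h3 : rel k (τ L) C
          · simp [h1, h3]
          · obtain ⟨hNC, hwC⟩ := hb' k L C hL hH h1 h3
            simp only [h1, h3, if_true, if_false, sub_zero]
            rw [← mul_assoc, map_mul, hwC, ih k (by omega) C hNC]
        · have h3 : ¬ rel k (τ L) C := fun h => h1 (hb k L C hL hH h)
          simp [h1, h3]
    have e : w m L * G m L + w m (τ L) * G m (τ L)
        = (w m L + w m (τ L)) * G m L - w m (τ L) * (G m L - G m (τ L)) := by ring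
    rw [e, map_sub, hdiff, map_mul, ih m (by omega) L hL, map_add, hσw, ← hw,
      add_comm (w m (τ L))]
  have key : ∀ C, rel m S C →
      σ (w m C * G m C + w m (τ C) * G m (τ C)) = w m C * G m C + w m (τ C) * G m (τ C) := by
    intro C hC
    rcases hc m S C hS hC with ⟨h1, h3⟩ | ⟨h1, h3⟩ | ⟨h1, h3⟩
    · have hwC : σ (w m C) = w m C := by rw [← hw, h3]
      rw [h3, map_add, map_mul, hwC, ih m (by omega) C h1]
    · exact E C h1 h3
    · have := E (τ C) h3 (by rwa [ττ])
      rw [ττ] at this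
      rw [add_comm, this]
  have hre : G (m + 1) S + G (m + 1) S
      = ∑ C, if rel m S C then w m C * G m C + w m (τ C) * G m (τ C) else 0 := by
    have e2 : G (m + 1) S = ∑ C, if rel m S C then w m (τ C) * G m (τ C) else 0 := by
      rw [Gs]
      let te : P ≃ P := ⟨τ, τ, ττ, ττ⟩
      rw [← Equiv.sum_comp te]
      refine Finset.sum_congr rfl fun C _ => ?_
      change (if rel m S (τ C) then w m (τ C) * G m (τ C) else 0) = _
      by_cases h1 : rel m S C
      · simp [h1, ha m S C hS h1]
      · have : ¬ rel m S (τ C) := fun h => h1 (by simpa [ττ] using ha m S _ hS h)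
        simp [h1, this]
    conv_lhs => rw [e2]
    rw [← e2]
    conv_lhs => arg 1; rw [Gs]
    rw [e2, ← Finset.sum_add_distrib]
    refine Finset.sum_congr rfl fun C _ => ?_
    split_ifs <;> simp
  apply h2
  rw [← map_add, hre, map_sum]
  refine Finset.sum_congr rfl fun C _ => ?_
  split_ifs with h
  · exact key C h
  · exact map_zero σ

section Alt

variable {n : ℕ} {K : Type} [Field K]

/-- Functions on the torus. -/
abbrev TF (n : ℕ) (K : Type) [Field K] : Type := (Fin n → Kˣ) → K

/-- Precomposition as a ring homomorphism. -/
def pre (f : (Fin n → Kˣ) → (Fin n → Kˣ)) : TF n K →+* TF n K where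
  toFun g := fun y => g (f y)
  map_one' := rfl
  map_mul' _ _ := rfl
  map_zero' := rfl
  map_add' _ _ := rfl

def mon (β : Fin n → ℤ) : TF n K := fun y => ((∏ i, y i ^ β i : Kˣ) : K)

theorem mon_add (β γ : Fin n → ℤ) : (mon (β + γ) : TF n K) = mon β * mon γ := by
  funext y
  simp [mon, zpow_add, Finset.prod_mul_distrib]

theorem mon_zero : (mon (0 : Fin n → ℤ) : TF n K) = 1 := by
  funext y
  simp [mon]

/-- Permuting the torus coordinates. -/
def permT (τ : Equiv.Perm (Fin n)) (y : Fin n → Kˣ) : Fin n → Kˣ := fun i => y (τ i)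

/-- Inverting one torus coordinate. -/
def invT (l : Fin n) (y : Fin n → Kˣ) : Fin n → Kˣ := fun i => if i = l then (y i)⁻¹ else y i

theorem pre_swap_mon (a b : Fin n) (β : Fin n → ℤ) :
    pre (permT (Equiv.swap a b)) (mon β : TF n K) = mon (fun i => β (Equiv.swap a b i)) := by
  funext y
  simp only [pre, permT, mon, RingHom.coe_mk, MonoidHom.coe_mk, OneHom.coe_mk]
  congr 1
  rw [← Equiv.prod_comp (Equiv.swap a b)]
  simp

theorem pre_inv_mon (l : Fin n) (β : Fin n → ℤ) :
    pre (invT l) (mon β : TF n K) = mon (fun i => if i = l then - β i else β i) := by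
  funext y
  simp only [pre, invT, mon, RingHom.coe_mk, MonoidHom.coe_mk, OneHom.coe_mk]
  congr 1
  refine Finset.prod_congr rfl fun i _ => ?_
  split_ifs <;> simp

/-- The group action point. -/
def actT (σ : Equiv.Perm (Fin n)) (s : Fin n → ℤˣ) (y : Fin n → Kˣ) : Fin n → Kˣ :=
  fun i => y (σ i) ^ ((s i : ℤˣ) : ℤ)

/-- Alternation over the hyperoctahedral group. -/
def alt (f : TF n K) : TF n K := fun y =>
  ∑ σ : Equiv.Perm (Fin n), ∑ s : Fin n → ℤˣ,
    ((Equiv.Perm.sign σ : ℤ) : K) * (((∏ i, s i : ℤˣ) : ℤ) : K) * f (actT σ s y)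

def aDet (β : Fin n → ℤ) : TF n K := fun y =>
  Matrix.det (Matrix.of fun i j : Fin n => (y j : K) ^ (β i) - (y j : K) ^ (-(β i)))

theorem alt_mon (β : Fin n → ℤ) : alt (mon β : TF n K) = aDet β := by
  funext y
  rw [aDet, ← Matrix.det_transpose, Matrix.det_apply]
  unfold alt
  refine Finset.sum_congr rfl fun σ _ => ?_
  have h : ∀ i, (Matrix.of fun i j : Fin n => (y j : K) ^ (β i) - (y j : K) ^ (-(β i))).transpose
      (σ i) i = ∑ u : ℤˣ, (((u : ℤ) : K)) * ((y (σ i) ^ (u : ℤ)) ^ β i : Kˣ) := by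
    intro i
    have hu : (Finset.univ : Finset ℤˣ) = {1, -1} := by decide
    rw [hu, Finset.sum_pair (by decide)]
    simp [sub_eq_add_neg]
  rw [Finset.prod_congr rfl (fun i _ => h i), Finset.prod_univ_sum, Fintype.piFinset_univ,
    Finset.smul_sum]
  refine Finset.sum_congr rfl fun s _ => ?_
  rw [Finset.prod_mul_distrib]
  simp [mon, actT, Units.smul_def, mul_assoc]

theorem alt_sum {ι : Type*} (t : Finset ι) (f : ι → TF n K) :
    alt (∑ i ∈ t, f i) = ∑ i ∈ t, alt (f i) := by
  funext y
  simp only [alt, Finset.sum_apply, Finset.mul_sum]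
  rw [Finset.sum_comm]
  conv_lhs => rw [Finset.sum_comm]
  rw [Finset.sum_comm]
  rw [Finset.sum_comm]
  simp_rw [Finset.sum_comm (s := t)]

theorem alt_zero : alt (0 : TF n K) = 0 := by
  funext y
  simp [alt]

theorem alt_swap (a b : Fin n) (hab : a ≠ b) (f : TF n K) :
    alt (pre (permT (Equiv.swap a b)) f) = - alt f := by
  funext y
  simp only [alt, Pi.neg_apply, ← Finset.sum_neg_distrib]
  rw [← Equiv.sum_comp (Equiv.mulRight (Equiv.swap a b))]
  refine Finset.sum_congr rfl fun σ _ => ?_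
  rw [← Equiv.sum_comp (Equiv.arrowCongr (Equiv.swap a b) (Equiv.refl ℤˣ))]
  refine Finset.sum_congr rfl fun s _ => ?_
  have h1 : (∏ i, (Equiv.arrowCongr (Equiv.swap a b) (Equiv.refl ℤˣ)) s i) = ∏ i, s i := by
    rw [← Equiv.prod_comp (Equiv.swap a b)]
    simp [Equiv.arrowCongr]
  have h3 : permT (Equiv.swap a b) (actT (Equiv.mulRight (Equiv.swap a b) σ)
      (Equiv.arrowCongr (Equiv.swap a b) (Equiv.refl ℤˣ) s) y) = actT σ s y := by
    funext i
    simp [permT, actT, Equiv.arrowCongr]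
  rw [h1]
  simp only [pre, RingHom.coe_mk, MonoidHom.coe_mk, OneHom.coe_mk]
  rw [h3]
  simp [Equiv.Perm.sign_mul, Equiv.Perm.sign_swap hab]

theorem alt_inv (l : Fin n) (f : TF n K) :
    alt (pre (invT l) f) = - alt f := by
  funext y
  simp only [alt, Pi.neg_apply, ← Finset.sum_neg_distrib]
  refine Finset.sum_congr rfl fun σ _ => ?_
  rw [← Equiv.sum_comp (Equiv.mulRight (fun i : Fin n => if i = l then (-1 : ℤˣ) else 1))]
  refine Finset.sum_congr rfl fun s _ => ?_
  have h1 : (∏ i, (Equiv.mulRight (fun i : Fin n => if i = l then (-1 : ℤˣ) else 1)) s i)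
      = - ∏ i, s i := by
    simp only [Equiv.coe_mulRight, Pi.mul_apply]
    rw [Finset.prod_mul_distrib]
    simp
  have h3 : invT l (actT σ
      (Equiv.mulRight (fun i : Fin n => if i = l then (-1 : ℤˣ) else 1) s) y) = actT σ s y := by
    funext i
    by_cases h : i = l <;> simp [invT, actT, h]
  rw [h1]
  simp only [pre, RingHom.coe_mk, MonoidHom.coe_mk, OneHom.coe_mk]
  rw [h3]
  simp

theorem alt_mul (f g : TF n K) (hg : ∀ σ s y, g (actT σ s y) = g y) :
    alt (f * g) = alt f * g := by
  funext y
  simp only [alt, Pi.mul_apply, Finset.sum_mul, hg, mul_assoc]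

theorem inv_all (g : TF n K)
    (h1 : ∀ a b : Fin n, (a : ℕ) + 1 = b → pre (permT (Equiv.swap a b)) g = g)
    (h3 : ∀ l : Fin n, (l : ℕ) + 1 = n → pre (invT l) g = g) :
    ∀ σ s y, g (actT σ s y) = g y := by
  cases n with
  | zero =>
    intro σ s y
    congr 1
    exact Subsingleton.elim _ _
  | succ n =>
  have hp : ∀ (τ : Equiv.Perm (Fin (n + 1))) (y), g (permT τ y) = g y := by
    intro τ
    have hτ : τ ∈ Submonoid.closure
        (Set.range fun i : Fin n => Equiv.swap i.castSucc i.succ) := by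
      rw [Equiv.Perm.mclosure_swap_castSucc_succ]
      trivial
    induction hτ using Submonoid.closure_induction with
    | mem x hx =>
      obtain ⟨i, rfl⟩ := hx
      intro y
      exact congrFun (h1 i.castSucc i.succ (by simp)) y
    | one => intro y; rfl
    | mul a b _ _ iha ihb =>
      intro y
      have : permT (a * b) y = permT b (permT a y) := rfl
      rw [this, ihb, iha]
  have hi : ∀ (l : Fin (n + 1)) (y), g (invT l y) = g y := by
    intro l y
    have e : permT (Equiv.swap l (Fin.last n)) (invT l y)
        = invT (Fin.last n) (permT (Equiv.swap l (Fin.last n)) y) := by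
      funext i
      by_cases h : i = Fin.last n
      · subst h; simp [permT, invT]
      · have : Equiv.swap l (Fin.last n) i ≠ l := by
          intro h'
          apply h
          rw [Equiv.swap_apply_eq_iff] at h'
          simpa using h'
        simp [permT, invT, h, this]
    rw [← hp (Equiv.swap l (Fin.last n)), e]
    have := congrFun (h3 (Fin.last n) (by simp)) (permT (Equiv.swap l (Fin.last n)) y)
    exact this.trans (hp _ _)
  have hI : ∀ (I : Finset (Fin (n + 1))) (y),
      g (fun i => if i ∈ I then (y i)⁻¹ else y i) = g y := by
    intro I
    induction I using Finset.induction_on with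
    | empty => intro y; simp
    | insert a I ha ih =>
      intro y
      rw [← ih y, ← hi a (fun i => if i ∈ I then (y i)⁻¹ else y i)]
      congr 1
      funext i
      by_cases h : i = a
      · subst h; simp [invT, ha]
      · simp [invT, h]
  intro σ s y
  rw [← hp σ y, ← hI (Finset.univ.filter fun i => s i = -1) (permT σ y)]
  congr 1
  funext i
  rcases Int.units_eq_one_or (s i) with h | h
  · have : ¬ ((1 : ℤˣ) = -1) := by decide
    simp [actT, permT, h, this]
  · simp [actT, permT, h]

end Alt


section DP

variable {n : ℕ}

/-- Number of elements of `C` below `i`. -/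
def ht (C : Finset (Fin n)) (i : ℕ) : ℕ := (C.filter (fun a : Fin n => (a : ℕ) < i)).card

theorem ht_zero (C : Finset (Fin n)) : ht C 0 = 0 := by simp [ht]

theorem ht_succ (C : Finset (Fin n)) (a : Fin n) :
    ht C (a + 1) = ht C a + if a ∈ C then 1 else 0 := by
  unfold ht
  have : C.filter (fun b : Fin n => (b : ℕ) < a + 1)
      = C.filter (fun b : Fin n => (b : ℕ) < a) ∪ C.filter (fun b : Fin n => b = a) := by
    ext b
    simp only [mem_filter, mem_union, Fin.ext_iff]
    constructor
    · rintro ⟨h1, h2⟩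
      rcases Nat.lt_succ_iff_lt_or_eq.mp h2 with h | h
      · exact Or.inl ⟨h1, h⟩
      · exact Or.inr ⟨h1, h⟩
    · rintro (⟨h1, h2⟩ | ⟨h1, h2⟩)
      · exact ⟨h1, by omega⟩
      · exact ⟨h1, by omega⟩
  rw [this, card_union_of_disjoint]
  · congr 1
    rw [Finset.filter_eq']
    split_ifs <;> simp
  · rw [Finset.disjoint_filter]
    rintro b _ h1 rfl
    omega

theorem ht_mono (C : Finset (Fin n)) {i j : ℕ} (h : i ≤ j) : ht C i ≤ ht C j := by
  unfold ht
  apply card_le_card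
  intro b
  simp only [mem_filter]
  rintro ⟨h1, h2⟩
  exact ⟨h1, by omega⟩

theorem ht_top (C : Finset (Fin n)) : ht C n = C.card := by
  unfold ht
  congr 1
  ext b
  simp

theorem ht_ge (C : Finset (Fin n)) {i : ℕ} (h : n ≤ i) : ht C i = ht C n := by
  unfold ht
  congr 1
  ext b
  have := b.2
  simp only [mem_filter, and_congr_right_iff]
  intro _
  omega

theorem ht_empty (i : ℕ) : ht (∅ : Finset (Fin n)) i = 0 := by simp [ht]

/-- `C` may be the column of index `m` to the left of the column `S`. -/
def rel (m : ℕ) (S C : Finset (Fin n)) : Prop :=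
  (∀ i, ht S i ≤ ht C i) ∧ (Even m → ht C n = ht S n)

/-- Weight of the column `C` in position `m`. -/
def wt (m : ℕ) (C : Finset (Fin n)) : Fin n → ℤ :=
  fun i => (if i ∈ C then 1 else 0) - if Even m then 1 else 0

variable {K : Type} [Field K]

/-- Generating function of the tableaux with `m` columns to the left of `S`. -/
def G (K : Type) [Field K] : ℕ → Finset (Fin n) → TF n K
  | 0, _ => 1
  | m + 1, S => ∑ C, if rel m S C then mon (wt m C) * G K m C else 0

theorem TF_cancel [CharZero K] (a b : TF n K) (h : a + a = b + b) : a = b := by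
  funext y
  have := congrFun h y
  simp only [Pi.add_apply] at this
  rw [← two_mul, ← two_mul] at this
  exact mul_left_cancel₀ two_ne_zero this

/-- Swapping two rows in a column. -/
def tauS (a b : Fin n) (C : Finset (Fin n)) : Finset (Fin n) :=
  univ.filter fun i => Equiv.swap a b i ∈ C

theorem mem_tauS (a b : Fin n) (C : Finset (Fin n)) (i : Fin n) :
    i ∈ tauS a b C ↔ Equiv.swap a b i ∈ C := by simp [tauS]

theorem ht_tauS (a b : Fin n) (hab : (a : ℕ) + 1 = b) (C : Finset (Fin n)) (i : ℕ)
    (hi : i ≠ a + 1) : ht (tauS a b C) i = ht C i := by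
  unfold ht
  apply Finset.card_bij (fun x _ => Equiv.swap a b x)
  · intro x
    simp only [mem_filter, mem_tauS]
    rintro ⟨h1, h2⟩
    refine ⟨h1, ?_⟩
    rw [Equiv.swap_apply_def]
    split_ifs with h3 h4
    · subst h3; omega
    · subst h4; omega
    · exact h2
  · intro x _ y _ h
    exact (Equiv.swap a b).injective h
  · intro x
    simp only [mem_filter, mem_tauS]
    rintro ⟨h1, h2⟩
    refine ⟨Equiv.swap a b x, ⟨by simpa using h1, ?_⟩, by simp⟩
    rw [Equiv.swap_apply_def]
    split_ifs with h3 h4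
    · subst h3; omega
    · subst h4; omega
    · exact h2

theorem wt_tauS (a b : Fin n) (m : ℕ) (C : Finset (Fin n)) :
    wt m (tauS a b C) = fun i => wt m C (Equiv.swap a b i) := by
  funext i
  simp [wt, mem_tauS]

set_option maxHeartbeats 1000000 in
theorem G_inv_swap [CharZero K] (a b : Fin n) (hab : (a : ℕ) + 1 = b) (m : ℕ)
    (S : Finset (Fin n)) (hS : ¬ (a ∈ S ∧ b ∉ S)) :
    pre (permT (Equiv.swap a b)) (G K m S) = G K m S := by
  have hne : a ≠ b := by rintro rfl; omega
  have ma : ∀ C, a ∈ tauS a b C ↔ b ∈ C := fun C => by simp [mem_tauS]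
  have mb : ∀ C, b ∈ tauS a b C ↔ a ∈ C := fun C => by simp [mem_tauS]
  have htn : ∀ C, ht (tauS a b C) n = ht C n := fun C =>
    ht_tauS a b hab C n (by have := b.2; omega)
  have s1 : ∀ C : Finset (Fin n), ht C (a + 1) = ht C a + if a ∈ C then 1 else 0 :=
    fun C => ht_succ C a
  have s2 : ∀ C : Finset (Fin n), ht C (a + 2) = ht C (a + 1) + if b ∈ C then 1 else 0 := by
    intro C
    have := ht_succ C b
    rw [← hab] at this
    exact this
  have t0 : ∀ C, ht (tauS a b C) a = ht C a := fun C => ht_tauS a b hab C a (by omega)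
  have t2 : ∀ C, ht (tauS a b C) (a + 2) = ht C (a + 2) := fun C =>
    ht_tauS a b hab C _ (by omega)
  refine abstract_inv TF_cancel (pre (permT (Equiv.swap a b))) rel (fun m C => mon (wt m C))
    (G K) (fun _ => rfl) (fun _ _ => rfl) (tauS a b) ?_ (fun S => ¬ (a ∈ S ∧ b ∉ S)) ?_ ?_ ?_ ?_ ?_
    m S hS
  · intro C
    ext i
    simp [mem_tauS]
  · intro m C
    rw [pre_swap_mon, wt_tauS]
  · rintro m S C hS ⟨h1, h3⟩
    refine ⟨fun i => ?_, fun hm => by rw [htn, h3 hm]⟩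
    by_cases hi : i = a + 1
    · subst hi
      have e1 := s1 S
      have e2 := s2 S
      have e3 := s1 (tauS a b C)
      have e4 := s2 (tauS a b C)
      have e5 := h1 a
      have e6 := h1 (a + 2)
      rw [t2] at e4
      rw [t0] at e3
      split_ifs at e1 e2 e3 e4 <;> first | omega | (exfalso; tauto)
    · rw [ht_tauS a b hab C i hi]; exact h1 i
  · rintro m S C hS -
    rw [ma, mb]
    by_cases h1 : a ∈ C <;> by_cases h3 : b ∈ C <;> simp only [h1, h3] <;> try tauto
    all_goals
      left
      refine ⟨by tauto, ?_⟩
      ext i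
      rw [mem_tauS, Equiv.swap_apply_def]
      split_ifs with h4 h5
      · subst h4; tauto
      · subst h5; tauto
      · rfl
  · rintro m S C hS hN ⟨h1, h3⟩
    rw [ma, mb] at hN
    refine ⟨fun i => ?_, fun hm => by rw [h3 hm, htn]⟩
    by_cases hi : i = a + 1
    · subst hi
      have e1 := s1 S
      have e2 := s1 C
      have e3 := h1 a
      rw [t0] at e3
      have : a ∉ S := by tauto
      simp only [this, if_false] at e1
      omega
    · rw [← ht_tauS a b hab S i hi]; exact h1 i
  · rintro m S C hS hN ⟨h1, h3⟩ hnr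
    rw [ma, mb] at hN
    have haS : a ∉ S := by tauto
    have hbS : b ∈ S := by tauto
    have hlt : ht C (a + 1) < ht (tauS a b S) (a + 1) := by
      by_contra hge
      apply hnr
      refine ⟨fun i => ?_, fun hm => by rw [h3 hm, htn]⟩
      by_cases hi : i = a + 1
      · subst hi; omega
      · rw [ht_tauS a b hab S i hi]; exact h1 i
    have e1 := s1 S
    have e2 := s2 S
    have e3 := s1 (tauS a b S)
    have e4 := h1 a
    have e5 := h1 (a + 2)
    have e6 := s1 C
    have e7 := s2 C
    rw [t0] at e3
    simp only [haS, hbS, ma, if_true, if_false] at e1 e2 e3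
    have haC : a ∉ C := by
      intro h
      simp only [h, if_true] at e6
      omega
    have hbC : b ∈ C := by
      by_contra h
      simp only [h, if_false] at e7
      omega
    refine ⟨by tauto, ?_⟩
    rw [← mon_add, pre_swap_mon]
    congr 1
    funext i
    simp only [Pi.add_apply, wt, mem_tauS]
    by_cases h4 : i = a
    · subst h4; simp [haS, hbS, haC, hbC]; ring
    · by_cases h5 : i = b
      · subst h5; simp [haS, hbS, haC, hbC]; ring
      · rw [Equiv.swap_apply_of_ne_of_ne h4 h5, Equiv.swap_apply_of_ne_of_ne h4 h5]

/-- Toggling the last row in a pair of columns. -/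
def tauL (l : Fin n) (P : Finset (Fin n) × Finset (Fin n)) : Finset (Fin n) × Finset (Fin n) :=
  if l ∈ P.1 ∧ l ∈ P.2 then (P.1.erase l, P.2.erase l)
  else if l ∉ P.1 ∧ l ∉ P.2 then (insert l P.1, insert l P.2) else P

theorem ht_insert_last (l : Fin n) (hl : (l : ℕ) + 1 = n) (C : Finset (Fin n)) (i : ℕ)
    (hi : i ≤ l) : ht (insert l C) i = ht C i := by
  unfold ht
  congr 1
  ext b
  simp only [mem_filter, mem_insert]
  constructor
  · rintro ⟨rfl | h, h3⟩
    · omega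
    · exact ⟨h, h3⟩
  · rintro ⟨h, h3⟩
    exact ⟨Or.inr h, h3⟩

theorem ht_erase_last (l : Fin n) (hl : (l : ℕ) + 1 = n) (C : Finset (Fin n)) (i : ℕ)
    (hi : i ≤ l) : ht (C.erase l) i = ht C i := by
  unfold ht
  congr 1
  ext b
  simp only [mem_filter, mem_erase]
  constructor
  · rintro ⟨⟨_, h⟩, h3⟩
    exact ⟨h, h3⟩
  · rintro ⟨h, h3⟩
    exact ⟨⟨by rintro rfl; omega, h⟩, h3⟩

theorem le_iff_last (l : Fin n) (hl : (l : ℕ) + 1 = n) (S C : Finset (Fin n)) :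
    (∀ i, ht S i ≤ ht C i) ↔ (∀ i, i ≤ (l : ℕ) → ht S i ≤ ht C i) ∧ ht S n ≤ ht C n := by
  constructor
  · intro h
    exact ⟨fun i _ => h i, h n⟩
  · rintro ⟨h1, h3⟩ i
    by_cases hi : i ≤ (l : ℕ)
    · exact h1 i hi
    · rw [ht_ge S (by omega), ht_ge C (by omega)]; exact h3

/-- Two-column steps. -/
def relP (S : Finset (Fin n)) (P : Finset (Fin n) × Finset (Fin n)) : Prop :=
  (∀ i, ht S i ≤ ht P.1 i) ∧ (∀ i, ht P.1 i ≤ ht P.2 i) ∧ ht P.2 n = ht P.1 n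

theorem G_pair (m : ℕ) (S : Finset (Fin n)) :
    G K (2 * (m + 1)) S = ∑ P : Finset (Fin n) × Finset (Fin n),
      if relP S P then
        mon (wt 1 P.1 + wt 0 P.2) * G K (2 * m) P.2 else 0 := by
  rw [Fintype.sum_prod_type]
  have e : 2 * (m + 1) = 2 * m + 1 + 1 := by ring
  rw [e, G]
  refine Finset.sum_congr rfl fun C _ => ?_
  have hodd : ¬ Even (2 * m + 1) := by simp
  have hev : Even (2 * m) := by simp
  have w1 : (wt (2 * m + 1) C) = wt 1 C := by
    funext i; simp [wt, hodd]
  have w0 : ∀ D : Finset (Fin n), (wt (2 * m) D) = wt 0 D := by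
    intro D; funext i; simp [wt, hev]
  by_cases h : ∀ i, ht S i ≤ ht C i
  · have hr : rel (2 * m + 1) S C := ⟨h, fun h' => absurd h' hodd⟩
    rw [if_pos hr, G, Finset.mul_sum]
    refine Finset.sum_congr rfl fun D _ => ?_
    by_cases h3 : rel (2 * m) C D
    · rw [if_pos h3, if_pos ⟨h, h3.1, h3.2 hev⟩, mon_add, w1, w0, mul_assoc]
    · rw [if_neg h3, if_neg, mul_zero]
      rintro ⟨_, h4, h5⟩
      exact h3 ⟨h4, fun _ => h5⟩
  · rw [if_neg (fun h' => h h'.1)]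
    symm
    apply Finset.sum_eq_zero
    intro D _
    rw [if_neg (fun h' => h h'.1)]

theorem G_inv_last [CharZero K] (l : Fin n) (hl : (l : ℕ) + 1 = n) (m : ℕ)
    (S : Finset (Fin n)) (hS : l ∉ S) :
    pre (invT l) (G K (2 * m) S) = G K (2 * m) S := by
  have sl : ∀ C : Finset (Fin n), ht C n = ht C l + if l ∈ C then 1 else 0 := by
    intro C
    have := ht_succ C l
    rwa [hl] at this
  have key := abstract_inv (P := Finset (Fin n) × Finset (Fin n)) (TF_cancel (K := K))
    (pre (invT l))
    (fun _ S P => relP S.2 P)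
    (fun _ P => mon (wt 1 P.1 + wt 0 P.2))
    (fun m P => G K (2 * m) P.2) (fun _ => rfl) (fun m P => G_pair m P.2) (tauL l) ?_
    (fun P => l ∉ P.2) ?_ ?_ ?_ ?_ ?_ m (S, S) hS
  · exact key
  · rintro ⟨C, D⟩
    unfold tauL
    by_cases h1 : l ∈ C <;> by_cases h3 : l ∈ D <;> simp [h1, h3]
  · rintro - ⟨C, D⟩
    rw [pre_inv_mon]
    congr 1
    funext i
    unfold tauL
    by_cases h4 : i = l
    · subst h4
      by_cases h1 : i ∈ C <;> by_cases h3 : i ∈ D <;> simp [h1, h3, wt]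
    · by_cases h1 : l ∈ C <;> by_cases h3 : l ∈ D <;> simp [h1, h3, wt, h4]
  · rintro - ⟨S1, S⟩ ⟨C, D⟩ hS ⟨h1, h3, h4⟩
    simp only [relP] at *
    have e1 := sl S
    simp only [hS, if_false] at e1
    rw [le_iff_last l hl] at h1 h3
    unfold tauL
    by_cases h5 : l ∈ C <;> by_cases h6 : l ∈ D
    · simp only [h5, h6, not_true, and_self, if_true]
      rw [le_iff_last l hl, le_iff_last l hl, sl, sl (C.erase l), sl (D.erase l)]
      simp only [notMem_erase, if_false, hS]
      have e2 := h1.1 l le_rfl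
      have e3 := h3.1 l le_rfl
      have e4 := sl C
      have e5 := sl D
      simp only [h5, h6, if_true] at e4 e5
      refine ⟨⟨fun i hi => ?_, ?_⟩, ⟨fun i hi => ?_, ?_⟩, ?_⟩
      · rw [ht_erase_last l hl _ i hi]; exact h1.1 i hi
      · rw [ht_erase_last l hl _ _ le_rfl]; omega
      · rw [ht_erase_last l hl _ i hi, ht_erase_last l hl _ i hi]; exact h3.1 i hi
      · rw [ht_erase_last l hl _ _ le_rfl, ht_erase_last l hl _ _ le_rfl]; omega
      · rw [ht_erase_last l hl _ _ le_rfl, ht_erase_last l hl _ _ le_rfl]; omega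
    · simp only [h5, h6, not_true, not_false_iff, and_true, and_false, if_false]
      rw [← le_iff_last l hl] at h1 h3
      exact ⟨h1, h3, h4⟩
    · simp only [h5, h6, not_true, not_false_iff, and_true, and_false, if_false]
      rw [← le_iff_last l hl] at h1 h3
      exact ⟨h1, h3, h4⟩
    · simp only [h5, h6, not_false_iff, and_self, if_true, if_false]
      rw [le_iff_last l hl, le_iff_last l hl, sl, sl (insert l C), sl (insert l D)]
      simp only [mem_insert_self, if_true, hS, if_false]
      have e2 := h1.1 l le_rfl
      have e3 := h3.1 l le_rfl
      have e4 := sl C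
      have e5 := sl D
      simp only [h5, h6, if_false] at e4 e5
      refine ⟨⟨fun i hi => ?_, ?_⟩, ⟨fun i hi => ?_, ?_⟩, ?_⟩
      · rw [ht_insert_last l hl _ i hi]; exact h1.1 i hi
      · rw [ht_insert_last l hl _ _ le_rfl]; omega
      · rw [ht_insert_last l hl _ i hi, ht_insert_last l hl _ i hi]; exact h3.1 i hi
      · rw [ht_insert_last l hl _ _ le_rfl, ht_insert_last l hl _ _ le_rfl]; omega
      · rw [ht_insert_last l hl _ _ le_rfl, ht_insert_last l hl _ _ le_rfl]; omega
  · rintro - ⟨S1, S⟩ ⟨C, D⟩ hS ⟨h1, h3, h4⟩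
    simp only [relP] at *
    unfold tauL
    have e3 := h3 l
    have e4 := sl C
    have e5 := sl D
    by_cases h5 : l ∈ C <;> by_cases h6 : l ∈ D <;> simp [h5, h6]
    simp only [h5, h6, if_true, if_false] at e4 e5
    omega
  · rintro - ⟨S1, S⟩ ⟨C, D⟩ hS hN ⟨h1, h3, h4⟩
    simp only [relP] at *
    refine ⟨?_, h3, h4⟩
    unfold tauL at h1 hN
    by_cases h5 : l ∈ S1
    · simp [h5, hS] at hN
    · simp only [h5, hS, not_false_iff, and_self, if_true, if_false] at h1
      rw [le_iff_last l hl] at h1 ⊢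
      have e1 := sl S
      have e2 := sl (insert l S)
      simp only [hS, mem_insert_self, if_true, if_false] at e1 e2
      rw [ht_insert_last l hl _ _ le_rfl] at e2
      refine ⟨fun i hi => ?_, by omega⟩
      rw [← ht_insert_last l hl _ i hi]
      exact h1.1 i hi
  · rintro - ⟨S1, S⟩ ⟨C, D⟩ hS hN ⟨h1, h3, h4⟩ hnr
    simp only [relP] at *
    have h5 : l ∉ S1 := by
      intro h5
      unfold tauL at hN
      simp [h5, hS] at hN
    have hτ : tauL l (S1, S) = (insert l S1, insert l S) := by
      unfold tauL
      simp [h5, hS]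
    rw [hτ] at hN hnr ⊢
    have e1 := sl S
    have e2 := sl (insert l S)
    simp only [hS, mem_insert_self, if_true, if_false] at e1 e2
    rw [ht_insert_last l hl _ _ le_rfl] at e2
    have hlt : ht C n < ht (insert l S) n := by
      by_contra hge
      apply hnr
      refine ⟨?_, h3, h4⟩
      change ∀ i, ht (insert l S) i ≤ ht C i
      rw [le_iff_last l hl]
      refine ⟨fun i hi => ?_, by omega⟩
      rw [ht_insert_last l hl _ i hi]
      exact h1 i
    have e3 := h3 l
    have e6 := h1 l
    have e4 := sl C
    have e5 := sl D
    have hC : l ∉ C := by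
      intro h
      simp only [h, if_true] at e4
      omega
    have hD : l ∉ D := by
      intro h
      simp only [h, hC, if_true, if_false] at e4 e5
      omega
    refine ⟨hD, ?_⟩
    rw [← mon_add, pre_inv_mon]
    congr 1
    funext i
    by_cases h4 : i = l
    · subst h4
      simp [wt, hC, hD]
    · simp [h4]

end DP


section Expand

variable {n : ℕ} {K : Type} [Field K]

def rho (n : ℕ) : Fin n → ℤ := fun i => (n : ℤ) - ((i : ℕ) : ℤ)

def dom (p : Fin n → ℤ) : Prop := Antitone p ∧ ∀ i, 0 ≤ p i

theorem anti_iff {α : Type*} [Preorder α] (q : Fin n → α) :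
    Antitone q ↔ ∀ a b : Fin n, (a : ℕ) + 1 = b → q b ≤ q a := by
  constructor
  · intro h a b hab
    apply h
    rw [Fin.le_def]
    omega
  · intro h
    have key : ∀ d : ℕ, ∀ a b : Fin n, (a : ℕ) + d = b → q b ≤ q a := by
      intro d
      induction d with
      | zero =>
        intro a b hab
        have : a = b := Fin.ext (by omega)
        rw [this]
      | succ d ih =>
        intro a b hab
        have hlt : (a : ℕ) + d < n := by have := b.2; omega
        exact (h ⟨a + d, hlt⟩ b (by simp only; omega)).trans (ih a ⟨a + d, hlt⟩ rfl)
    intro a b hab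
    exact key (b - a) a b (by rw [Fin.le_def] at hab; omega)

theorem neg_cancel [CharZero K] (a : TF n K) (h : a = - a) : a = 0 := by
  apply TF_cancel
  nth_rewrite 1 [h]
  simp

theorem alt_vanish_swap [CharZero K] (a b : Fin n) (hab : a ≠ b) (β : Fin n → ℤ) (g : TF n K)
    (hβ : β a = β b) (hg : pre (permT (Equiv.swap a b)) g = g) : alt (mon β * g) = 0 := by
  apply neg_cancel
  rw [← alt_swap a b hab, map_mul, hg, pre_swap_mon]
  congr 3
  funext i
  rw [Equiv.swap_apply_def]
  split_ifs with h1 h2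
  · rw [h1, hβ]
  · rw [h2, hβ]
  · rfl

theorem alt_vanish_inv [CharZero K] (l : Fin n) (β : Fin n → ℤ) (g : TF n K)
    (hβ : β l = 0) (hg : pre (invT l) g = g) : alt (mon β * g) = 0 := by
  apply neg_cancel
  rw [← alt_inv l, map_mul, hg, pre_inv_mon]
  congr 3
  funext i
  split_ifs with h1
  · rw [h1, hβ, neg_zero]
  · rfl

theorem vanish [CharZero K] (m : ℕ) (C : Finset (Fin n)) (p : Fin n → ℤ) (hp : dom p)
    (hq : ¬ dom (p + wt m C)) : alt (mon (p + wt m C + rho n) * G K m C) = 0 := by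
  by_cases h1 : Antitone (p + wt m C)
  · have h3 : ∃ i, (p + wt m C) i < 0 := by
      by_contra h
      push Not at h
      exact hq ⟨h1, h⟩
    obtain ⟨i, hi⟩ := h3
    have hn : n - 1 < n := by have := i.2; omega
    set l : Fin n := ⟨n - 1, hn⟩ with hl
    have hl1 : (l : ℕ) + 1 = n := by simp only [hl]; omega
    have hil : i ≤ l := by rw [Fin.le_def]; have := i.2; omega
    have h4 := h1 hil
    have h5 := hp.2 l
    simp only [Pi.add_apply, wt] at h4 hi
    by_cases hm : Even m
    · by_cases hlC : l ∈ C
      · simp only [hlC, hm, if_true] at h4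
        split_ifs at * <;> omega
      · obtain ⟨k, rfl⟩ := hm
        rw [← two_mul] at *
        refine alt_vanish_inv l _ _ ?_ (G_inv_last l hl1 k C hlC)
        have : Even (2 * k) := by simp
        simp only [hlC, this, if_true, if_false] at h4
        simp only [Pi.add_apply, wt, rho, hlC, this, if_true, if_false]
        split_ifs at * <;> omega
    · simp only [hm, if_false] at h4 hi
      split_ifs at * <;> omega
  · rw [anti_iff] at h1
    push Not at h1
    obtain ⟨a, b, hab, hlt⟩ := h1
    have hne : a ≠ b := by rintro rfl; omega
    have h4 : p b ≤ p a := hp.1 (by rw [Fin.le_def]; omega)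
    simp only [Pi.add_apply, wt] at hlt
    have ha : a ∉ C := by
      intro h
      simp only [h, if_true] at hlt
      split_ifs at hlt <;> omega
    have hb : b ∈ C := by
      by_contra h
      simp only [h, ha, if_false] at hlt
      omega
    refine alt_vanish_swap a b hne _ _ ?_ (G_inv_swap a b hab m C (by tauto))
    simp only [ha, hb, if_true, if_false] at hlt
    simp only [Pi.add_apply, wt, rho, ha, hb, if_true, if_false]
    omega

/-- Extending a finite sequence of columns by a constant. -/
def ext (m : ℕ) (S : Finset (Fin n)) (f : Fin m → Finset (Fin n)) : ℕ → Finset (Fin n) :=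
  fun j => if h : j < m then f ⟨j, h⟩ else S

/-- Partial weights. -/
def pos (m : ℕ) (p : Fin n → ℤ) (C : ℕ → Finset (Fin n)) (j : ℕ) : Fin n → ℤ :=
  p + ∑ j' ∈ Finset.Ico j m, wt j' (C j')

/-- Good sequences. -/
def Gd (m : ℕ) (p : Fin n → ℤ) (C : ℕ → Finset (Fin n)) : Prop :=
  ∀ j < m, rel j (C (j + 1)) (C j) ∧ dom (pos m p C j)

theorem pos_congr (m : ℕ) (p : Fin n → ℤ) (C D : ℕ → Finset (Fin n)) (j : ℕ)
    (h : ∀ j < m, C j = D j) : pos m p C j = pos m p D j := by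
  unfold pos
  congr 1
  refine Finset.sum_congr rfl fun i hi => ?_
  rw [h i (Finset.mem_Ico.mp hi).2]

theorem Gd_congr (m : ℕ) (p : Fin n → ℤ) (C D : ℕ → Finset (Fin n))
    (h : ∀ j ≤ m, C j = D j) : Gd m p C ↔ Gd m p D := by
  unfold Gd
  refine forall_congr' fun j => forall_congr' fun hj => ?_
  rw [pos_congr m p C D j (fun j hj => h j (by omega)), h j (by omega), h (j + 1) (by omega)]

theorem pos_succ (m : ℕ) (p : Fin n → ℤ) (C : ℕ → Finset (Fin n)) (j : ℕ) (hj : j ≤ m) :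
    pos (m + 1) p C j = pos m (p + wt m (C m)) C j := by
  unfold pos
  rw [Finset.sum_Ico_succ_top hj]
  abel

theorem pos_self (m : ℕ) (p : Fin n → ℤ) (C : ℕ → Finset (Fin n)) : pos m p C m = p := by
  simp [pos]

theorem Gd_succ (m : ℕ) (p : Fin n → ℤ) (C : ℕ → Finset (Fin n)) :
    Gd (m + 1) p C ↔ rel m (C (m + 1)) (C m) ∧ dom (p + wt m (C m)) ∧
      Gd m (p + wt m (C m)) C := by
  constructor
  · intro h
    have h1 := h m (by omega)
    rw [pos_succ m p C m le_rfl, pos_self] at h1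
    refine ⟨h1.1, h1.2, fun j hj => ?_⟩
    have h2 := h j (by omega)
    rw [pos_succ m p C j (by omega)] at h2
    exact h2
  · rintro ⟨h1, h2, h3⟩ j hj
    rw [pos_succ m p C j (by omega)]
    rcases Nat.lt_succ_iff_lt_or_eq.mp hj with h | rfl
    · exact h3 j h
    · rw [pos_self]; exact ⟨h1, h2⟩

theorem expand_aux [CharZero K] (m : ℕ) : ∀ (S : Finset (Fin n)) (p : Fin n → ℤ), dom p →
    alt (mon (p + rho n) * G K m S) = ∑ f : Fin m → Finset (Fin n),
      if Gd m p (ext m S f) then aDet (pos m p (ext m S f) 0 + rho n) else 0 := by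
  induction m with
  | zero =>
    intro S p hp
    have h1 : ∀ f : Fin 0 → Finset (Fin n), Gd 0 p (ext 0 S f) := by
      intro f j hj
      omega
    simp only [h1, if_true, pos_self]
    rw [G, mul_one, alt_mon]
    simp
  | succ m ih =>
    intro S p hp
    rw [G, Finset.mul_sum, alt_sum, ← Equiv.sum_comp (Fin.snocEquiv fun _ => Finset (Fin n)),
      Fintype.sum_prod_type]
    refine Finset.sum_congr rfl fun C _ => ?_
    have e1 : ∀ f : Fin m → Finset (Fin n), ∀ j ≤ m,
        ext (m + 1) S (Fin.snocEquiv (fun _ => Finset (Fin n)) (C, f)) j = ext m C f j := by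
      intro f j hj
      unfold ext
      have hj' : j < m + 1 := by omega
      by_cases h : j < m
      · simp [h, hj', Fin.snoc]
      · have : j = m := by omega
        subst this
        simp [Fin.snoc]
    have e2 : ∀ f : Fin m → Finset (Fin n),
        ext (m + 1) S (Fin.snocEquiv (fun _ => Finset (Fin n)) (C, f)) (m + 1) = S := by
      intro f
      simp [ext]
    have e3 : ∀ f : Fin m → Finset (Fin n), ext m C f m = C := by
      intro f
      simp [ext]
    by_cases hr : rel m S C
    · rw [if_pos hr]
      have hmon : mon (p + rho n) * (mon (wt m C) * G K m C)
          = mon (p + wt m C + rho n) * G K m C := by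
        rw [mon_add, mon_add, mon_add]; ring
      rw [hmon]
      by_cases hd : dom (p + wt m C)
      · rw [ih C _ hd]
        refine Finset.sum_congr rfl fun f _ => ?_
        rw [pos_succ m _ _ 0 (by omega), e1 f m le_rfl, e3,
          pos_congr m _ _ (ext m C f) 0 (fun j hj => e1 f j (by omega))]
        have : Gd (m + 1) p (ext (m + 1) S (Fin.snocEquiv (fun _ => Finset (Fin n)) (C, f)))
            ↔ Gd m (p + wt m C) (ext m C f) := by
          rw [Gd_succ, e2, e1 f m le_rfl, e3, Gd_congr m _ _ (ext m C f) (e1 f)]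
          exact ⟨fun h => h.2.2, fun h => ⟨hr, hd, h⟩⟩
        simp only [this]
      · rw [vanish m C p hp hd]
        symm
        apply Finset.sum_eq_zero
        intro f _
        rw [if_neg]
        rw [Gd_succ, e1 f m le_rfl, e3]
        tauto
    · rw [if_neg hr, mul_zero, alt_zero]
      symm
      apply Finset.sum_eq_zero
      intro f _
      rw [if_neg]
      rw [Gd_succ, e2, e1 f m le_rfl, e3]
      tauto

theorem expand [CharZero K] (c : ℕ) (p : Fin n → ℤ) (hp : dom p) :
    aDet (p + rho n) * G K (2 * c) ∅ = ∑ f : Fin (2 * c) → Finset (Fin n),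
      if Gd (2 * c) p (ext (2 * c) ∅ f) then
        aDet (pos (2 * c) p (ext (2 * c) ∅ f) 0 + rho n) else 0 := by
  rw [← expand_aux _ _ _ hp, alt_mul, alt_mon]
  apply inv_all
  · intro a b hab
    exact G_inv_swap a b hab _ _ (by simp)
  · intro l hl
    exact G_inv_last l hl _ _ (by simp)

theorem sum_parity (c : ℕ) : ∑ j ∈ Finset.range (2 * c), (if Even j then (1 : ℤ) else 0) = c := by
  induction c with
  | zero => simp
  | succ c ih =>
    have e : 2 * (c + 1) = 2 * c + 1 + 1 := by ring
    rw [e, Finset.sum_range_succ, Finset.sum_range_succ, ih]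
    simp

theorem pos_apply (m : ℕ) (p : Fin n → ℤ) (C : ℕ → Finset (Fin n)) (j : ℕ) (i : Fin n) :
    pos m p C j i = p i + (((Finset.Ico j m).filter fun j' => i ∈ C j').card : ℤ)
      - ∑ j' ∈ Finset.Ico j m, (if Even j' then (1 : ℤ) else 0) := by
  unfold pos
  simp only [Pi.add_apply, Finset.sum_apply, wt, Finset.sum_sub_distrib, Finset.card_filter]
  push_cast
  ring

theorem sum_parity_Ico (c k : ℕ) (hk : k ≤ c) :
    ∑ j ∈ Finset.Ico (2 * k) (2 * c), (if Even j then (1 : ℤ) else 0) = c - k := by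
  rw [Finset.sum_Ico_eq_sub _ (by omega), sum_parity, sum_parity]

theorem rect [CharZero K] (c : ℕ) :
    (aDet (rho n) : TF n K) * G K (2 * c) ∅ = aDet ((fun _ => (c : ℤ)) + rho n) := by
  have h0 : dom (0 : Fin n → ℤ) := ⟨fun _ _ _ => le_rfl, fun _ => le_rfl⟩
  have h1 := expand (K := K) c 0 h0
  rw [zero_add] at h1
  rw [h1]
  rw [Finset.sum_eq_single (fun _ => Finset.univ)]
  · have hu : ∀ j < 2 * c, ext (2 * c) ∅ (fun _ => (Finset.univ : Finset (Fin n))) j = univ := by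
      intro j hj
      simp [ext, hj]
    have hpos : ∀ j, ∀ i, pos (2 * c) 0 (ext (2 * c) ∅ (fun _ => (Finset.univ : Finset (Fin n)))) j i
        = ∑ j' ∈ Finset.Ico j (2 * c), (1 - if Even j' then (1 : ℤ) else 0) := by
      intro j i
      rw [pos_congr _ _ _ (fun _ => univ) j hu]
      simp [pos, wt]
    rw [if_pos]
    · congr 2
      funext i
      rw [hpos, Finset.sum_sub_distrib]
      have := sum_parity_Ico c 0 (by omega)
      simp only [mul_zero] at this
      rw [this]
      simp
      ring
    · intro j hj
      refine ⟨?_, ?_, ?_⟩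
      · rw [hu j hj]
        by_cases h : j + 1 < 2 * c
        · rw [hu _ h]
          exact ⟨fun _ => le_rfl, fun _ => rfl⟩
        · have : ¬ Even j := by
            intro ⟨k, hk⟩
            omega
          refine ⟨fun i => ?_, fun h => absurd h this⟩
          have : ext (2 * c) ∅ (fun _ => (Finset.univ : Finset (Fin n))) (j + 1) = ∅ := by
            simp [ext, h]
          rw [this, ht_empty]
          omega
      · intro a b _
        rw [hpos, hpos]
      · intro i
        rw [hpos]
        apply Finset.sum_nonneg
        intro j _
        split_ifs <;> norm_num
  · intro f _ hf
    rw [if_neg]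
    intro hG
    apply hf
    funext j0
    have hc : 0 < c := by have := j0.2; omega
    set C := ext (2 * c) ∅ f with hC
    have hCj : f j0 = C j0 := by simp [hC, ext]
    rw [hCj]
    -- the first column is full
    have htop : C (2 * c - 1) = univ := by
      ext i
      simp only [mem_univ, iff_true]
      have hn : n - 1 < n := by have := i.2; omega
      set l : Fin n := ⟨n - 1, hn⟩ with hl
      have hl1 : (l : ℕ) + 1 = n := by simp only [hl]; omega
      have hil : i ≤ l := by rw [Fin.le_def]; have := i.2; omega
      have g1 := hG (2 * c - 1) (by omega)
      have g2 := hG (2 * c - 2) (by omega)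
      have e1 : 2 * c - 2 + 1 = 2 * c - 1 := by omega
      have hodd : ¬ Even (2 * c - 1) := by rintro ⟨k, hk⟩; omega
      have hev : Even (2 * c - 2) := ⟨c - 1, by omega⟩
      rw [e1] at g2
      have hI1 : Finset.Ico (2 * c - 1) (2 * c) = {2 * c - 1} := by
        ext x; simp only [mem_Ico, mem_singleton]; omega
      have hI2 : Finset.Ico (2 * c - 2) (2 * c) = {2 * c - 2, 2 * c - 1} := by
        ext x; simp only [mem_Ico, mem_insert, mem_singleton]; omega
      have hl2 : l ∈ C (2 * c - 1) := by
        by_contra hcon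
        have q := g2.2.2 l
        unfold pos at q
        rw [hI2, Finset.sum_pair (by omega)] at q
        simp only [wt, Pi.add_apply, Pi.zero_apply, hcon, hodd, hev, if_true, if_false] at q
        have hD : l ∈ C (2 * c - 2) := by
          by_contra hD
          simp [hD] at q
        have a1 := ht_succ (C (2 * c - 2)) l
        have a2 := ht_succ (C (2 * c - 1)) l
        have a3 := g2.1.1 l
        have a4 := g2.1.2 hev
        rw [hl1] at a1 a2
        simp only [hD, hcon, if_true, if_false] at a1 a2
        omega
      have q := g1.2.1 hil
      unfold pos at q
      rw [hI1, Finset.sum_singleton] at q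
      simp only [wt, Pi.add_apply, Pi.zero_apply, hl2, hodd, if_true, if_false] at q
      by_contra hi
      simp [hi] at q
    have hall : ∀ d ≤ 2 * c - 1, C (2 * c - 1 - d) = univ := by
      intro d
      induction d with
      | zero => intro _; exact htop
      | succ d ih =>
        intro hd
        have g := (hG (2 * c - 1 - (d + 1)) (by omega)).1.1 n
        have e : 2 * c - 1 - (d + 1) + 1 = 2 * c - 1 - d := by omega
        rw [e, ih (by omega), ht_top, ht_top] at g
        apply Finset.eq_univ_of_card
        have := Finset.card_le_univ (C (2 * c - 1 - (d + 1)))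
        rw [Finset.card_univ] at g
        omega
    have := hall (2 * c - 1 - j0) (by omega)
    have e : 2 * c - 1 - (2 * c - 1 - (j0 : ℕ)) = j0 := by have := j0.2; omega
    rw [e] at this
    exact this
  · intro h
    exact absurd (Finset.mem_univ _) h

end Expand


section Mid

variable {n : ℕ}

theorem low_card (s : Finset ℕ) (h : ∀ a b, a ≤ b → b ∈ s → a ∈ s) (v : ℕ) :
    v ∈ s ↔ v < s.card := by
  have hs : s = Finset.range s.card := by
    have h1 : ∀ v ∈ s, v < s.card := by
      intro v hv
      have : Finset.range (v + 1) ⊆ s := by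
        intro a ha
        exact h a v (by simp at ha; omega) hv
      have := Finset.card_le_card this
      simp at this
      omega
    apply Finset.eq_of_subset_of_card_le
    · intro v hv
      exact Finset.mem_range.mpr (h1 v hv)
    · simp
  conv_lhs => rw [hs]
  exact Finset.mem_range

def cnt (t : ℕ → Fin n → ℕ) (i : Fin n) (v : ℕ) : ℕ := ∑ e ∈ Finset.range v, t e i

def Kt (t : ℕ → Fin n → ℕ) (e i : ℕ) : ℕ :=
  ∑ a ∈ univ.filter (fun a : Fin n => (a : ℕ) < i), t e a

theorem cnt_zero (t : ℕ → Fin n → ℕ) (i : Fin n) : cnt t i 0 = 0 := by simp [cnt]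

theorem cnt_succ (t : ℕ → Fin n → ℕ) (i : Fin n) (v : ℕ) :
    cnt t i (v + 1) = cnt t i v + t v i := by
  simp [cnt, Finset.sum_range_succ]

theorem cnt_mono (t : ℕ → Fin n → ℕ) (i : Fin n) {v w : ℕ} (h : v ≤ w) :
    cnt t i v ≤ cnt t i w := by
  unfold cnt
  apply Finset.sum_le_sum_of_subset
  intro a
  simp only [Finset.mem_range]
  omega

theorem Kt_zero (t : ℕ → Fin n → ℕ) (e : ℕ) : Kt t e 0 = 0 := by simp [Kt]

theorem Kt_succ (t : ℕ → Fin n → ℕ) (e : ℕ) (a : Fin n) :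
    Kt t e (a + 1) = Kt t e a + t e a := by
  unfold Kt
  have : univ.filter (fun b : Fin n => (b : ℕ) < a + 1)
      = insert a (univ.filter (fun b : Fin n => (b : ℕ) < a)) := by
    ext b
    simp only [mem_filter, mem_univ, true_and, mem_insert, Fin.ext_iff]
    omega
  rw [this, Finset.sum_insert (by simp), add_comm]

theorem Kt_top (t : ℕ → Fin n → ℕ) (e : ℕ) : Kt t e n = ∑ a, t e a := by
  unfold Kt
  congr 1
  ext b
  simp

theorem Kt_mono (t : ℕ → Fin n → ℕ) (e : ℕ) {i j : ℕ} (h : i ≤ j) : Kt t e i ≤ Kt t e j := by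
  unfold Kt
  apply Finset.sum_le_sum_of_subset
  intro b
  simp only [mem_filter, mem_univ, true_and]
  omega

/-- The matrices `t e i` = number of entries `e + 1` in row `i`. -/
structure TM (n c : ℕ) (lam ν : Fin n → ℕ) (t : ℕ → Fin n → ℕ) : Prop where
  t0 : ∀ e i, n ≤ e → t e i = 0
  t1 : ∀ i, lam i + cnt t i n = ν i + c
  t2 : ∀ a b : Fin n, (a : ℕ) + 1 = b → ∀ e, lam b + cnt t b (e + 1) ≤ lam a + cnt t a e
  t3 : ∀ (i : Fin n) (e : ℕ), Kt t (e + 1) (i + 1) ≤ Kt t e i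
  t4 : ∀ e, Even (Kt t e n) ∧ Kt t e n ≤ 2 * c
  t5 : ∀ l : Fin n, (l : ℕ) + 1 = n → ∀ e, 0 < t e l →
    2 * c ≤ Kt t e n + 2 * lam l + 2 * cnt t l e

/-- Matrix attached to a sequence of columns. -/
def tC (c : ℕ) (C : ℕ → Finset (Fin n)) (e : ℕ) (i : Fin n) : ℕ :=
  ((Finset.range (2 * c)).filter fun j => i ∈ C j ∧ ht (C j) i = e).card

theorem ht_le (C : Finset (Fin n)) (i : Fin n) : ht C i ≤ i := by
  unfold ht
  have : (C.filter (fun a : Fin n => (a : ℕ) < i)) ⊆ Finset.Iio i := by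
    intro a
    simp only [mem_filter, Finset.mem_Iio, Fin.lt_def]
    tauto
  have := Finset.card_le_card this
  simpa using this

theorem cnt_tC (c : ℕ) (C : ℕ → Finset (Fin n)) (i : Fin n) (v : ℕ) :
    cnt (tC c C) i v = ((Finset.range (2 * c)).filter fun j => i ∈ C j ∧ ht (C j) i < v).card := by
  induction v with
  | zero => simp [cnt]
  | succ v ih =>
    rw [cnt_succ, ih, tC, ← Finset.card_union_of_disjoint]
    · congr 1
      ext j
      simp only [mem_union, mem_filter]
      constructor
      · rintro (⟨h1, h2, h3⟩ | ⟨h1, h2, h3⟩)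
        · exact ⟨h1, h2, by omega⟩
        · exact ⟨h1, h2, by omega⟩
      · rintro ⟨h1, h2, h3⟩
        rcases Nat.lt_succ_iff_lt_or_eq.mp h3 with h | h
        · exact Or.inl ⟨h1, h2, h⟩
        · exact Or.inr ⟨h1, h2, h⟩
    · rw [Finset.disjoint_filter]
      rintro j _ ⟨_, h⟩ ⟨_, h'⟩
      omega

theorem Kt_tC (c : ℕ) (C : ℕ → Finset (Fin n)) (e i : ℕ) (hi : i ≤ n) :
    Kt (tC c C) e i = ((Finset.range (2 * c)).filter fun j => e < ht (C j) i).card := by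
  induction i with
  | zero => simp [Kt_zero, ht_zero]
  | succ i ih =>
    have := Kt_succ (tC c C) e ⟨i, by omega⟩
    simp only at this
    rw [this, ih (by omega), tC, ← Finset.card_union_of_disjoint]
    · congr 1
      ext j
      have hs := ht_succ (C j) ⟨i, by omega⟩
      simp only at hs
      simp only [mem_union, mem_filter]
      by_cases hm : (⟨i, by omega⟩ : Fin n) ∈ C j
      · simp only [hm, if_true, true_and] at hs ⊢
        rw [hs]
        constructor
        · rintro (⟨h1, h2⟩ | ⟨h1, h2⟩)
          · exact ⟨h1, by omega⟩
          · exact ⟨h1, by omega⟩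
        · rintro ⟨h1, h2⟩
          by_cases h : e < ht (C j) i
          · exact Or.inl ⟨h1, h⟩
          · exact Or.inr ⟨h1, by omega⟩
      · simp only [hm, if_false, false_and, and_false, or_false] at hs ⊢
        rw [hs, add_zero]
    · rw [Finset.disjoint_filter]
      rintro j _ h ⟨_, h'⟩
      simp only at h'
      omega

/-- Chains of columns. -/
structure Chain (c : ℕ) (C : ℕ → Finset (Fin n)) : Prop where
  supp : ∀ j, 2 * c ≤ j → C j = ∅
  anti : ∀ i j, ht (C (j + 1)) i ≤ ht (C j) i
  par : ∀ k, ht (C (2 * k)) n = ht (C (2 * k + 1)) n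

theorem Chain.anti' {c : ℕ} {C : ℕ → Finset (Fin n)} (h : Chain c C) (i : ℕ) {j k : ℕ}
    (hjk : j ≤ k) : ht (C k) i ≤ ht (C j) i :=
  antitone_nat_of_succ_le (f := fun j => ht (C j) i) (fun j => h.anti i j) hjk

theorem Chain.Q {c : ℕ} {C : ℕ → Finset (Fin n)} (h : Chain c C) (e i j : ℕ) (hi : i ≤ n) :
    e < ht (C j) i ↔ j < Kt (tC c C) e i := by
  rw [Kt_tC c C e i hi, ← low_card]
  · simp only [mem_filter, Finset.mem_range]
    constructor
    · intro h1
      refine ⟨?_, h1⟩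
      by_contra h2
      rw [h.supp j (by omega), ht_empty] at h1
      omega
    · exact fun h => h.2
  · intro a b hab
    simp only [mem_filter, Finset.mem_range]
    rintro ⟨h1, h2⟩
    have := h.anti' i hab
    exact ⟨by omega, by omega⟩

theorem chain_inj (c : ℕ) (C D : ℕ → Finset (Fin n)) (hC : Chain c C) (hD : Chain c D)
    (h : tC c C = tC c D) : C = D := by
  have hht : ∀ j i, i ≤ n → ht (C j) i = ht (D j) i := by
    intro j i hi
    have key : ∀ e, e < ht (C j) i ↔ e < ht (D j) i := by
      intro e
      rw [hC.Q e i j hi, hD.Q e i j hi, h]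
    have k1 := key (ht (C j) i)
    have k2 := key (ht (D j) i)
    omega
  funext j
  ext i
  have a1 := ht_succ (C j) i
  have a2 := ht_succ (D j) i
  rw [hht j i (by omega), hht j (i + 1) (by omega)] at a1
  by_cases h1 : i ∈ C j <;> by_cases h2 : i ∈ D j <;> simp only [h1, h2, if_true, if_false] at * <;>
    omega

/-- Column counts from position `j0` on. -/
def colN (c : ℕ) (C : ℕ → Finset (Fin n)) (j0 : ℕ) (i : Fin n) : ℕ :=
  ((Finset.Ico j0 (2 * c)).filter fun j => i ∈ C j).card

theorem colN_cut {c : ℕ} {C : ℕ → Finset (Fin n)} (h : Chain c C) (e : ℕ) (i : Fin n) :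
    colN c C (Kt (tC c C) e i) i = cnt (tC c C) i (e + 1) := by
  rw [cnt_tC, colN]
  congr 1
  ext j
  have := h.Q e i j (by omega)
  simp only [mem_filter, mem_Ico, Finset.mem_range]
  constructor
  · rintro ⟨⟨h1, h2⟩, h3⟩
    exact ⟨h2, h3, by omega⟩
  · rintro ⟨h1, h2, h3⟩
    exact ⟨⟨by omega, h1⟩, h2⟩

theorem colN_cut' {c : ℕ} {C : ℕ → Finset (Fin n)} (h : Chain c C) (e : ℕ) (i : Fin n) :
    colN c C (Kt (tC c C) e (i + 1)) i = cnt (tC c C) i e := by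
  rw [cnt_tC, colN]
  congr 1
  ext j
  have := h.Q e (i + 1) j (by omega)
  have hs := ht_succ (C j) i
  simp only [mem_filter, mem_Ico, Finset.mem_range]
  constructor
  · rintro ⟨⟨h1, h2⟩, h3⟩
    simp only [h3, if_true] at hs
    exact ⟨h2, h3, by omega⟩
  · rintro ⟨h1, h2, h3⟩
    simp only [h2, if_true] at hs
    exact ⟨⟨by omega, h1⟩, h2⟩

theorem colN_succ (c : ℕ) (C : ℕ → Finset (Fin n)) (j : ℕ) (i : Fin n) (hj : j < 2 * c) :
    colN c C j i = colN c C (j + 1) i + if i ∈ C j then 1 else 0 := by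
  unfold colN
  rw [Finset.card_filter, Finset.card_filter, Finset.sum_eq_sum_Ico_succ_bot hj, add_comm]

theorem colN_anti (c : ℕ) (C : ℕ → Finset (Fin n)) {j k : ℕ} (i : Fin n) (hjk : j ≤ k) :
    colN c C k i ≤ colN c C j i := by
  unfold colN
  apply Finset.card_le_card
  intro a
  simp only [mem_filter, mem_Ico]
  rintro ⟨⟨h1, h2⟩, h3⟩
  exact ⟨⟨by omega, h2⟩, h3⟩

theorem colN_zero (c : ℕ) (C : ℕ → Finset (Fin n)) (i : Fin n) :
    colN c C 0 i = cnt (tC c C) i n := by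
  rw [cnt_tC, colN]
  congr 1
  ext j
  have := ht_le (C j) i
  simp only [mem_filter, mem_Ico, Finset.mem_range]
  constructor
  · rintro ⟨⟨h1, h2⟩, h3⟩
    exact ⟨h2, h3, by omega⟩
  · rintro ⟨h1, h2, h3⟩
    exact ⟨⟨by omega, h1⟩, h2⟩

/-- Conditions on column sequences, in terms of natural numbers. -/
structure CG (n c : ℕ) (lam ν : Fin n → ℕ) (C : ℕ → Finset (Fin n)) : Prop where
  chain : Chain c C
  fin : ∀ i, lam i + colN c C 0 i = ν i + c
  part : ∀ a b : Fin n, (a : ℕ) + 1 = b → ∀ j, lam b + colN c C j b ≤ lam a + colN c C j a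
  nonneg : ∀ l : Fin n, (l : ℕ) + 1 = n → ∀ k ≤ c, c ≤ lam l + colN c C (2 * k) l + k

theorem TM_of_CG {c : ℕ} {lam ν : Fin n → ℕ} {C : ℕ → Finset (Fin n)} (h : CG n c lam ν C) :
    TM n c lam ν (tC c C) where
  t0 := by
    intro e i he
    unfold tC
    rw [Finset.card_eq_zero, Finset.filter_eq_empty_iff]
    rintro j _ ⟨_, h2⟩
    have := ht_le (C j) i
    omega
  t1 := by
    intro i
    rw [← colN_zero]
    exact h.fin i
  t2 := by
    intro a b hab e
    have := h.part a b hab (Kt (tC c C) e b)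
    rw [colN_cut h.chain, ← hab, colN_cut' h.chain] at this
    exact this
  t3 := by
    intro i e
    by_contra hlt
    push Not at hlt
    rw [← h.chain.Q _ _ _ (by omega)] at hlt
    have h1 := h.chain.Q e i (Kt (tC c C) e i) (by omega)
    have hs := ht_succ (C (Kt (tC c C) e i)) i
    split_ifs at hs <;> omega
  t4 := by
    intro e
    constructor
    · by_contra ho
      rw [Nat.not_even_iff_odd] at ho
      obtain ⟨k, hk⟩ := ho
      have h1 := h.chain.Q e n (2 * k) le_rfl
      have h2 := h.chain.Q e n (2 * k + 1) le_rfl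
      have h3 := h.chain.par k
      omega
    · rw [Kt_tC _ _ _ _ le_rfl]
      refine (Finset.card_filter_le _ _).trans ?_
      simp
  t5 := by
    intro l hl e _
    have hev : Even (Kt (tC c C) e n) ∧ Kt (tC c C) e n ≤ 2 * c := by
      constructor
      · by_contra ho
        rw [Nat.not_even_iff_odd] at ho
        obtain ⟨k, hk⟩ := ho
        have h1 := h.chain.Q e n (2 * k) le_rfl
        have h2 := h.chain.Q e n (2 * k + 1) le_rfl
        have h3 := h.chain.par k
        omega
      · rw [Kt_tC _ _ _ _ le_rfl]
        refine (Finset.card_filter_le _ _).trans ?_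
        simp
    obtain ⟨⟨k, hk⟩, hle⟩ := hev
    have h1 := h.nonneg l hl k (by omega)
    have h2 := colN_cut' h.chain e l
    rw [hl, hk, ← two_mul] at h2
    omega

/-- Column sequence attached to a matrix. -/
def colsOf (t : ℕ → Fin n → ℕ) (j : ℕ) : Finset (Fin n) :=
  univ.filter fun i => ∃ e, Kt t e i ≤ j ∧ j < Kt t e (i + 1)

theorem TM.Kanti {c : ℕ} {lam ν : Fin n → ℕ} {t : ℕ → Fin n → ℕ} (h : TM n c lam ν t)
    (i : ℕ) (hi : i ≤ n) {e e' : ℕ} (hee : e ≤ e') : Kt t e' i ≤ Kt t e i := by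
  cases i with
  | zero => simp [Kt_zero]
  | succ i =>
    refine antitone_nat_of_succ_le (f := fun e => Kt t e (i + 1)) (fun e => ?_) hee
    exact (h.t3 ⟨i, by omega⟩ e).trans (Kt_mono t e (by simp))

theorem colsOf_ht {c : ℕ} {lam ν : Fin n → ℕ} {t : ℕ → Fin n → ℕ} (h : TM n c lam ν t)
    (j i : ℕ) (hi : i ≤ n) : ∀ e, e < ht (colsOf t j) i ↔ j < Kt t e i := by
  induction i with
  | zero => simp [Kt_zero, ht_zero]
  | succ i ih =>
    intro e
    have ih := ih (by omega)
    have hs := ht_succ (colsOf t j) ⟨i, by omega⟩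
    simp only at hs
    by_cases hm : (⟨i, by omega⟩ : Fin n) ∈ colsOf t j
    · simp only [hm, if_true] at hs
      simp only [colsOf, mem_filter, mem_univ, true_and] at hm
      obtain ⟨e0, h1, h2⟩ := hm
      have h3 := ih e0
      have h4 : ht (colsOf t j) i = e0 := by
        cases e0 with
        | zero => omega
        | succ e0 =>
          have h5 := h.t3 ⟨i, by omega⟩ e0
          simp only at h5
          have h6 := ih e0
          omega
      rw [hs, h4]
      constructor
      · intro he
        have := h.Kanti (i + 1) hi (show e ≤ e0 by omega)
        omega
      · intro he
        by_contra hlt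
        have h5 := h.Kanti (i + 1) hi (show e0 + 1 ≤ e by omega)
        have h6 := h.t3 ⟨i, by omega⟩ e0
        simp only at h6
        omega
    · simp only [hm, if_false] at hs
      simp only [colsOf, mem_filter, mem_univ, true_and] at hm
      push Not at hm
      have h1 := hm e
      have h2 := ih e
      have h3 := Kt_mono t e (show i ≤ i + 1 by omega)
      rw [hs, add_zero, h2]
      constructor
      · intro; omega
      · intro h4
        by_contra h5
        have := h1 (by omega)
        omega

theorem colsOf_chain {c : ℕ} {lam ν : Fin n → ℕ} {t : ℕ → Fin n → ℕ} (h : TM n c lam ν t) :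
    Chain c (colsOf t) where
  supp := by
    intro j hj
    ext i
    simp only [colsOf, mem_filter, mem_univ, true_and, notMem_empty, iff_false]
    rintro ⟨e, _, h2⟩
    have h3 := Kt_mono t e (show (i : ℕ) + 1 ≤ n by omega)
    have h4 := (h.t4 e).2
    omega
  anti := by
    have key : ∀ i j, i ≤ n → ht (colsOf t (j + 1)) i ≤ ht (colsOf t j) i := by
      intro i j hi
      by_contra hlt
      push Not at hlt
      rw [colsOf_ht h _ _ hi] at hlt
      have := colsOf_ht h j i hi (ht (colsOf t j) i)
      omega
    intro i j
    by_cases hi : i ≤ n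
    · exact key i j hi
    · rw [ht_ge _ (by omega : n ≤ i), ht_ge _ (by omega : n ≤ i)]
      exact key n j le_rfl
  par := by
    intro k
    have key : ∀ e, e < ht (colsOf t (2 * k)) n ↔ e < ht (colsOf t (2 * k + 1)) n := by
      intro e
      rw [colsOf_ht h _ _ le_rfl, colsOf_ht h _ _ le_rfl]
      obtain ⟨d, hd⟩ := (h.t4 e).1
      omega
    have k1 := key (ht (colsOf t (2 * k)) n)
    have k2 := key (ht (colsOf t (2 * k + 1)) n)
    omega

theorem tC_colsOf {c : ℕ} {lam ν : Fin n → ℕ} {t : ℕ → Fin n → ℕ} (h : TM n c lam ν t) :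
    tC c (colsOf t) = t := by
  have hK : ∀ e i, i ≤ n → Kt (tC c (colsOf t)) e i = Kt t e i := by
    intro e i hi
    have key : ∀ j, j < Kt (tC c (colsOf t)) e i ↔ j < Kt t e i := by
      intro j
      rw [← colsOf_ht h j i hi, (colsOf_chain h).Q e i j hi]
    have k1 := key (Kt t e i)
    have k2 := key (Kt (tC c (colsOf t)) e i)
    omega
  funext e i
  have h1 := Kt_succ t e i
  have h2 := Kt_succ (tC c (colsOf t)) e i
  rw [hK _ _ (by omega), hK _ _ (by omega)] at h2
  omega

theorem CG_of_TM {c : ℕ} {lam ν : Fin n → ℕ} (hlam : Antitone lam) {t : ℕ → Fin n → ℕ}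
    (h : TM n c lam ν t) : CG n c lam ν (colsOf t) := by
  have hch := colsOf_chain h
  have ht' := tC_colsOf h
  refine ⟨hch, ?_, ?_, ?_⟩
  · intro i
    rw [colN_zero, ht']
    exact h.t1 i
  · intro a b hab
    have hlab : lam b ≤ lam a := hlam (by rw [Fin.le_def]; omega)
    have hdown : ∀ d j, j + d = 2 * c →
        lam b + colN c (colsOf t) j b ≤ lam a + colN c (colsOf t) j a := by
      intro d
      induction d with
      | zero =>
        intro j hj
        have : ∀ i, colN c (colsOf t) j i = 0 := by
          intro i
          unfold colN
          rw [Finset.Ico_eq_empty (by omega)]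
          simp
        rw [this, this]
        omega
      | succ d ih =>
        intro j hj
        by_cases ha : a ∈ colsOf t j
        · have h1 := ih (j + 1) (by omega)
          have h2 := colN_succ c (colsOf t) j a (by omega)
          have h3 := colN_succ c (colsOf t) j b (by omega)
          simp only [ha, if_true] at h2
          split_ifs at h3 <;> omega
        · set e := ht (colsOf t j) b with he
          have hj0 : Kt t e b ≤ j := by
            have := colsOf_ht h j b (by omega) e
            omega
          have h2 := h.t2 a b hab e
          have h3 := colN_cut hch e b
          have h4 := colN_cut' hch e a
          rw [hab] at h4
          rw [ht'] at h3 h4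
          have h5 := colN_anti c (colsOf t) b hj0
          have h6 : colN c (colsOf t) (Kt t e b) a = colN c (colsOf t) j a := by
            unfold colN
            congr 1
            ext j'
            simp only [mem_filter, mem_Ico]
            constructor
            · rintro ⟨⟨q1, q2⟩, q3⟩
              refine ⟨⟨?_, q2⟩, q3⟩
              by_contra hlt
              have r1 := colsOf_ht h j' b (by omega) e
              have r2 := hch.anti' a (show j' ≤ j by omega)
              have r3 := ht_succ (colsOf t j') a
              have r4 := ht_succ (colsOf t j) a
              simp only [q3, ha, if_true, if_false, hab] at r3 r4
              omega
            · rintro ⟨⟨q1, q2⟩, q3⟩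
              exact ⟨⟨by omega, q2⟩, q3⟩
          omega
    intro j
    by_cases hj : j ≤ 2 * c
    · exact hdown (2 * c - j) j (by omega)
    · have : ∀ i, colN c (colsOf t) j i = 0 := by
        intro i
        unfold colN
        rw [Finset.Ico_eq_empty (by omega)]
        simp
      rw [this, this]
      omega
  · intro l hl
    have hdown : ∀ d k, k + d = c → c ≤ lam l + colN c (colsOf t) (2 * k) l + k := by
      intro d
      induction d with
      | zero => intro k hk; omega
      | succ d ih =>
        intro k hk
        by_cases hlk : l ∈ colsOf t (2 * k)
        · have h1 := ih (k + 1) (by omega)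
          have h2 := colN_succ c (colsOf t) (2 * k) l (by omega)
          have h3 := colN_anti c (colsOf t) l (show 2 * k + 1 ≤ 2 * (k + 1) by omega)
          simp only [hlk, if_true] at h2
          omega
        · by_cases hex : ∃ j, j < 2 * k ∧ l ∈ colsOf t j
          · -- the largest such index
            have hne : ((Finset.range (2 * k)).filter fun j => l ∈ colsOf t j).Nonempty := by
              obtain ⟨j, hj1, hj2⟩ := hex
              exact ⟨j, by simp [hj1, hj2]⟩
            set j' := Finset.max' _ hne with hj'
            have hmem := Finset.max'_mem _ hne
            rw [← hj'] at hmem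
            simp only [mem_filter, Finset.mem_range] at hmem
            have hmax : ∀ j, j < 2 * k → l ∈ colsOf t j → j ≤ j' := by
              intro j q1 q2
              exact Finset.le_max' _ _ (by simp [q1, q2])
            set e := ht (colsOf t j') l with he
            have htpos : 0 < t e l := by
              rw [← congrFun (congrFun ht' e) l, tC, Finset.card_pos]
              exact ⟨j', by
                simp only [mem_filter, Finset.mem_range]
                exact ⟨by omega, hmem.2, rfl⟩⟩
            have h5 := h.t5 l hl e htpos
            have hK : Kt t e n ≤ 2 * k := by
              have r1 := colsOf_ht h (2 * k) n le_rfl e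
              have r2 := ht_succ (colsOf t (2 * k)) l
              have r3 := hch.anti' l (show j' ≤ 2 * k by omega)
              simp only [hlk, if_false, hl] at r2
              omega
            have hc : cnt t l e ≤ colN c (colsOf t) (2 * k) l := by
              rw [← ht', cnt_tC, ht']
              unfold colN
              apply Finset.card_le_card
              intro j
              simp only [mem_filter, mem_Ico, Finset.mem_range]
              rintro ⟨q1, q2, q3⟩
              refine ⟨⟨?_, q1⟩, q2⟩
              by_contra hlt
              have r1 := hmax j (by omega) q2
              have r2 := hch.anti' l r1
              omega
            omega
          · have h0 : colN c (colsOf t) 0 l = colN c (colsOf t) (2 * k) l := by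
              unfold colN
              congr 1
              ext j
              simp only [mem_filter, mem_Ico]
              constructor
              · rintro ⟨⟨q1, q2⟩, q3⟩
                refine ⟨⟨?_, q2⟩, q3⟩
                by_contra hlt
                exact hex ⟨j, by omega, q3⟩
              · rintro ⟨⟨q1, q2⟩, q3⟩
                exact ⟨⟨by omega, q2⟩, q3⟩
            have h1 := h.t1 l
            have h2 := colN_zero c (colsOf t) l
            rw [ht'] at h2
            omega
    intro k hk
    exact hdown (c - k) k (by omega)

end Mid

section Link

variable {n : ℕ}

theorem colN_empty (c : ℕ) (C : ℕ → Finset (Fin n)) {j : ℕ} (i : Fin n) (hj : 2 * c ≤ j) :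
    colN c C j i = 0 := by
  unfold colN
  rw [Finset.Ico_eq_empty (by omega)]
  simp

theorem pos_colN (c : ℕ) (p : Fin n → ℤ) (C : ℕ → Finset (Fin n)) (j : ℕ) (i : Fin n) :
    pos (2 * c) p C j i = p i + (colN c C j i : ℤ)
      - ∑ j' ∈ Finset.Ico j (2 * c), (if Even j' then (1 : ℤ) else 0) := by
  rw [pos_apply]
  rfl

theorem CG_iff (c : ℕ) (lam ν : Fin n → ℕ) (hlam : Antitone lam) (C : ℕ → Finset (Fin n))
    (hs : ∀ j, 2 * c ≤ j → C j = ∅) :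
    (Gd (2 * c) (fun i => (lam i : ℤ)) C ∧
      pos (2 * c) (fun i => (lam i : ℤ)) C 0 = fun i => (ν i : ℤ)) ↔ CG n c lam ν C := by
  have p0 := sum_parity_Ico c 0 (by omega)
  simp only [mul_zero] at p0
  constructor
  · rintro ⟨h, hend⟩
    refine ⟨⟨hs, ?_, ?_⟩, ?_, ?_, ?_⟩
    · intro i j
      by_cases hj : j < 2 * c
      · exact (h j hj).1.1 i
      · rw [hs (j + 1) (by omega), ht_empty]
        omega
    · intro k
      by_cases hk : 2 * k < 2 * c
      · exact (h (2 * k) hk).1.2 ⟨k, by ring⟩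
      · rw [hs (2 * k + 1) (by omega), hs (2 * k) (by omega)]
    · intro i
      have := congrFun hend i
      rw [pos_colN, p0] at this
      push_cast at this
      omega
    · intro a b hab j
      by_cases hj : j < 2 * c
      · have := (anti_iff _).1 (h j hj).2.1 a b hab
        rw [pos_colN, pos_colN] at this
        omega
      · rw [colN_empty _ _ _ (by omega), colN_empty _ _ _ (by omega)]
        have : lam b ≤ lam a := hlam (by rw [Fin.le_def]; omega)
        omega
    · intro l hl k hk
      rcases hk.lt_or_eq with hk' | hk'
      · have := (h (2 * k) (by omega)).2.2 l
        rw [pos_colN, sum_parity_Ico c k hk] at this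
        omega
      · omega
  · intro h
    refine ⟨?_, ?_⟩
    · intro j hj
      have hanti : Antitone (pos (2 * c) (fun i => (lam i : ℤ)) C j) := by
        rw [anti_iff]
        intro a b hab
        have := h.part a b hab j
        rw [pos_colN, pos_colN]
        omega
      refine ⟨⟨fun i => h.chain.anti i j, ?_⟩, hanti, ?_⟩
      · rintro ⟨k, hk⟩
        have := h.chain.par k
        rw [hk, ← two_mul]
        exact this
      · intro i
        have hn := i.2
        set l : Fin n := ⟨n - 1, by omega⟩ with hl
        have hl1 : (l : ℕ) + 1 = n := by simp only [hl]; omega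
        have hle : i ≤ l := by rw [Fin.le_def]; omega
        refine le_trans ?_ (hanti hle)
        rw [pos_colN]
        rcases Nat.even_or_odd' j with ⟨k, hk | hk⟩
        · have h1 := h.nonneg l hl1 k (by omega)
          rw [hk, sum_parity_Ico c k (by omega)]
          omega
        · have h1 := h.nonneg l hl1 (k + 1) (by omega)
          have h2 := colN_anti c C l (show 2 * k + 1 ≤ 2 * (k + 1) by omega)
          have h3 := sum_parity_Ico c k (by omega)
          rw [Finset.sum_eq_sum_Ico_succ_bot (by omega)] at h3
          simp only [even_two, Even.mul_right, if_true] at h3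
          rw [hk]
          omega
    · funext i
      rw [pos_colN, p0]
      have := h.fin i
      push_cast
      omega

theorem ext_inj (m : ℕ) (S : Finset (Fin n)) : Function.Injective (ext m S) := by
  intro f g h
  funext j
  have := congrFun h j
  simpa [ext] using this

theorem card_link (c : ℕ) (lam ν : Fin n → ℕ) (hlam : Antitone lam) :
    Nat.card {t // TM n c lam ν t} =
    (univ.filter fun f : Fin (2 * c) → Finset (Fin n) =>
      Gd (2 * c) (fun i => (lam i : ℤ)) (ext (2 * c) ∅ f) ∧
      pos (2 * c) (fun i => (lam i : ℤ)) (ext (2 * c) ∅ f) 0 = fun i => (ν i : ℤ)).card := by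
  have hsupp : ∀ (f : Fin (2 * c) → Finset (Fin n)) j, 2 * c ≤ j → ext (2 * c) ∅ f j = ∅ := by
    intro f j hj
    unfold ext
    rw [dif_neg (by omega)]
  have hE : {f : Fin (2 * c) → Finset (Fin n) //
      Gd (2 * c) (fun i => (lam i : ℤ)) (ext (2 * c) ∅ f) ∧
      pos (2 * c) (fun i => (lam i : ℤ)) (ext (2 * c) ∅ f) 0 = fun i => (ν i : ℤ)} ≃
      {t // TM n c lam ν t} := by
    refine Equiv.ofBijective
      (fun f => ⟨tC c (ext (2 * c) ∅ f.1), TM_of_CG ((CG_iff c lam ν hlam _ (hsupp _)).1 f.2)⟩) ⟨?_, ?_⟩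
    · intro f g h
      have h1 := congrArg Subtype.val h
      simp only at h1
      have hf := (CG_iff c lam ν hlam _ (hsupp _)).1 f.2
      have hg := (CG_iff c lam ν hlam _ (hsupp _)).1 g.2
      exact Subtype.ext (ext_inj _ _ (chain_inj c _ _ hf.chain hg.chain h1))
    · rintro ⟨t, ht⟩
      have hC := CG_of_TM hlam ht
      have he : ext (2 * c) ∅ (fun j : Fin (2 * c) => colsOf t j) = colsOf t := by
        funext j
        unfold ext
        split_ifs with hj
        · rfl
        · exact (hC.chain.supp j (by omega)).symm
      refine ⟨⟨fun j => colsOf t j, ?_⟩, ?_⟩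
      · rw [he]
        exact (CG_iff c lam ν hlam _ hC.chain.supp).2 hC
      · apply Subtype.ext
        simp only [he]
        exact tC_colsOf ht
  rw [← Nat.card_congr hE, Nat.card_eq_fintype_card, Fintype.card_subtype]

theorem TM_finite (c : ℕ) (lam ν : Fin n → ℕ) (hlam : Antitone lam) :
    Finite {t // TM n c lam ν t} := by
  have hinj : Function.Injective (fun t : {t // TM n c lam ν t} =>
      fun j : Fin (2 * c) => colsOf t.1 j) := by
    intro t s h
    have hC := CG_of_TM hlam t.2
    have hD := CG_of_TM hlam s.2
    have h1 : colsOf t.1 = colsOf s.1 := by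
      funext j
      by_cases hj : j < 2 * c
      · exact congrFun h ⟨j, hj⟩
      · rw [hC.chain.supp j (by omega), hD.chain.supp j (by omega)]
    apply Subtype.ext
    rw [← tC_colsOf t.2, ← tC_colsOf s.2, h1]
  exact Finite.of_injective _ hinj

end Link

section Fill

variable {n : ℕ}

/-- Row lengths. -/
def rl (c : ℕ) (lam ν : Fin n → ℕ) (i : Fin n) : ℕ := ν i + c - lam i

/-- Doubled column index of the `k`-th cell of row `i`. -/
def col (lam : Fin n → ℕ) (i : Fin n) (k : ℕ) : ℤ := 2 * ((lam i : ℤ) + k + 1)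

/-- The cells of the shape. -/
def cl (c : ℕ) (lam ν : Fin n → ℕ) : Finset (Fin n × ℤ) :=
  cellsOf n (fun i => 2 * (lam i : ℤ)) (fun i => 2 * (ν i : ℤ) + 2 * c)

theorem mem_cl (c : ℕ) (lam ν : Fin n → ℕ) (i : Fin n) (J : ℤ) :
    (i, J) ∈ cl c lam ν ↔ ∃ k < rl c lam ν i, J = col lam i k := by
  simp only [cl, cellsOf, mem_biUnion, mem_univ, true_and, mem_image, mem_filter, mem_Ioc,
    Prod.mk.injEq, rl, col]
  constructor
  · rintro ⟨a, J', ⟨⟨h1, h2⟩, h3⟩, rfl, rfl⟩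
    exact ⟨((J' - 2 * lam a) / 2 - 1).toNat, by omega, by omega⟩
  · rintro ⟨k, hk, rfl⟩
    exact ⟨i, _, ⟨⟨by omega, by omega⟩, by omega⟩, rfl, rfl⟩

theorem col_mem {c : ℕ} {lam ν : Fin n → ℕ} {i : Fin n} {k : ℕ} (hk : k < rl c lam ν i) :
    (i, col lam i k) ∈ cl c lam ν := (mem_cl _ _ _ _ _).2 ⟨k, hk, rfl⟩

theorem card_cl (c : ℕ) (lam ν : Fin n → ℕ) (Q : Fin n → ℤ → Prop) [∀ i J, Decidable (Q i J)] :
    ((cl c lam ν).filter (fun x => Q x.1 x.2)).card =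
      ∑ i, ((Finset.range (rl c lam ν i)).filter (fun k => Q i (col lam i k))).card := by
  rw [← Finset.card_sigma]
  symm
  apply Finset.card_nbij (fun x : (_ : Fin n) × ℕ => (x.1, col lam x.1 x.2))
  · rintro ⟨i, k⟩ h
    have h := mem_filter.1 (mem_sigma.1 h).2
    rw [Finset.mem_range] at h
    exact mem_filter.2 ⟨col_mem h.1, h.2⟩
  · rintro ⟨i, k⟩ _ ⟨i', k'⟩ _ h
    simp only [Prod.mk.injEq, col] at h
    obtain ⟨rfl, h⟩ := h
    have : k = k' := by omega
    rw [this]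
  · rintro ⟨i, J⟩ h
    simp only [coe_filter, Set.mem_ofPred_eq] at h
    obtain ⟨k, hk, rfl⟩ := (mem_cl _ _ _ _ _).1 h.1
    refine ⟨⟨i, k⟩, ?_, rfl⟩
    simp only [coe_sigma, Set.mem_sigma_iff, coe_univ, Set.mem_univ, true_and, coe_filter,
      Set.mem_ofPred_eq, Finset.mem_range]
    exact ⟨hk, h.2⟩

/-- Matrix attached to a filling. -/
def tF (c : ℕ) (lam ν : Fin n → ℕ) (F : Fin n → ℤ → ℕ) (e : ℕ) (i : Fin n) : ℕ :=
  ((Finset.range (rl c lam ν i)).filter (fun k => F i (col lam i k) = e + 1)).card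

theorem count_e (c : ℕ) (lam ν : Fin n → ℕ) (F : Fin n → ℤ → ℕ) (e : ℕ) :
    ((cl c lam ν).filter (fun x => F x.1 x.2 = e + 1)).card = Kt (tF c lam ν F) e n := by
  rw [card_cl c lam ν (fun i J => F i J = e + 1), Kt_top]
  rfl

theorem lat_count (c : ℕ) (lam ν : Fin n → ℕ) (F : Fin n → ℤ → ℕ) (e : ℕ) (i : Fin n) (J : ℤ) :
    ((cl c lam ν).filter
      (fun x => (x.1 < i ∨ (x.1 = i ∧ J ≤ x.2)) ∧ F x.1 x.2 = e + 1)).card =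
    Kt (tF c lam ν F) e i + ((Finset.range (rl c lam ν i)).filter
      (fun k => J ≤ col lam i k ∧ F i (col lam i k) = e + 1)).card := by
  rw [card_cl c lam ν (fun a J' => (a < i ∨ (a = i ∧ J ≤ J')) ∧ F a J' = e + 1)]
  unfold Kt
  rw [Finset.sum_filter, show ((Finset.range (rl c lam ν i)).filter
      (fun k => J ≤ col lam i k ∧ F i (col lam i k) = e + 1)).card =
      ∑ a, if a = i then ((Finset.range (rl c lam ν a)).filter
      (fun k => J ≤ col lam a k ∧ F a (col lam a k) = e + 1)).card else 0 by simp,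
    ← Finset.sum_add_distrib]
  apply Finset.sum_congr rfl
  intro a _
  rcases lt_trichotomy a i with h | h | h
  · have h1 : (a : ℕ) < i := h
    have h2 : a ≠ i := h.ne
    simp only [h, h1, h2, true_or, true_and, if_true, if_false, add_zero, tF]
  · subst h
    simp
  · have h1 : ¬ (a : ℕ) < i := by rw [Fin.lt_def] at h; omega
    have h2 : a ≠ i := h.ne'
    have h3 : ¬ a < i := h.not_gt
    simp [h1, h2, h3]

/-- Valid fillings. -/
def VF (c : ℕ) (lam ν : Fin n → ℕ) (μ : Fin n → ℕ) (F : Fin n → ℤ → ℕ) : Prop :=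
  IsLRFilling n (fun i => 2 * (lam i : ℤ)) (fun i => 2 * (ν i : ℤ) + 2 * c) μ F ∧
    StarCond n (fun i => 2 * (lam i : ℤ)) (fun i => 2 * (ν i : ℤ) + 2 * c) (2 * c) F

theorem row_mono {c : ℕ} {lam ν μ : Fin n → ℕ} {F : Fin n → ℤ → ℕ} (h : VF c lam ν μ F)
    (i : Fin n) (d k : ℕ) (hk : k + d < rl c lam ν i) :
    F i (col lam i k) ≤ F i (col lam i (k + d)) := by
  induction d with
  | zero => exact le_rfl
  | succ d ih =>
    refine (ih (by omega)).trans ?_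
    have h1 := h.1.2.2.2.1 i (col lam i (k + d)) (col_mem (by omega))
    have e : col lam i (k + d) + 2 = col lam i (k + (d + 1)) := by
      simp only [col]; push_cast; ring
    rw [e] at h1
    exact h1 (col_mem hk)

theorem cnt_tF {c : ℕ} {lam ν μ : Fin n → ℕ} {F : Fin n → ℤ → ℕ} (h : VF c lam ν μ F)
    (i : Fin n) (v : ℕ) : cnt (tF c lam ν F) i v =
      ((Finset.range (rl c lam ν i)).filter (fun k => F i (col lam i k) ≤ v)).card := by
  induction v with
  | zero =>
    rw [cnt_zero]
    symm
    rw [Finset.card_eq_zero, Finset.filter_eq_empty_iff]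
    intro k hk
    have := (h.1.2.2.1 i (col lam i k) (col_mem (Finset.mem_range.1 hk))).1
    omega
  | succ v ih =>
    rw [cnt_succ, ih, tF, ← Finset.card_union_of_disjoint]
    · congr 1
      ext j
      simp only [mem_union, mem_filter, Finset.mem_range]
      rw [Nat.le_succ_iff]
      tauto
    · rw [Finset.disjoint_filter]
      intro k _ h1 h2
      omega

theorem low_F {c : ℕ} {lam ν μ : Fin n → ℕ} {F : Fin n → ℤ → ℕ} (h : VF c lam ν μ F)
    (i : Fin n) (v k : ℕ) (hk : k < rl c lam ν i) :
    F i (col lam i k) ≤ v ↔ k < cnt (tF c lam ν F) i v := by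
  rw [cnt_tF h, ← low_card]
  · simp [hk]
  · intro a b hab
    simp only [mem_filter, Finset.mem_range]
    rintro ⟨h1, h2⟩
    have := row_mono h i (b - a) a (by omega)
    rw [show a + (b - a) = b by omega] at this
    exact ⟨by omega, by omega⟩

theorem cnt_le_rl {c : ℕ} {lam ν μ : Fin n → ℕ} {F : Fin n → ℤ → ℕ} (h : VF c lam ν μ F)
    (i : Fin n) (v : ℕ) : cnt (tF c lam ν F) i v ≤ rl c lam ν i := by
  rw [cnt_tF h]
  refine (Finset.card_filter_le _ _).trans ?_
  simp

theorem F_inj {c : ℕ} {lam ν μ μ' : Fin n → ℕ} {F F' : Fin n → ℤ → ℕ} (h : VF c lam ν μ F)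
    (h' : VF c lam ν μ' F') (ht : tF c lam ν F = tF c lam ν F') : F = F' := by
  funext i J
  by_cases hJ : (i, J) ∈ cl c lam ν
  · obtain ⟨k, hk, rfl⟩ := (mem_cl _ _ _ _ _).1 hJ
    have key : ∀ v, F i (col lam i k) ≤ v ↔ F' i (col lam i k) ≤ v := by
      intro v
      rw [low_F h i v k hk, low_F h' i v k hk, ht]
    have k1 := key (F i (col lam i k))
    have k2 := key (F' i (col lam i k))
    omega
  · rw [h.1.2.1 i J hJ, h'.1.2.1 i J hJ]

theorem TM_of_VF {c : ℕ} {lam ν μ : Fin n → ℕ} {F : Fin n → ℤ → ℕ} (hlam : Antitone lam)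
    (hν : Antitone ν) (hμ : ∀ i, Even (μ i) ∧ μ i ≤ 2 * c) (h : VF c lam ν μ F) :
    TM n c lam ν (tF c lam ν F) := by
  have hle : ∀ i, lam i ≤ ν i + c := by
    intro i
    have := (h.1.1 i).1
    simp only at this
    omega
  have ht0 : ∀ e i, n ≤ e → tF c lam ν F e i = 0 := by
    intro e i he
    unfold tF
    rw [Finset.card_eq_zero, Finset.filter_eq_empty_iff]
    intro k hk
    have := (h.1.2.2.1 i (col lam i k) (col_mem (Finset.mem_range.1 hk))).2
    omega
  refine ⟨ht0, ?_, ?_, ?_, ?_, ?_⟩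
  · intro i
    rw [cnt_tF h, Finset.filter_true_of_mem]
    · have := hle i
      rw [Finset.card_range, rl]
      omega
    · intro k hk
      exact (h.1.2.2.1 i (col lam i k) (col_mem (Finset.mem_range.1 hk))).2
  · intro a b hab e
    by_contra hlt
    push Not at hlt
    have hab' : a < b := by rw [Fin.lt_def]; omega
    have h1 := hlam hab'.le
    have h2 := hν hab'.le
    set x := cnt (tF c lam ν F) a e with hx
    have hxl := cnt_le_rl h a e
    have hyl := cnt_le_rl h b (e + 1)
    have hk' : lam a + x - lam b < rl c lam ν b := by omega
    have h3 := (low_F h b (e + 1) (lam a + x - lam b) hk').2 (by omega)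
    have h4 := hle a
    have h5 := hle b
    by_cases hxa : x < rl c lam ν a
    · have e1 : col lam b (lam a + x - lam b) = col lam a x := by
        simp only [col]; omega
      have m1 := col_mem (lam := lam) hk'
      rw [e1] at m1 h3
      have h6 := h.1.2.2.2.2.1 a b (col lam a x) hab' (col_mem hxa) m1
      have h7 := (low_F h a e x hxa).1 (by omega)
      omega
    · simp only [rl] at *
      omega
  · intro i e
    have h1 := h.1.2.2.2.2.2.2 i (col lam i (cnt (tF c lam ν F) i (e + 1))) e
    have h2 := lat_count c lam ν F (e + 1) i (col lam i (cnt (tF c lam ν F) i (e + 1)))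
    have h3 := lat_count c lam ν F e i (col lam i (cnt (tF c lam ν F) i (e + 1)))
    change (Finset.card ((cl c lam ν).filter _)) ≤ Finset.card ((cl c lam ν).filter _) at h1
    rw [h3] at h1
    change _ = _ at h2
    rw [show e + 1 + 1 = e + 2 from rfl] at h2
    rw [h2] at h1
    have e1 : ((Finset.range (rl c lam ν i)).filter (fun k =>
        col lam i (cnt (tF c lam ν F) i (e + 1)) ≤ col lam i k ∧ F i (col lam i k) = e + 1)).card
        = 0 := by
      rw [Finset.card_eq_zero, Finset.filter_eq_empty_iff]
      rintro k hk ⟨q1, q2⟩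
      have := (low_F h i (e + 1) k (Finset.mem_range.1 hk)).1 (by omega)
      simp only [col] at q1
      omega
    have e2 : ((Finset.range (rl c lam ν i)).filter (fun k =>
        col lam i (cnt (tF c lam ν F) i (e + 1)) ≤ col lam i k ∧ F i (col lam i k) = e + 2)).card
        = tF c lam ν F (e + 1) i := by
      change _ = ((Finset.range (rl c lam ν i)).filter
        (fun k => F i (col lam i k) = e + 1 + 1)).card
      congr 1
      apply Finset.filter_congr
      intro k hk
      have := low_F h i (e + 1) k (Finset.mem_range.1 hk)
      constructor
      · exact fun q => q.2
      · intro q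
        refine ⟨?_, q⟩
        have h5 : ¬ k < cnt (tF c lam ν F) i (e + 1) := by
          rw [← this]; omega
        simp only [col]
        omega
    rw [e1, e2] at h1
    rw [Kt_succ]
    exact h1
  · intro e
    by_cases he : e < n
    · have := h.1.2.2.2.2.2.1 ⟨e, he⟩
      change (Finset.card ((cl c lam ν).filter _)) = _ at this
      rw [count_e] at this
      rw [this]
      exact hμ _
    · have : Kt (tF c lam ν F) e n = 0 := by
        rw [Kt_top]
        apply Finset.sum_eq_zero
        intro a _
        exact ht0 e a (by omega)
      rw [this]
      simp
  · intro l hl e hpos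
    unfold tF at hpos
    rw [Finset.card_pos] at hpos
    obtain ⟨k, hk⟩ := hpos
    simp only [mem_filter, Finset.mem_range] at hk
    set x := cnt (tF c lam ν F) l e with hx
    have h1 := low_F h l e k hk.1
    have hxk : x ≤ k := by omega
    have h2 := low_F h l e x (by omega)
    have h3 := row_mono h l (k - x) x (by omega)
    rw [show x + (k - x) = k by omega] at h3
    have h4 : F l (col lam l x) = e + 1 := by omega
    have h5 := h.2 l hl (col lam l x) (col_mem (by omega))
    change _ ≤ ((Finset.card ((cl c lam ν).filter _) : ℕ) : ℤ) at h5
    rw [h4] at h5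
    have h6 : ((cl c lam ν).filter (fun y => F y.1 y.2 = e + 1 ∧ col lam l x < y.2)).card
        < ((cl c lam ν).filter (fun y => F y.1 y.2 = e + 1)).card := by
      apply Finset.card_lt_card
      rw [Finset.ssubset_iff_of_subset]
      · refine ⟨(l, col lam l x), ?_, ?_⟩
        · rw [mem_filter]
          exact ⟨col_mem (by omega), h4⟩
        · simp
      · intro y
        simp only [mem_filter]
        tauto
    rw [count_e] at h6
    have h7 : col lam l x = 2 * ((lam l : ℤ) + x + 1) := rfl
    omega

/-- Filling attached to a matrix. -/
def fil (c : ℕ) (lam ν : Fin n → ℕ) (t : ℕ → Fin n → ℕ) (i : Fin n) (J : ℤ) : ℕ :=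
  if (i, J) ∈ cl c lam ν then
    ((Finset.range (n + 1)).filter (fun v => 2 * (lam i : ℤ) + 2 * (cnt t i v : ℤ) < J)).card
  else 0

theorem TM.rl {c : ℕ} {lam ν : Fin n → ℕ} {t : ℕ → Fin n → ℕ} (h : TM n c lam ν t)
    (i : Fin n) : cnt t i n = rl c lam ν i := by
  have := h.t1 i
  unfold SpProof.rl
  omega

theorem TM.cnt_le {c : ℕ} {lam ν : Fin n → ℕ} {t : ℕ → Fin n → ℕ} (h : TM n c lam ν t)
    (i : Fin n) (v : ℕ) : cnt t i v ≤ SpProof.rl c lam ν i := by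
  rw [← h.rl]
  rcases le_total v n with hv | hv
  · exact cnt_mono t i hv
  · apply le_of_eq
    symm
    unfold cnt
    apply Finset.sum_subset
    · intro a
      simp only [Finset.mem_range]
      omega
    · intro a _ ha
      exact h.t0 a i (by simpa using ha)

theorem fil_low {c : ℕ} {lam ν : Fin n → ℕ} {t : ℕ → Fin n → ℕ} (h : TM n c lam ν t)
    (i : Fin n) (k v : ℕ) (hk : k < rl c lam ν i) :
    fil c lam ν t i (col lam i k) ≤ v ↔ k < cnt t i v := by
  have key : v < fil c lam ν t i (col lam i k) ↔ v < n + 1 ∧ cnt t i v ≤ k := by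
    unfold fil
    rw [if_pos (col_mem hk), ← low_card]
    · simp only [mem_filter, Finset.mem_range]
      simp only [col]
      constructor
      · rintro ⟨h1, h2⟩
        exact ⟨h1, by omega⟩
      · rintro ⟨h1, h2⟩
        exact ⟨h1, by omega⟩
    · intro a b hab
      simp only [mem_filter, Finset.mem_range]
      rintro ⟨h1, h2⟩
      have := cnt_mono t i hab
      exact ⟨by omega, by omega⟩
  rcases le_or_gt v n with hv | hv
  · omega
  · have h1 := cnt_mono t i hv.le
    rw [h.rl] at h1
    omega

theorem tF_fil {c : ℕ} {lam ν : Fin n → ℕ} {t : ℕ → Fin n → ℕ} (h : TM n c lam ν t) :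
    tF c lam ν (fil c lam ν t) = t := by
  funext e i
  have : (Finset.range (rl c lam ν i)).filter (fun k => fil c lam ν t i (col lam i k) = e + 1)
      = Finset.Ico (cnt t i e) (cnt t i (e + 1)) := by
    ext k
    simp only [mem_filter, Finset.mem_range, mem_Ico]
    constructor
    · rintro ⟨h1, h2⟩
      have h3 := fil_low h i k e h1
      have h4 := fil_low h i k (e + 1) h1
      omega
    · rintro ⟨h1, h2⟩
      have h0 := h.cnt_le i (e + 1)
      have h3 := fil_low h i k e (by omega)
      have h4 := fil_low h i k (e + 1) (by omega)
      omega
  unfold tF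
  rw [this, Nat.card_Ico, cnt_succ]
  omega

theorem TM.col_strict {c : ℕ} {lam ν : Fin n → ℕ} {t : ℕ → Fin n → ℕ} (h : TM n c lam ν t)
    (u : ℕ) (a : Fin n) (d : ℕ) : ∀ b : Fin n, (a : ℕ) + (d + 1) = b →
    lam b + cnt t b (u + 1) ≤ lam a + cnt t a u := by
  induction d with
  | zero =>
    intro b hb
    exact h.t2 a b hb u
  | succ d ih =>
    intro b hb
    have h1 := ih ⟨a + (d + 1), by omega⟩ rfl
    have h2 := h.t2 ⟨a + (d + 1), by omega⟩ b (by simp only; omega) u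
    have h3 := cnt_mono t ⟨a + (d + 1), by omega⟩ (Nat.le_succ u)
    simp only [Nat.succ_eq_add_one] at h3
    omega

theorem fil_VF {c : ℕ} {lam ν : Fin n → ℕ} (hlam : Antitone lam)
    {t : ℕ → Fin n → ℕ} (h : TM n c lam ν t) :
    VF c lam ν (fun e => Kt t e n) (fil c lam ν t) := by
  have htF := tF_fil h
  have hpos : ∀ i k, k < rl c lam ν i → 1 ≤ fil c lam ν t i (col lam i k) := by
    intro i k hk
    have := fil_low h i k 0 hk
    rw [cnt_zero] at this
    omega
  have hcol : ∀ i i' : Fin n, ∀ k k', i < i' → k < rl c lam ν i → k' < rl c lam ν i' →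
      lam i + k = lam i' + k' →
      fil c lam ν t i (col lam i k) < fil c lam ν t i' (col lam i' k') := by
    intro i i' k k' hii hk hk' he
    have h1 := hpos i' k' hk'
    obtain ⟨u, hu⟩ := Nat.exists_eq_add_of_le' h1
    have h2 := (fil_low h i' k' (u + 1) hk').1 (by omega)
    rw [Fin.lt_def] at hii
    have h3 := h.col_strict u i (i' - i - 1) i' (by omega)
    have h4 := (fil_low h i k u hk).2 (by omega)
    omega
  have hrow : ∀ i k k', k ≤ k' → k' < rl c lam ν i →
      fil c lam ν t i (col lam i k) ≤ fil c lam ν t i (col lam i k') := by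
    intro i k k' hkk hk'
    rw [fil_low h i k _ (by omega)]
    have := (fil_low h i k' _ hk').1 le_rfl
    omega
  refine ⟨⟨?_, ?_, ?_, ?_, ?_, ?_, ?_⟩, ?_⟩
  · intro i
    have := h.t1 i
    simp only
    exact ⟨by omega, by omega⟩
  · intro i J hJ
    exact if_neg hJ
  · intro i J hJ
    obtain ⟨k, hk, rfl⟩ := (mem_cl c lam ν i J).1 hJ
    refine ⟨hpos i k hk, ?_⟩
    rw [fil_low h i k n hk, h.rl]
    exact hk
  · intro i J hJ hJ'
    obtain ⟨k, hk, rfl⟩ := (mem_cl c lam ν i J).1 hJ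
    obtain ⟨k', hk', e⟩ := (mem_cl c lam ν i _).1 hJ'
    rw [e]
    apply hrow i k k' _ hk'
    simp only [col] at e
    omega
  · intro i i' J hii hJ hJ'
    obtain ⟨k, hk, rfl⟩ := (mem_cl c lam ν i J).1 hJ
    obtain ⟨k', hk', e⟩ := (mem_cl c lam ν i' _).1 hJ'
    have := hcol i i' k k' hii hk hk' (by simp only [col] at e; omega)
    rw [← e] at this
    exact this
  · intro e
    change (Finset.card ((cl c lam ν).filter _)) = _
    rw [count_e, htF]
  · intro i J e
    have h2 := lat_count c lam ν (fil c lam ν t) (e + 1) i J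
    have h3 := lat_count c lam ν (fil c lam ν t) e i J
    change (Finset.card ((cl c lam ν).filter _)) ≤ Finset.card ((cl c lam ν).filter _)
    rw [show e + 1 + 1 = e + 2 from rfl] at h2
    rw [h2, h3, htF]
    have h4 : ((Finset.range (rl c lam ν i)).filter (fun k =>
        J ≤ col lam i k ∧ fil c lam ν t i (col lam i k) = e + 2)).card ≤ t (e + 1) i := by
      conv_rhs => rw [← htF]
      unfold tF
      apply Finset.card_le_card
      intro k
      simp only [mem_filter]
      tauto
    have h5 := h.t3 i e
    rw [Kt_succ] at h5
    omega
  · intro l hl J hJ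
    obtain ⟨k, hk, rfl⟩ := (mem_cl c lam ν l J).1 hJ
    change _ ≤ ((Finset.card ((cl c lam ν).filter _) : ℕ) : ℤ)
    obtain ⟨e, he⟩ := Nat.exists_eq_add_of_le' (hpos l k hk)
    rw [he]
    have h1 := fil_low h l k e hk
    have h2 := fil_low h l k (e + 1) hk
    have h3 := cnt_succ t l e
    have h5 := h.t5 l hl e (by omega)
    have h6 : ((cl c lam ν).filter (fun y => fil c lam ν t y.1 y.2 = e + 1)).card
        ≤ ((cl c lam ν).filter (fun y => fil c lam ν t y.1 y.2 = e + 1 ∧ col lam l k < y.2)).card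
        + (Finset.Icc (cnt t l e) k).card := by
      rw [← Finset.card_image_of_injective (Finset.Icc (cnt t l e) k)
        (f := fun k' => (l, col lam l k'))]
      · refine le_trans (Finset.card_le_card ?_) (Finset.card_union_le _ _)
        rintro ⟨a, J'⟩ hy
        rw [mem_filter] at hy
        obtain ⟨hy1, hy2⟩ := hy
        simp only at hy2
        obtain ⟨k2, hk2, rfl⟩ := (mem_cl c lam ν a J').1 hy1
        rw [mem_union]
        by_cases hJJ : col lam l k < col lam a k2
        · left
          rw [mem_filter]
          exact ⟨hy1, hy2, hJJ⟩
        · right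
          by_cases hal : a = l
          · subst hal
            rw [mem_image]
            refine ⟨k2, ?_, rfl⟩
            have := fil_low h a k2 e hk2
            rw [mem_Icc]
            simp only [col] at hJJ
            omega
          · exfalso
            have hlt : a < l := by
              rw [Fin.lt_def]
              have : (a : ℕ) ≠ l := fun q => hal (Fin.ext q)
              omega
            have hl' := hlam hlt.le
            simp only [col] at hJJ
            have q1 := hcol a l k2 (lam a + k2 - lam l) hlt hk2 (by omega) (by omega)
            have q2 := hrow l (lam a + k2 - lam l) k (by omega) hk
            omega
      · intro k1 k2 hkk
        simp only [Prod.mk.injEq, col] at hkk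
        omega
    rw [count_e, htF, Nat.card_Icc] at h6
    have h7 : col lam l k = 2 * ((lam l : ℤ) + k + 1) := rfl
    omega

theorem LR_sum (c : ℕ) (lam ν : Fin n → ℕ) (hlam : Antitone lam) (hν : Antitone ν) :
    ∑ μ ∈ ((Fintype.piFinset fun _ : Fin n => Finset.range (2 * c + 1)).filter
                (fun μ => Antitone μ ∧ ∀ i, Even (μ i))),
      LRbar n (fun i => 2 * (lam i : ℤ)) (fun i => 2 * (ν i : ℤ) + 2 * c) μ (2 * c)
    = Nat.card {t // TM n c lam ν t} := by
  set M := ((Fintype.piFinset fun _ : Fin n => Finset.range (2 * c + 1)).filter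
                (fun μ => Antitone μ ∧ ∀ i, Even (μ i))) with hM
  have hMm : ∀ μ ∈ M, ∀ i, Even (μ i) ∧ μ i ≤ 2 * c := by
    intro μ hμ i
    rw [hM, mem_filter, Fintype.mem_piFinset] at hμ
    have := Finset.mem_range.1 (hμ.1 i)
    exact ⟨hμ.2.2 i, by omega⟩
  have hfin := TM_finite c lam ν hlam
  let Φ : (Σ μ : M, {F // VF c lam ν μ.1 F}) → {t // TM n c lam ν t} :=
    fun x => ⟨tF c lam ν x.2.1, TM_of_VF hlam hν (hMm x.1.1 x.1.2) x.2.2⟩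
  have hΦ : Function.Bijective Φ := by
    constructor
    · rintro ⟨⟨μ, hμ⟩, F, hF⟩ ⟨⟨μ', hμ'⟩, F', hF'⟩ hh
      have h1 := congrArg Subtype.val hh
      simp only [Φ] at h1
      have h2 := F_inj hF hF' h1
      subst h2
      have h3 : μ = μ' := by
        funext e
        exact (hF.1.2.2.2.2.2.1 e).symm.trans (hF'.1.2.2.2.2.2.1 e)
      subst h3
      rfl
    · rintro ⟨t, ht⟩
      refine ⟨⟨⟨fun e => Kt t e n, ?_⟩, fil c lam ν t, fil_VF hlam ht⟩, ?_⟩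
      · rw [hM, mem_filter, Fintype.mem_piFinset]
        refine ⟨?_, ?_, ?_⟩
        · intro e
          have := (ht.t4 e).2
          rw [Finset.mem_range]
          omega
        · intro a b hab
          exact ht.Kanti n le_rfl hab
        · intro e
          exact (ht.t4 e).1
      · apply Subtype.ext
        exact tF_fil ht
  have hsf : Finite (Σ μ : M, {F // VF c lam ν μ.1 F}) := Finite.of_injective Φ hΦ.1
  have hff : ∀ μ : M, Finite {F // VF c lam ν μ.1 F} := by
    intro μ
    exact Finite.of_injective (fun F => (⟨μ, F⟩ : Σ μ : M, {F // VF c lam ν μ.1 F}))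
      (fun a b hab => by simpa using hab)
  rw [← Nat.card_congr (Equiv.ofBijective Φ hΦ), Nat.card_sigma, ← Finset.sum_coe_sort M]
  rfl

end Fill

section Final

variable {n : ℕ}

theorem Xv_ne (n : ℕ) (i : Fin n) : Xv n i ≠ 0 := by
  unfold Xv
  rw [Ne, IsFractionRing.to_map_eq_zero_iff]
  exact MvPolynomial.X_ne_zero i

/-- The variables as units. -/
def yv (n : ℕ) : Fin n → (FF n)ˣ := fun i => Units.mk0 (Xv n i) (Xv_ne n i)

theorem spWeyl_eq (n : ℕ) (p : Fin n → ℤ) :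
    spWeyl n p (Xv n) = (aDet (p + rho n) : TF n (FF n)) (yv n) / (aDet (rho n) : TF n (FF n)) (yv n) := by
  unfold spWeyl aDet yv rho
  simp only [Units.val_mk0, Pi.add_apply, add_sub_assoc]

theorem main (n c : ℕ) (lam : Fin n → ℕ) (hlam : Antitone lam) :
    spWeyl n (fun _ : Fin n => (c : ℤ)) (Xv n) *
        spWeyl n (fun i => (lam i : ℤ)) (Xv n)
      = ∑ ν ∈ ((Fintype.piFinset fun i : Fin n => Finset.range (lam i + c + 1)).filter
            (fun ν => Antitone ν)),
          spWeyl n (fun i => (ν i : ℤ)) (Xv n) *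
            (∑ μ ∈ ((Fintype.piFinset fun _ : Fin n => Finset.range (2 * c + 1)).filter
                (fun μ => Antitone μ ∧ ∀ i, Even (μ i))),
              (LRbar n (fun i => 2 * (lam i : ℤ)) (fun i => 2 * (ν i : ℤ) + 2 * c)
                  μ (2 * c) : FF n)) := by
  set N := ((Fintype.piFinset fun i : Fin n => Finset.range (lam i + c + 1)).filter
            (fun ν => Antitone ν)) with hN
  set P : Fin n → ℤ := fun i => (lam i : ℤ) with hP
  have hdom : dom P := by
    refine ⟨?_, ?_⟩
    · intro a b hab
      have := hlam hab
      simp only [hP]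
      exact_mod_cast this
    · intro i
      simp [hP]
  have h1 : ∀ ν ∈ N, (∑ μ ∈ ((Fintype.piFinset fun _ : Fin n => Finset.range (2 * c + 1)).filter
                (fun μ => Antitone μ ∧ ∀ i, Even (μ i))),
              (LRbar n (fun i => 2 * (lam i : ℤ)) (fun i => 2 * (ν i : ℤ) + 2 * c)
                  μ (2 * c) : FF n)) =
      (((univ.filter fun f : Fin (2 * c) → Finset (Fin n) =>
      Gd (2 * c) P (ext (2 * c) ∅ f) ∧
      pos (2 * c) P (ext (2 * c) ∅ f) 0 = fun i => (ν i : ℤ)).card : ℕ) : FF n) := by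
    intro ν hν
    rw [hN, mem_filter] at hν
    rw [← card_link c lam ν hlam, ← LR_sum c lam ν hlam hν.2]
    push_cast
    rfl
  have hE : (aDet (P + rho n) : TF n (FF n)) (yv n) * (G (FF n) (2 * c) ∅ : TF n (FF n)) (yv n) = _ :=
    congrFun (expand (K := FF n) c P hdom) (yv n)
  have hR : (aDet (rho n) : TF n (FF n)) (yv n) * (G (FF n) (2 * c) ∅ : TF n (FF n)) (yv n) = _ :=
    congrFun (rect (K := FF n) (n := n) c) (yv n)
  rw [Finset.sum_congr rfl (fun ν hν => by rw [h1 ν hν])]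
  simp only [spWeyl_eq]
  rw [← hR]
  set D := (aDet (rho n) : TF n (FF n)) (yv n) with hD
  by_cases hD0 : D = 0
  · simp [hD0]
  rw [mul_div_cancel_left₀ _ hD0, mul_comm ((G (FF n) (2 * c) ∅ : TF n (FF n)) (yv n)), div_mul_eq_mul_div, hE, Finset.sum_apply, Finset.sum_div]
  -- group the terms by their end point
  have hmap : ∀ f : Fin (2 * c) → Finset (Fin n), Gd (2 * c) P (ext (2 * c) ∅ f) →
      ∃ ν ∈ N, pos (2 * c) P (ext (2 * c) ∅ f) 0 = fun i => (ν i : ℤ) := by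
    intro f hf
    have hd : dom (pos (2 * c) P (ext (2 * c) ∅ f) 0) := by
      rcases Nat.eq_zero_or_pos c with hc | hc
      · subst hc
        have h0 : pos (2 * 0) P (ext (2 * 0) ∅ f) 0 = P := pos_self _ _ _
        rw [h0]
        exact hdom
      · exact (hf 0 (by omega)).2
    refine ⟨fun i => (pos (2 * c) P (ext (2 * c) ∅ f) 0 i).toNat, ?_, ?_⟩
    · rw [hN, mem_filter, Fintype.mem_piFinset]
      constructor
      · intro i
        rw [Finset.mem_range, pos_colN]
        have p0 := sum_parity_Ico c 0 (by omega)
        simp only [mul_zero] at p0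
        rw [p0]
        have : colN c (ext (2 * c) ∅ f) 0 i ≤ 2 * c := by
          unfold colN
          refine (Finset.card_filter_le _ _).trans ?_
          simp
        simp only [hP]
        omega
      · intro a b hab
        exact Int.toNat_le_toNat (hd.1 hab)
    · funext i
      exact (Int.toNat_of_nonneg (hd.2 i)).symm
  have hterm : ∀ f : Fin (2 * c) → Finset (Fin n),
      (if Gd (2 * c) P (ext (2 * c) ∅ f) then
        (aDet (pos (2 * c) P (ext (2 * c) ∅ f) 0 + rho n) : TF n (FF n)) else 0) (yv n) / D =
      ∑ ν ∈ N, if Gd (2 * c) P (ext (2 * c) ∅ f) ∧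
          pos (2 * c) P (ext (2 * c) ∅ f) 0 = (fun i => (ν i : ℤ)) then
        (aDet ((fun i => (ν i : ℤ)) + rho n) : TF n (FF n)) (yv n) / D else 0 := by
    intro f
    by_cases hf : Gd (2 * c) P (ext (2 * c) ∅ f)
    · obtain ⟨ν, hν, he⟩ := hmap f hf
      rw [if_pos hf, Finset.sum_eq_single ν]
      · rw [if_pos ⟨hf, he⟩, he]
      · intro ν' _ hne
        rw [if_neg]
        rintro ⟨_, h⟩
        apply hne
        rw [he] at h
        funext i
        have := congrFun h i
        omega
      · intro h
        exact absurd hν h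
    · rw [if_neg hf]
      symm
      simp only [hf, false_and, if_false, Finset.sum_const_zero]
      exact (zero_div D).symm
  rw [Finset.sum_congr rfl (fun f _ => hterm f), Finset.sum_comm]
  apply Finset.sum_congr rfl
  intro ν _
  rw [← Finset.sum_filter, Finset.sum_const, nsmul_eq_mul, mul_comm]

end Final

end SpProof

/-- `sp_{2n}((c^n)) · sp_{2n}(λ) = ∑_{ν ⊆ λ+(c^n)} sp_{2n}(ν) ·
∑_{μ ⊆ ((2c)^n), μ even} LRbar^{ν+(c^n)}_{λ,μ}(c)` (LRbar in doubled
coordinates). -/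
theorem spWeylRect_mul_spWeyl
    (n c : ℕ) (lam : Fin n → ℕ) (hlam : Antitone lam) :
    spWeyl n (fun _ : Fin n => (c : ℤ)) (Xv n) *
        spWeyl n (fun i => (lam i : ℤ)) (Xv n)
      = ∑ ν ∈ ((Fintype.piFinset fun i : Fin n => Finset.range (lam i + c + 1)).filter
            (fun ν => Antitone ν)),
          spWeyl n (fun i => (ν i : ℤ)) (Xv n) *
            (∑ μ ∈ ((Fintype.piFinset fun _ : Fin n => Finset.range (2 * c + 1)).filter
                (fun μ => Antitone μ ∧ ∀ i, Even (μ i))),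
              (LRbar n (fun i => 2 * (lam i : ℤ)) (fun i => 2 * (ν i : ℤ) + 2 * c)
                  μ (2 * c) : FF n)) := by
  exact SpProof.main n c lam hlam

end
end
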